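/- Fix λ > 0 and ε ∈ (0,1). Set A = N·e^{-ε√(log N)}, Q = (log N)^λ, τ = A²·N^{-1}·Q^{-1}. There is a constant c₄ > 0 such that for all sufficiently large even N, for every q with 1 ≤ q ≤ Q, every a with 0 ≤ a ≤ q−1 and gcd(a,q) = 1, and every real α with |α − a/q| ≤ 1/τ, writing β = α − a/q, one has F̃(α,A) = (C_q(2a)/φ(q)) · Σ_{2 < n ≤ A} e^{2πiβ·2n} + O(A·e^{-c₄√(log N)}). -/

import Mathlib

open Finset Real
open scoped BigOperators Classical

/-- `e(x) = exp(2πix)`. -/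
noncomputable def e (x : ℝ) : ℂ := Complex.exp (2 * Real.pi * Complex.I * x)

/-- The Ramanujan sum `C_q(m) = Σ_{a=1,(a,q)=1}^{q} e(ma/q)`. -/
noncomputable def ramanujanC (q : ℕ) (m : ℤ) : ℂ :=
  ∑ a ∈ (Finset.Icc 1 q).filter (fun a => Nat.gcd a q = 1), e ((m : ℝ) * a / q)

/-- `A = N·e^{−ε√(log N)}`. -/
noncomputable def Aof (ε : ℝ) (N : ℕ) : ℝ := (N : ℝ) * Real.exp (-ε * Real.sqrt (Real.log N))

/-- `Q = (log N)^λ`. -/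
noncomputable def Qof (lam : ℝ) (N : ℕ) : ℝ := Real.log N ^ (lam : ℝ)

/-- `τ = A²·N⁻¹·Q⁻¹`. -/
noncomputable def tauof (ε lam : ℝ) (N : ℕ) : ℝ := Aof ε N ^ 2 * (N : ℝ)⁻¹ * (Qof lam N)⁻¹

/-- `F̃(α,A) = Σ_{2 < p ≤ A} (log p)·e(α·2p)`, sum over primes `p`. -/
noncomputable def Ftilde (A α : ℝ) : ℂ :=
  ∑ p ∈ (Finset.range (⌊A⌋₊ + 1)).filter
      (fun p => Nat.Prime p ∧ 2 < p ∧ (p : ℝ) ≤ A),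
    (Real.log p : ℂ) * e (α * (2 * p))

/-- `ũ(β,A) = Σ_{2 < n ≤ A} e(β·2n)`. -/
noncomputable def utilde (A β : ℝ) : ℂ :=
  ∑ n ∈ (Finset.range (⌊A⌋₊ + 1)).filter (fun n => 2 < n ∧ (n : ℝ) ≤ A),
    e (β * (2 * n))

/-- A holomorphic function on a disk without zeros has a holomorphic logarithm there. -/
lemma exists_log_of_ball {f : ℂ → ℂ} {c : ℂ} {R : ℝ} (hR : 0 < R)
    (hf : DifferentiableOn ℂ f (Metric.ball c R)) (h0 : ∀ z ∈ Metric.ball c R, f z ≠ 0) :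
    ∃ h : ℂ → ℂ, h c = 0 ∧ (∀ z ∈ Metric.ball c R, HasDerivAt h (deriv f z / f z) z) ∧
      ∀ z ∈ Metric.ball c R, f z = f c * Complex.exp (h z) := by
  have hd : DifferentiableOn ℂ (fun z => deriv f z / f z) (Metric.ball c R) :=
    (hf.deriv Metric.isOpen_ball).div hf h0
  obtain ⟨h, hc, hh⟩ := hd.isExactOn_ball.with_val_at c 0
  refine ⟨h, hc, hh, fun z hz => ?_⟩
  have hcb : c ∈ Metric.ball c R := Metric.mem_ball_self hR
  have key : ∀ w ∈ Metric.ball c R,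
      HasDerivAt (fun w => f w * Complex.exp (-h w)) 0 w := by
    intro w hw
    have h1 : HasDerivAt f (deriv f w) w :=
      (hf.differentiableAt (Metric.isOpen_ball.mem_nhds hw)).hasDerivAt
    have h2 := h1.mul ((hh w hw).neg.cexp)
    refine h2.congr_deriv ?_
    have e : f w * (deriv f w / f w) = deriv f w := mul_div_cancel₀ _ (h0 w hw)
    linear_combination -Complex.exp (-h w) * e
  have hconst := Metric.isOpen_ball.is_const_of_deriv_eq_zero
    (convex_ball c R).isPreconnected
    (fun w hw => (key w hw).differentiableAt.differentiableWithinAt)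
    (fun w hw => (key w hw).deriv) hz hcb
  simp only [hc, neg_zero, Complex.exp_zero, mul_one] at hconst
  rw [← hconst, mul_assoc, ← Complex.exp_add]
  simp

/-- Bound for the logarithmic derivative of a zero-free bounded function on a disk. -/
lemma norm_logDeriv_le_of_ball {f : ℂ → ℂ} {c : ℂ} {R M r : ℝ} (hR : 0 < R) (hM : 0 < M)
    (hf : DifferentiableOn ℂ f (Metric.ball c R)) (h0 : ∀ z ∈ Metric.ball c R, f z ≠ 0)
    (hb : ∀ z ∈ Metric.ball c R, ‖f z‖ ≤ Real.exp M * ‖f c‖) (hrR : r < R)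
    {z : ℂ} (hz : ‖z - c‖ ≤ r) : ‖deriv f z / f z‖ ≤ 8 * M * R / (R - r) ^ 2 := by
  obtain ⟨h, hc, hh, hfe⟩ := exists_log_of_ball hR hf h0
  have hcb : c ∈ Metric.ball c R := Metric.mem_ball_self hR
  have hr : 0 ≤ r := (norm_nonneg _).trans hz
  have hRr : 0 < R - r := sub_pos.2 hrR
  have hre : ∀ w ∈ Metric.ball c R, (h w).re ≤ M := by
    intro w hw
    have h1 := hb w hw
    rw [hfe w hw, norm_mul, Complex.norm_exp, mul_comm] at h1
    exact Real.exp_le_exp.1 (le_of_mul_le_mul_right h1 (norm_pos_iff.2 (h0 c hcb)))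
  have hmem : ∀ w : ℂ, w ∈ Metric.ball (0 : ℂ) R → c + w ∈ Metric.ball c R := by
    intro w hw; simpa using hw
  have hbc : ∀ w : ℂ, w ∈ Metric.ball (0 : ℂ) R → ‖h (c + w)‖ ≤ 2 * M * ‖w‖ / (R - ‖w‖) := by
    intro w hw
    refine Complex.borelCaratheodory_zero (f := fun w => h (c + w)) hM ?_ ?_ hR hw
      (by simpa using hc)
    · intro u hu
      have := ((hh _ (hmem u hu)).differentiableAt.comp u
        (by fun_prop : DifferentiableAt ℂ (fun u => c + u) u))
      exact this.differentiableWithinAt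
    · intro u hu
      exact hre _ (hmem u hu)
  have hzb : Metric.closedBall z ((R - r) / 2) ⊆ Metric.ball c R := by
    intro w hw
    rw [Metric.mem_closedBall, dist_eq_norm] at hw
    rw [Metric.mem_ball, dist_eq_norm]
    calc ‖w - c‖ = ‖(w - z) + (z - c)‖ := by ring_nf
      _ ≤ ‖w - z‖ + ‖z - c‖ := norm_add_le _ _
      _ < R := by linarith
  have hz' : z ∈ Metric.ball c R := hzb (Metric.mem_closedBall_self (by linarith))
  rw [← (hh z hz').deriv]
  have hdc : DiffContOnCl ℂ h (Metric.ball z ((R - r) / 2)) := by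
    apply DifferentiableOn.diffContOnCl
    rw [closure_ball _ (by linarith)]
    exact fun w hw => (hh w (hzb hw)).differentiableAt.differentiableWithinAt
  have := Complex.norm_deriv_le_of_forall_mem_sphere_norm_le (C := 4 * M * R / (R - r))
    (by linarith : 0 < (R - r) / 2) hdc ?_
  · refine this.trans (le_of_eq ?_)
    field_simp
    ring
  · intro w hw
    have hw' : ‖w - z‖ = (R - r) / 2 := by simpa [dist_eq_norm] using hw
    have h2 : ‖w - c‖ ≤ (R + r) / 2 := by
      calc ‖w - c‖ = ‖(w - z) + (z - c)‖ := by ring_nf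
        _ ≤ ‖w - z‖ + ‖z - c‖ := norm_add_le _ _
        _ ≤ (R + r) / 2 := by linarith
    have h3 := hbc (w - c) (by simp; linarith)
    rw [add_sub_cancel] at h3
    refine h3.trans ?_
    rw [div_le_div_iff₀ (by linarith) hRr]
    have h4 : ‖w - c‖ ≤ R := by linarith
    have h5 := mul_le_mul_of_nonneg_left h4 (mul_pos hM hRr).le
    have h6 := mul_le_mul_of_nonneg_left h2 (mul_pos hM hR).le
    nlinarith

/-- Either finitely many zeros in a disk can be split off so that the rest does not vanish on that
disk, or any given number of zeros can be split off. -/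
lemma split_zeros {f : ℂ → ℂ} (hf : Differentiable ℂ f) (c : ℂ) (R : ℝ) (n : ℕ) :
    ∃ (l : List ℂ) (g : ℂ → ℂ), Differentiable ℂ g ∧ (∀ ρ ∈ l, ‖ρ - c‖ ≤ R) ∧
      (∀ z, f z = (l.map (fun ρ => z - ρ)).prod * g z) ∧
      ((∀ z, ‖z - c‖ ≤ R → g z ≠ 0) ∨ l.length = n) := by
  induction n with
  | zero => exact ⟨[], f, hf, by simp, by simp, Or.inr rfl⟩
  | succ n ih =>
    obtain ⟨l, g, hg, hl, hfac, h | h⟩ := ih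
    · exact ⟨l, g, hg, hl, hfac, Or.inl h⟩
    · by_cases hz : ∀ z, ‖z - c‖ ≤ R → g z ≠ 0
      · exact ⟨l, g, hg, hl, hfac, Or.inl hz⟩
      · push Not at hz
        obtain ⟨ρ, hρ, hgρ⟩ := hz
        refine ⟨ρ :: l, dslope g ρ, ?_, ?_, ?_, Or.inr (by simp [h])⟩
        · rw [← differentiableOn_univ] at hg ⊢
          exact (Complex.differentiableOn_dslope Filter.univ_mem).2 hg
        · intro x hx
          rcases List.mem_cons.1 hx with rfl | hx
          · exact hρ
          · exact hl x hx
        · intro z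
          have := sub_smul_dslope g ρ z
          rw [hgρ, sub_zero, smul_eq_mul] at this
          rw [hfac z, ← this, List.map_cons, List.prod_cons]
          ring

lemma List.norm_prod_sub_le {l : List ℂ} {z c : ℂ} {A B : ℝ} (hA : 0 ≤ A)
    (h1 : ∀ ρ ∈ l, A ≤ ‖z - ρ‖) (h2 : ∀ ρ ∈ l, ‖c - ρ‖ ≤ B) (hB : 0 ≤ B) :
    ‖(l.map (fun ρ => c - ρ)).prod‖ * A ^ l.length ≤
      ‖(l.map (fun ρ => z - ρ)).prod‖ * B ^ l.length := by
  induction l with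
  | nil => simp
  | cons x l ih =>
    simp only [List.map_cons, List.prod_cons, norm_mul, List.length_cons, pow_succ]
    have i1 := ih (fun ρ hρ => h1 ρ (List.mem_cons_of_mem _ hρ))
      (fun ρ hρ => h2 ρ (List.mem_cons_of_mem _ hρ))
    have i2 := h1 x List.mem_cons_self
    have i3 := h2 x List.mem_cons_self
    have : ‖c - x‖ * A ≤ ‖z - x‖ * B :=
      (mul_le_mul i3 i2 hA hB).trans (by rw [mul_comm])
    calc _ = (‖(l.map (fun ρ => c - ρ)).prod‖ * A ^ l.length) * (‖c - x‖ * A) := by ring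
      _ ≤ (‖(l.map (fun ρ => z - ρ)).prod‖ * B ^ l.length) * (‖z - x‖ * B) :=
        mul_le_mul i1 this (by positivity) (by positivity)
      _ = _ := by ring

/-- Zeros of an entire function in a disk split off, with control on the rest. -/
lemma exists_split_zeros {f : ℂ → ℂ} (hf : Differentiable ℂ f) {c : ℂ} {R M : ℝ} (hR : 0 < R)
    (hc : f c ≠ 0) (hb : ∀ z, ‖z - c‖ ≤ 3 * R → ‖f z‖ ≤ Real.exp M * ‖f c‖) :
    ∃ (l : List ℂ) (g : ℂ → ℂ), Differentiable ℂ g ∧ (∀ ρ ∈ l, ‖ρ - c‖ ≤ R) ∧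
      (∀ z, f z = (l.map (fun ρ => z - ρ)).prod * g z) ∧
      (∀ z, ‖z - c‖ ≤ R → g z ≠ 0) ∧ (∀ z, ‖z - c‖ ≤ 3 * R → ‖g z‖ ≤ Real.exp M * ‖g c‖) := by
  have main : ∀ (l : List ℂ) (g : ℂ → ℂ), Differentiable ℂ g → (∀ ρ ∈ l, ‖ρ - c‖ ≤ R) →
      (∀ z, f z = (l.map (fun ρ => z - ρ)).prod * g z) →
      (∀ z, ‖z - c‖ ≤ 3 * R → ‖g z‖ * 2 ^ l.length ≤ Real.exp M * ‖g c‖) := by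
    intro l g hg hl hfac z hz
    have hsph : ∀ w ∈ frontier (Metric.ball c (3 * R)),
        ‖g w‖ ≤ Real.exp M * ‖g c‖ / 2 ^ l.length := by
      intro w hw
      rw [frontier_ball _ (by linarith)] at hw
      have hw' : ‖w - c‖ = 3 * R := by simpa [dist_eq_norm] using hw
      rw [le_div_iff₀ (by positivity)]
      have h1 := hb w hw'.le
      rw [hfac w, hfac c, norm_mul, norm_mul] at h1
      have h2 : ∀ ρ ∈ l, 2 * R ≤ ‖w - ρ‖ := by
        intro ρ hρ
        have := norm_sub_norm_le (w - c) (ρ - c)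
        rw [sub_sub_sub_cancel_right] at this
        linarith [hl ρ hρ]
      have h3 : ∀ ρ ∈ l, ‖c - ρ‖ ≤ R := fun ρ hρ => by rw [norm_sub_rev]; exact hl ρ hρ
      have h4 := List.norm_prod_sub_le (by positivity) h2 h3 hR.le
      rw [mul_pow, ← mul_assoc] at h4
      have h5 := le_of_mul_le_mul_right h4 (by positivity)
      have hpos : 0 < ‖(l.map (fun ρ => w - ρ)).prod‖ := by
        rw [norm_pos_iff]
        intro h0
        rw [List.prod_eq_zero_iff, List.mem_map] at h0
        obtain ⟨ρ, hρ, h0⟩ := h0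
        have := h2 ρ hρ
        rw [h0, norm_zero] at this
        linarith
      have h6 := mul_le_mul_of_nonneg_left h5 (mul_nonneg (Real.exp_pos M).le (norm_nonneg (g c)))
      have h7 := mul_le_mul_of_nonneg_right h1 (by positivity : (0 : ℝ) ≤ 2 ^ l.length)
      refine le_of_mul_le_mul_left ?_ hpos
      nlinarith
    have := Complex.norm_le_of_forall_mem_frontier_norm_le Metric.isBounded_ball
      hg.diffContOnCl hsph (z := z)
      (by rw [closure_ball _ (by linarith)]; simpa [dist_eq_norm] using hz)
    rwa [le_div_iff₀ (by positivity)] at this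
  obtain ⟨n, hn⟩ := pow_unbounded_of_one_lt (Real.exp M) (one_lt_two)
  obtain ⟨l, g, hg, hl, hfac, h⟩ := split_zeros hf c R n
  have hgc : 0 < ‖g c‖ := by
    rw [norm_pos_iff]
    intro h0
    exact hc (by rw [hfac c, h0, mul_zero])
  have hm := main l g hg hl hfac
  refine ⟨l, g, hg, hl, hfac, ?_, ?_⟩
  · rcases h with h | h
    · exact h
    · exfalso
      have := hm c (by simpa using by positivity)
      rw [h] at this
      nlinarith
  · intro z hz
    refine le_trans ?_ (hm z hz)
    exact le_mul_of_one_le_right (norm_nonneg _) (one_le_pow₀ (by norm_num))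

lemma List.logDeriv_prod_sub (l : List ℂ) {c : ℂ} (hl : ∀ ρ ∈ l, c ≠ ρ) :
    logDeriv (fun z => (l.map (fun ρ => z - ρ)).prod) c = (l.map (fun ρ => 1 / (c - ρ))).sum ∧
      DifferentiableAt ℂ (fun z => (l.map (fun ρ => z - ρ)).prod) c ∧
      (l.map (fun ρ => c - ρ)).prod ≠ 0 := by
  induction l with
  | nil => simp
  | cons x l ih =>
    obtain ⟨i1, i2, i3⟩ := ih (fun ρ hρ => hl ρ (List.mem_cons_of_mem _ hρ))
    have hx : c - x ≠ 0 := sub_ne_zero.2 (hl x List.mem_cons_self)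
    simp only [List.map_cons, List.prod_cons, List.sum_cons]
    refine ⟨?_, by fun_prop, mul_ne_zero hx i3⟩
    rw [logDeriv_mul (f := fun z => z - x) (g := fun z => (l.map (fun ρ => z - ρ)).prod) c hx i3
      (by fun_prop) i2, i1]
    simp [logDeriv_apply]

/-- Landau's lemma. -/
lemma landau_lemma {f : ℂ → ℂ} (hf : Differentiable ℂ f) {c : ℂ} {R M : ℝ} (hR : 0 < R)
    (hM : 0 < M) (hc : f c ≠ 0) (hb : ∀ z, ‖z - c‖ ≤ 3 * R → ‖f z‖ ≤ Real.exp M * ‖f c‖)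
    (hz : ∀ ρ, ‖ρ - c‖ ≤ R → f ρ = 0 → ρ.re < c.re) :
    -(logDeriv f c).re ≤ 8 * M / R ∧
      ∀ ρ, ‖ρ - c‖ ≤ R → f ρ = 0 → -(logDeriv f c).re ≤ 8 * M / R - (1 / (c - ρ)).re := by
  obtain ⟨l, g, hg, hl, hfac, hg0, hgb⟩ := exists_split_zeros hf hR hc hb
  have hz' : ∀ ρ ∈ l, f ρ = 0 := by
    intro ρ hρ
    rw [hfac ρ, List.prod_eq_zero, zero_mul]
    exact List.mem_map.2 ⟨ρ, hρ, sub_self ρ⟩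
  have hne : ∀ ρ ∈ l, c ≠ ρ := fun ρ hρ h => hc (h ▸ hz' ρ hρ)
  have hgc : g c ≠ 0 := hg0 c (by simpa using hR.le)
  obtain ⟨l1, l2, l3⟩ := List.logDeriv_prod_sub l hne
  have hlog : logDeriv f c = (l.map (fun ρ => 1 / (c - ρ))).sum + logDeriv g c := by
    rw [show f = fun z => (l.map (fun ρ => z - ρ)).prod * g z from funext hfac,
      logDeriv_mul (f := fun z => (l.map (fun ρ => z - ρ)).prod) c l3 hgc l2 hg.differentiableAt,
        l1]
  have hgl : ‖logDeriv g c‖ ≤ 8 * M / R := by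
    have := norm_logDeriv_le_of_ball (r := 0) hR hM hg.differentiableOn
      (fun z hz => hg0 z (by simpa [dist_eq_norm] using (Metric.mem_ball.1 hz).le))
      (fun z hz => hgb z (by
        have := (Metric.mem_ball.1 hz).le
        rw [dist_eq_norm] at this; linarith)) hR (z := c) (by simp)
    rw [logDeriv_apply]
    refine this.trans (le_of_eq ?_)
    have := hR.ne'
    rw [sub_zero]
    field_simp
  have hgre : -(logDeriv g c).re ≤ 8 * M / R :=
    (neg_le_abs _).trans ((Complex.abs_re_le_norm _).trans hgl)
  have hpos : ∀ ρ ∈ l, 0 ≤ (1 / (c - ρ)).re := by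
    intro ρ hρ
    have := hz ρ (hl ρ hρ) (hz' ρ hρ)
    rw [one_div, Complex.inv_re]
    exact div_nonneg (by simp; linarith) (Complex.normSq_nonneg _)
  have hsum : (l.map (fun ρ => 1 / (c - ρ))).sum.re = (l.map (fun ρ => (1 / (c - ρ)).re)).sum := by
    clear l1 l2 l3 hlog hz' hne hpos hl hfac
    induction l with
    | nil => simp
    | cons x l ih => simp only [List.map_cons, List.sum_cons, Complex.add_re, ih]
  have hnn : ∀ x ∈ l.map (fun ρ => (1 / (c - ρ)).re), 0 ≤ x := by
    intro x hx
    obtain ⟨ρ, hρ, rfl⟩ := List.mem_map.1 hx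
    exact hpos ρ hρ
  constructor
  · rw [hlog, Complex.add_re, hsum]
    have := List.sum_nonneg hnn
    linarith
  · intro ρ hρ hfρ
    have hmem : ρ ∈ l := by
      rw [hfac ρ, mul_eq_zero, or_iff_left (hg0 ρ hρ), List.prod_eq_zero_iff, List.mem_map] at hfρ
      obtain ⟨x, hx, h⟩ := hfρ
      rwa [sub_eq_zero.1 h]
    have := List.single_le_sum hnn _ (List.mem_map.2 ⟨ρ, hmem, rfl⟩)
    rw [hlog, Complex.add_re, hsum]
    linarith

lemma sum_range_add_periodic {f : ℕ → ℂ} {q : ℕ} (hf : ∀ k, f (k + q) = f k) (j : ℕ) :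
    ∑ k ∈ Finset.range q, f (j + k) = ∑ k ∈ Finset.range q, f k := by
  induction j with
  | zero => simp
  | succ j ih =>
    rw [← ih]
    have h1 := Finset.sum_range_succ (fun k => f (j + k)) q
    have h2 := Finset.sum_range_succ' (fun k => f (j + k)) q
    rw [h1, hf] at h2
    simp only [add_zero] at h2
    rw [add_right_cancel h2]
    exact Finset.sum_congr rfl fun k _ => by ring_nf

lemma norm_sum_range_periodic_sub_le {f : ℕ → ℂ} {q : ℕ} (hq : 0 < q) (hf : ∀ k, f (k + q) = f k)
    (hb : ∀ k, ‖f k‖ ≤ 1) (n : ℕ) :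
    ‖∑ k ∈ Finset.range n, f k - (∑ k ∈ Finset.range q, f k) / q * n‖ ≤ 2 * q := by
  have hq' : (q : ℂ) ≠ 0 := by exact_mod_cast hq.ne'
  induction n using Nat.strong_induction_on with
  | _ n ih =>
    rcases lt_or_ge n q with h | h
    · have h1 : ∀ m : ℕ, ‖∑ k ∈ Finset.range m, f k‖ ≤ m := fun m =>
        (norm_sum_le _ _).trans ((Finset.sum_le_sum fun k _ => hb k).trans (by simp))
      have h2 : ‖(∑ k ∈ Finset.range q, f k) / q * (n : ℂ)‖ ≤ n := by
        rw [norm_mul, norm_div, Complex.norm_natCast, Complex.norm_natCast]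
        refine mul_le_of_le_one_left (by positivity) ?_
        rw [div_le_one (by exact_mod_cast hq)]
        exact h1 q
      have h3 : (n : ℝ) ≤ q := by exact_mod_cast h.le
      exact (norm_sub_le _ _).trans (by linarith [h1 n])
    · obtain ⟨m, rfl⟩ := Nat.exists_eq_add_of_le' h
      have := ih m (by omega)
      rw [Finset.sum_range_add, sum_range_add_periodic hf]
      convert this using 2
      push_cast
      field_simp
      ring

section DirichletL

open DirichletCharacter

variable {q : ℕ} [NeZero q]

lemma sum_range_dirichletCharacter (χ : DirichletCharacter ℂ q) :
    ∑ k ∈ Finset.range q, χ (k + 1 : ℕ) = if χ = 1 then (Nat.totient q : ℂ) else 0 := by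
  have hper : ∀ k : ℕ, χ ((k + q : ℕ) : ZMod q) = χ (k : ℕ) := fun k => by simp
  have h1 : ∑ k ∈ Finset.range q, χ (k + 1 : ℕ) = ∑ k ∈ Finset.range q, χ (k : ℕ) := by
    rw [← sum_range_add_periodic (f := fun k : ℕ => χ (k : ℕ)) hper 1]
    exact Finset.sum_congr rfl fun k _ => by rw [add_comm]
  have h2 : ∑ k ∈ Finset.range q, χ (k : ℕ) = ∑ a : ZMod q, χ a := by
    refine Finset.sum_nbij' (fun k : ℕ => (k : ZMod q)) (fun a => a.val) ?_ ?_ ?_ ?_ ?_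
    · intro k _; exact Finset.mem_univ _
    · intro a _; exact Finset.mem_range.2 (ZMod.val_lt a)
    · intro k hk; exact ZMod.val_cast_of_lt (Finset.mem_range.1 hk)
    · intro a _; exact ZMod.natCast_zmod_val a
    · intro k _; rfl
  rw [h1, h2]
  split_ifs with h
  · rw [h, MulChar.sum_one_eq_card_units, ZMod.card_units_eq_totient]
  · exact MulChar.sum_eq_zero_of_ne_one h

/-- The mean value of a Dirichlet character. -/
noncomputable def charMean (χ : DirichletCharacter ℂ q) : ℂ :=
  if χ = 1 then (Nat.totient q : ℂ) / q else 0

lemma norm_charMean_le (χ : DirichletCharacter ℂ q) : ‖charMean χ‖ ≤ 1 := by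
  unfold charMean
  split_ifs
  · rw [norm_div, Complex.norm_natCast, Complex.norm_natCast]
    exact div_le_one_of_le₀ (by exact_mod_cast Nat.totient_le q) (by positivity)
  · simp

/-- The error term in the summatory function of a Dirichlet character. -/
noncomputable def charErr (χ : DirichletCharacter ℂ q) (u : ℝ) : ℂ :=
  ∑ k ∈ Finset.Icc 1 ⌊u⌋₊, χ (k : ℕ) - charMean χ * u

lemma sum_Icc_one_eq_sum_range (f : ℕ → ℂ) (n : ℕ) :
    ∑ k ∈ Finset.Icc 1 n, f k = ∑ k ∈ Finset.range n, f (k + 1) := by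
  rw [Finset.range_eq_Ico, Finset.sum_Ico_add' f 0 n 1]
  rfl

lemma norm_charErr_le (χ : DirichletCharacter ℂ q) {u : ℝ} (hu : 0 ≤ u) :
    ‖charErr χ u‖ ≤ 3 * q := by
  have hq : 0 < q := NeZero.pos q
  have hq1 : (1 : ℝ) ≤ q := by exact_mod_cast hq
  have h1 := norm_sum_range_periodic_sub_le (f := fun k : ℕ => χ (k + 1 : ℕ)) hq
    (fun k => by push_cast; simp) (fun k => χ.norm_le_one _) ⌊u⌋₊
  rw [sum_range_dirichletCharacter] at h1
  have h2 : (if χ = 1 then (Nat.totient q : ℂ) else 0) / q = charMean χ := by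
    unfold charMean; split_ifs <;> simp
  rw [h2, ← sum_Icc_one_eq_sum_range (fun k : ℕ => χ (k : ℕ))] at h1
  have h3 : ‖charMean χ * (u - ⌊u⌋₊)‖ ≤ 1 := by
    rw [norm_mul]
    refine mul_le_one₀ (norm_charMean_le χ) (norm_nonneg _) ?_
    have : ((u : ℂ) - (⌊u⌋₊ : ℂ)) = ((u - ⌊u⌋₊ : ℝ) : ℂ) := by push_cast; rfl
    rw [this, Complex.norm_real, Real.norm_eq_abs, abs_of_nonneg (by linarith [Nat.floor_le hu])]
    linarith [Nat.lt_floor_add_one u]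
  have h4 : charErr χ u = (∑ k ∈ Finset.Icc 1 ⌊u⌋₊, χ (k : ℕ) - charMean χ * ⌊u⌋₊) -
      charMean χ * (u - ⌊u⌋₊) := by unfold charErr; ring
  rw [h4]
  exact (norm_sub_le _ _).trans (by linarith)

lemma measurable_charErr (χ : DirichletCharacter ℂ q) : Measurable (charErr χ) := by
  unfold charErr
  refine Measurable.sub ?_ (by fun_prop)
  exact (measurable_from_nat (f := fun n : ℕ => ∑ k ∈ Finset.Icc 1 n, χ (k : ℕ))).comp
    Nat.measurable_floor

/-- The integral of the error term of the summatory function against `u ^ (-s - 1)`. -/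
noncomputable def charInt (χ : DirichletCharacter ℂ q) (s : ℂ) : ℂ :=
  ∫ u in Set.Ioi (1 : ℝ), charErr χ u * (u : ℂ) ^ (-(s + 1))

lemma norm_charErr_mul_cpow_le (χ : DirichletCharacter ℂ q) {K θ : ℝ}
    (hK : ∀ u : ℝ, 1 ≤ u → ‖charErr χ u‖ ≤ K * u ^ (1 - θ)) (s : ℂ) {u : ℝ}
    (hu : u ∈ Set.Ioi (1 : ℝ)) :
    ‖charErr χ u * (u : ℂ) ^ (-(s + 1))‖ ≤ K * u ^ (-θ - s.re) := by
  have hu1 : (1 : ℝ) < u := hu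
  have hu0 : (0 : ℝ) < u := by linarith
  rw [norm_mul, Complex.norm_cpow_eq_rpow_re_of_pos hu0]
  calc _ ≤ K * u ^ (1 - θ) * u ^ (-(s + 1)).re := by
        gcongr; exact hK u hu1.le
    _ = _ := by
        rw [mul_assoc, ← Real.rpow_add hu0]
        congr 2
        simp; ring

lemma integrableOn_charErr (χ : DirichletCharacter ℂ q) {K θ : ℝ}
    (hK : ∀ u : ℝ, 1 ≤ u → ‖charErr χ u‖ ≤ K * u ^ (1 - θ)) {s : ℂ} (hs : 1 < s.re + θ) :
    MeasureTheory.IntegrableOn (fun u : ℝ => charErr χ u * (u : ℂ) ^ (-(s + 1)))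
      (Set.Ioi 1) := by
  have h1 : MeasureTheory.IntegrableOn (fun u : ℝ => K * u ^ (-θ - s.re)) (Set.Ioi 1) :=
    (integrableOn_Ioi_rpow_of_lt (by linarith) one_pos).const_mul K
  refine MeasureTheory.Integrable.mono' h1 ?_ ?_
  · refine Measurable.aestronglyMeasurable ?_
    exact (measurable_charErr χ).mul (by fun_prop)
  · refine (MeasureTheory.ae_restrict_iff' measurableSet_Ioi).2 (Filter.Eventually.of_forall ?_)
    intro u hu
    exact norm_charErr_mul_cpow_le χ hK s hu

lemma norm_charInt_le (χ : DirichletCharacter ℂ q) {K θ : ℝ}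
    (hK : ∀ u : ℝ, 1 ≤ u → ‖charErr χ u‖ ≤ K * u ^ (1 - θ)) {s : ℂ} (hs : 1 < s.re + θ) :
    ‖charInt χ s‖ ≤ K / (s.re + θ - 1) := by
  have h1 : MeasureTheory.IntegrableOn (fun u : ℝ => K * u ^ (-θ - s.re)) (Set.Ioi 1) :=
    (integrableOn_Ioi_rpow_of_lt (by linarith) one_pos).const_mul K
  unfold charInt
  refine (MeasureTheory.norm_integral_le_of_norm_le h1 ?_).trans ?_
  · refine (MeasureTheory.ae_restrict_iff' measurableSet_Ioi).2 (Filter.Eventually.of_forall ?_)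
    intro u hu
    exact norm_charErr_mul_cpow_le χ hK s hu
  · rw [MeasureTheory.integral_const_mul, integral_Ioi_rpow_of_lt (by linarith) one_pos]
    rw [Real.one_rpow, div_eq_mul_inv]
    refine le_of_eq ?_
    congr 1
    rw [show -θ - s.re + 1 = -(s.re + θ - 1) by ring, inv_neg]
    ring

lemma norm_charErr_le_rpow (χ : DirichletCharacter ℂ q) (u : ℝ) (hu : 1 ≤ u) :
    ‖charErr χ u‖ ≤ 3 * q * u ^ (1 - (1 : ℝ)) := by
  simpa using norm_charErr_le χ (by linarith)

lemma differentiableAt_charInt (χ : DirichletCharacter ℂ q) {s : ℂ} (hs : 0 < s.re) :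
    DifferentiableAt ℂ (charInt χ) s := by
  set f : ℝ → ℂ := Set.indicator (Set.Ioi 1) (charErr χ) with hf
  have hfm : Measurable f := (measurable_charErr χ).indicator measurableSet_Ioi
  have hfb : ∀ u, ‖f u‖ ≤ 3 * q := by
    intro u
    by_cases hu : u ∈ Set.Ioi (1 : ℝ)
    · rw [hf, Set.indicator_of_mem hu]
      exact norm_charErr_le χ (by linarith [Set.mem_Ioi.1 hu])
    · rw [hf, Set.indicator_of_notMem hu]; simp
  have h1 : charInt χ = fun s => mellin f (-s) := by
    funext s
    unfold charInt mellin
    rw [← MeasureTheory.integral_indicator measurableSet_Ioi,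
      ← MeasureTheory.integral_indicator measurableSet_Ioi]
    congr 1
    funext u
    by_cases hu : u ∈ Set.Ioi (1 : ℝ)
    · have hu0 : u ∈ Set.Ioi (0 : ℝ) := lt_trans one_pos (Set.mem_Ioi.1 hu)
      rw [Set.indicator_of_mem hu, Set.indicator_of_mem hu0, hf, Set.indicator_of_mem hu,
        smul_eq_mul, mul_comm]
      congr 2; ring
    · have hz : f u = 0 := Set.indicator_of_notMem hu _
      rw [Set.indicator_of_notMem hu]
      by_cases hu0 : u ∈ Set.Ioi (0 : ℝ)
      · rw [Set.indicator_of_mem hu0, hz, smul_zero]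
      · rw [Set.indicator_of_notMem hu0]
  rw [h1]
  have h2 : DifferentiableAt ℂ (mellin f) (-s) := by
    refine mellin_differentiableAt_of_isBigO_rpow (a := 0) (b := (-s).re - 1) ?_ ?_ ?_ ?_ ?_
    · refine MeasureTheory.LocallyIntegrable.locallyIntegrableOn ?_ _
      have hc : MeasureTheory.LocallyIntegrable (fun _ : ℝ => (3 * q : ℝ)) :=
        MeasureTheory.locallyIntegrable_const _
      exact hc.mono hfm.aestronglyMeasurable (Filter.Eventually.of_forall fun u => by
        rw [Real.norm_of_nonneg (by positivity)]; exact hfb u)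
    · refine Asymptotics.IsBigO.of_bound (3 * q) (Filter.Eventually.of_forall fun u => ?_)
      simpa using hfb u
    · simpa using hs
    · refine Asymptotics.IsBigO.of_bound 1 ?_
      filter_upwards [mem_nhdsWithin_of_mem_nhds (Iio_mem_nhds (one_pos : (0 : ℝ) < 1))] with u hu
      rw [hf, Set.indicator_of_notMem (by simpa using (Set.mem_Iio.1 hu).le)]
      simp
    · linarith
  exact h2.comp s (by fun_prop : DifferentiableAt ℂ (fun s : ℂ => -s) s)

lemma LFunction_eq_charInt_of_one_lt_re (χ : DirichletCharacter ℂ q) {s : ℂ} (hs : 1 < s.re) :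
    LFunction χ s = charMean χ * s / (s - 1) + s * charInt χ s := by
  rw [LFunction_eq_LSeries χ hs]
  have hs1 : s - 1 ≠ 0 := by
    intro h
    rw [sub_eq_zero.1 h] at hs
    simp at hs
  rw [LSeries_eq_mul_integral' (fun n : ℕ => χ (n : ℕ)) zero_le_one hs]
  · have h1 : ∀ u ∈ Set.Ioi (1 : ℝ),
        (∑ k ∈ Finset.Icc 1 ⌊u⌋₊, χ (k : ℕ)) * (u : ℂ) ^ (-(s + 1)) =
        charErr χ u * (u : ℂ) ^ (-(s + 1)) + charMean χ * (u : ℂ) ^ (-s) := by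
      intro u hu
      have hu0 : (u : ℂ) ≠ 0 := by
        have : (0 : ℝ) < u := lt_trans one_pos hu
        exact_mod_cast this.ne'
      unfold charErr
      rw [show -s = 1 + -(s + 1) by ring, Complex.cpow_add _ _ hu0, Complex.cpow_one]
      ring
    rw [MeasureTheory.setIntegral_congr_fun measurableSet_Ioi h1,
      MeasureTheory.integral_add (integrableOn_charErr χ (norm_charErr_le_rpow χ) (by linarith))
        ((integrableOn_Ioi_cpow_of_lt (by simpa using hs) one_pos).const_mul _),
      MeasureTheory.integral_const_mul, integral_Ioi_cpow_of_lt (by simpa using hs) one_pos]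
    rw [Complex.ofReal_one, Complex.one_cpow]
    unfold charInt
    have h3 : -s + 1 ≠ 0 := by
      intro h; apply hs1; linear_combination -h
    field_simp
    ring
  · refine Asymptotics.IsBigO.of_bound 1 (Filter.Eventually.of_forall fun n => ?_)
    rw [Real.rpow_one, Real.norm_of_nonneg (by positivity), Real.norm_of_nonneg (by positivity),
      one_mul]
    refine (Finset.sum_le_sum fun k _ => χ.norm_le_one _).trans ?_
    simp

/-- The `L`-function of `χ`, multiplied by `s - 1` when `χ` is principal. -/
noncomputable def Lreg (χ : DirichletCharacter ℂ q) : ℂ → ℂ :=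
  if χ = 1 then LFunctionTrivChar₁ q else LFunction χ

lemma differentiable_Lreg (χ : DirichletCharacter ℂ q) : Differentiable ℂ (Lreg χ) := by
  unfold Lreg
  split_ifs with h
  · exact differentiable_LFunctionTrivChar₁ q
  · exact differentiable_LFunction h

lemma Lreg_eq (χ : DirichletCharacter ℂ q) {s : ℂ} (hs : s ≠ 1) :
    Lreg χ s = (if χ = 1 then s - 1 else 1) * LFunction χ s := by
  unfold Lreg
  split_ifs with h
  · rw [h]
    exact Function.update_of_ne hs _ _
  · rw [one_mul]

lemma Lreg_eq_charInt (χ : DirichletCharacter ℂ q) {s : ℂ} (hs : 0 < s.re) :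
    Lreg χ s = charMean χ * s + (if χ = 1 then s - 1 else 1) * (s * charInt χ s) := by
  have hopen : IsOpen {s : ℂ | 0 < s.re} := isOpen_lt continuous_const Complex.continuous_re
  have hconv : Convex ℝ {s : ℂ | 0 < s.re} := convex_halfSpace_re_gt 0
  have h1 : AnalyticOnNhd ℂ (Lreg χ) {s : ℂ | 0 < s.re} :=
    (differentiable_Lreg χ).differentiableOn.analyticOnNhd hopen
  have h2 : AnalyticOnNhd ℂ (fun s => charMean χ * s +
      (if χ = 1 then s - 1 else 1) * (s * charInt χ s)) {s : ℂ | 0 < s.re} := by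
    refine DifferentiableOn.analyticOnNhd (fun s hs => ?_) hopen
    have := differentiableAt_charInt χ hs
    refine DifferentiableAt.differentiableWithinAt ?_
    split_ifs <;> fun_prop
  refine h1.eqOn_of_preconnected_of_eventuallyEq h2 hconv.isPreconnected (z₀ := 2) (by simp) ?_ hs
  have h3 : {s : ℂ | 1 < s.re} ∈ nhds (2 : ℂ) :=
    (isOpen_lt continuous_const Complex.continuous_re).mem_nhds (by simp)
  filter_upwards [h3] with s hs
  have hs' : 1 < s.re := hs
  have hs1 : s ≠ 1 := by
    rintro rfl
    simp at hs'
  have hs2 := sub_ne_zero.2 hs1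
  rw [Lreg_eq χ hs1, LFunction_eq_charInt_of_one_lt_re χ hs']
  unfold charMean
  split_ifs
  · field_simp
  · simp

lemma norm_Lreg_le (χ : DirichletCharacter ℂ q) {s : ℂ} (hs : 1 / 2 ≤ s.re) :
    ‖Lreg χ s‖ ≤ 7 * q * (‖s‖ + 1) ^ 2 := by
  have hq1 : (1 : ℝ) ≤ q := by exact_mod_cast NeZero.pos q
  rw [Lreg_eq_charInt χ (by linarith)]
  have h1 : ‖charInt χ s‖ ≤ 6 * q := by
    refine (norm_charInt_le χ (norm_charErr_le_rpow χ) (by linarith)).trans ?_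
    rw [div_le_iff₀ (by linarith)]
    nlinarith
  have h2 : ‖(if χ = 1 then s - 1 else 1 : ℂ)‖ ≤ ‖s‖ + 1 := by
    split_ifs
    · exact (norm_sub_le _ _).trans (by simp)
    · simp
  have h3 : ‖charMean χ * s‖ ≤ ‖s‖ := by
    rw [norm_mul]
    exact mul_le_of_le_one_left (norm_nonneg _) (norm_charMean_le χ)
  have h0 := norm_nonneg s
  calc _ ≤ ‖charMean χ * s‖ + ‖(if χ = 1 then s - 1 else 1 : ℂ)‖ * (‖s‖ * ‖charInt χ s‖) := by
        refine (norm_add_le _ _).trans ?_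
        rw [norm_mul (if χ = 1 then s - 1 else 1 : ℂ), norm_mul s]
    _ ≤ ‖s‖ + (‖s‖ + 1) * (‖s‖ * (6 * q)) := by gcongr
    _ ≤ 7 * q * (‖s‖ + 1) ^ 2 := by
      nlinarith [mul_nonneg h0 h0, mul_nonneg h0 (by linarith : (0 : ℝ) ≤ q - 1)]

end DirichletL

section ZeroFree

set_option linter.unusedSectionVars false

open DirichletCharacter

variable {q : ℕ} [NeZero q]

/-- The twist of the von Mangoldt function by a Dirichlet character. -/
noncomputable def twistVM (χ : DirichletCharacter ℂ q) (n : ℕ) : ℂ :=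
  χ n * (ArithmeticFunction.vonMangoldt n : ℂ)

lemma twistVM_eq_mul (χ : DirichletCharacter ℂ q) :
    twistVM χ = (fun n : ℕ => χ n) * (fun n : ℕ => (ArithmeticFunction.vonMangoldt n : ℂ)) := rfl

lemma LSeriesSummable_twistVM (χ : DirichletCharacter ℂ q) {s : ℂ} (hs : 1 < s.re) :
    LSeriesSummable (twistVM χ) s :=
  LSeriesSummable_twist_vonMangoldt χ hs

lemma Lreg_ne_zero_of_one_le_re (χ : DirichletCharacter ℂ q) {s : ℂ} (hs : 1 ≤ s.re) :
    Lreg χ s ≠ 0 := by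
  by_cases hχ : χ = 1
  · by_cases h1 : s = 1
    · rw [h1]
      unfold Lreg
      rw [if_pos hχ]
      exact LFunctionTrivChar₁_apply_one_ne_zero q
    · rw [Lreg_eq χ h1, if_pos hχ]
      exact mul_ne_zero (sub_ne_zero.2 h1) (LFunction_ne_zero_of_one_le_re χ (Or.inr h1) hs)
  · unfold Lreg
    rw [if_neg hχ]
    exact LFunction_ne_zero_of_one_le_re χ (Or.inl hχ) hs

lemma logDeriv_Lreg (χ : DirichletCharacter ℂ q) {s : ℂ} (hs : s ≠ 1) (hL : LFunction χ s ≠ 0) :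
    logDeriv (Lreg χ) s = (if χ = 1 then 1 / (s - 1) else 0) + logDeriv (LFunction χ) s := by
  split_ifs with h
  · have h1 : Lreg χ =ᶠ[nhds s] fun z => (z - 1) * LFunction χ z := by
      filter_upwards [isOpen_ne.mem_nhds hs] with z hz
      rw [Lreg_eq χ hz, if_pos h]
    rw [logDeriv_apply, Filter.EventuallyEq.deriv_eq h1, Filter.EventuallyEq.eq_of_nhds h1,
      ← logDeriv_apply (fun z => (z - 1) * LFunction χ z),
      logDeriv_mul (f := fun z => z - 1) s (sub_ne_zero.2 hs) hL (by fun_prop)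
      (differentiableAt_LFunction χ s (Or.inl hs))]
    simp [logDeriv_apply]
  · unfold Lreg
    rw [if_neg h, zero_add]

lemma LSeries_twistVM_eq (χ : DirichletCharacter ℂ q) {s : ℂ} (hs : 1 < s.re) :
    LSeries (twistVM χ) s = -logDeriv (Lreg χ) s + (if χ = 1 then 1 / (s - 1) else 0) := by
  have hs1 : s ≠ 1 := by
    rintro rfl
    simp at hs
  rw [logDeriv_Lreg χ hs1 (LFunction_ne_zero_of_one_le_re χ (Or.inr hs1) hs.le), twistVM_eq_mul,
    LSeries_twist_vonMangoldt_eq χ hs, logDeriv_apply, LFunction_eq_LSeries χ hs,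
    deriv_LFunction_eq_deriv_LSeries χ hs]
  ring

lemma norm_LSeries_le_of_norm_le_one {f : ℕ → ℂ} (hf : ∀ n, ‖f n‖ ≤ 1) {s : ℂ}
    (hs : 1 < s.re) : ‖LSeries f s‖ ≤ 4 * s.re / (s.re - 1) := by
  have hs' : (1 : ℝ) < ((s.re : ℝ) : ℂ).re := by simpa using hs
  have h1 : LSeriesSummable (1 : ℕ → ℂ) ((s.re : ℝ) : ℂ) := LSeriesSummable_one_iff.2 hs'
  have h2 : ∀ n, ‖LSeries.term f s n‖ ≤ ‖LSeries.term (1 : ℕ → ℂ) ((s.re : ℝ) : ℂ) n‖ := by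
    intro n
    rw [LSeries.norm_term_eq, LSeries.norm_term_eq]
    split_ifs
    · rfl
    · rw [Complex.ofReal_re]
      gcongr
      simpa using hf n
  have h3 : ∀ n, ‖LSeries.term (1 : ℕ → ℂ) ((s.re : ℝ) : ℂ) n‖ =
      (LSeries.term (1 : ℕ → ℂ) ((s.re : ℝ) : ℂ) n).re := by
    intro n
    have := LSeries.term_nonneg (a := (1 : ℕ → ℂ)) (n := n)
      (by open ComplexOrder in simp) s.re
    rw [← Complex.re_eq_norm.2 this]
  have h4 : ‖LSeries f s‖ ≤ (LSeries (1 : ℕ → ℂ) ((s.re : ℝ) : ℂ)).re := by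
    unfold LSeries
    rw [Complex.re_tsum h1]
    refine tsum_of_norm_bounded (Complex.hasSum_re h1.hasSum).summable.hasSum fun n => ?_
    rw [← h3]; exact h2 n
  refine h4.trans ?_
  have h5 : LSeries (1 : ℕ → ℂ) ((s.re : ℝ) : ℂ) =
      LFunction (1 : DirichletCharacter ℂ 1) ((s.re : ℝ) : ℂ) := by
    rw [LFunction_eq_LSeries _ hs', LSeries_modOne_eq]
  rw [h5, LFunction_eq_charInt_of_one_lt_re _ hs']
  have h6 := norm_charInt_le (1 : DirichletCharacter ℂ 1) (norm_charErr_le_rpow _)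
    (s := ((s.re : ℝ) : ℂ)) (by simp; linarith)
  have h7 : charMean (1 : DirichletCharacter ℂ 1) = 1 := by simp [charMean]
  refine (Complex.re_le_norm _).trans ((norm_add_le _ _).trans ?_)
  rw [h7, one_mul, norm_div, norm_mul, Complex.norm_real, Real.norm_of_nonneg (by linarith)]
  have h8 : ‖((s.re : ℝ) : ℂ) - 1‖ = s.re - 1 := by
    rw [← Complex.ofReal_one, ← Complex.ofReal_sub, Complex.norm_real,
      Real.norm_of_nonneg (by linarith)]
  rw [h8]
  have h9 : s.re * ‖charInt (1 : DirichletCharacter ℂ 1) ((s.re : ℝ) : ℂ)‖ ≤ 3 := by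
    calc _ ≤ s.re * (3 / s.re) := by
          gcongr
          simpa using h6
      _ = 3 := by field_simp
  have h10 : 3 ≤ 3 * s.re / (s.re - 1) := by
    rw [le_div_iff₀ (by linarith)]; linarith
  calc _ ≤ s.re / (s.re - 1) + 3 * s.re / (s.re - 1) := by gcongr; exact h9.trans h10
    _ = _ := by ring

lemma le_norm_LFunction (χ : DirichletCharacter ℂ q) {s : ℂ} (hs : 1 < s.re) :
    (s.re - 1) / (4 * s.re) ≤ ‖LFunction χ s‖ := by
  have h1 := LSeries.mul_mu_eq_one χ hs
  rw [← LFunction_eq_LSeries χ hs] at h1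
  have h2 := norm_LSeries_le_of_norm_le_one (f := (fun n : ℕ => χ n) *
    (fun n : ℕ => ((ArithmeticFunction.moebius n : ℤ) : ℂ))) (fun n => by
      rw [Pi.mul_apply, norm_mul]
      refine mul_le_one₀ (χ.norm_le_one _) (norm_nonneg _) ?_
      rw [Complex.norm_intCast]
      exact_mod_cast ArithmeticFunction.abs_moebius_le_one) hs
  have h3 := congrArg norm h1
  rw [norm_mul, norm_one] at h3
  have h0 : 0 ≤ ‖LFunction χ s‖ := norm_nonneg _
  rw [div_le_iff₀ (by linarith)]
  rw [le_div_iff₀ (by linarith)] at h2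
  have h4 := mul_le_mul_of_nonneg_left h2 h0
  have h5 : s.re - 1 = ‖LFunction χ s‖ * (‖LSeries ((fun n : ℕ => χ n) *
    (fun n : ℕ => ((ArithmeticFunction.moebius n : ℤ) : ℂ))) s‖ * (s.re - 1)) := by
    rw [← mul_assoc, h3, one_mul]
  linarith

lemma norm_Lreg_ball_le (χ : DirichletCharacter ℂ q) {L η t : ℝ} (hL : 1 ≤ L)
    (hq : (q : ℝ) ≤ Real.exp L) (ht : |t| ≤ 3 * Real.exp L) (hη : 0 < η) (hη1 : η ≤ 1)
    (hηL : Real.exp (-L) ≤ η) {z : ℂ} (hz : ‖z - (1 + η + t * Complex.I)‖ ≤ 1 / 2) :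
    ‖Lreg χ z‖ ≤ Real.exp (13 * L) * ‖Lreg χ (1 + η + t * Complex.I)‖ := by
  set c : ℂ := 1 + η + t * Complex.I with hc
  have hcre : c.re = 1 + η := by simp [hc]
  have hcne : c ≠ 1 := by
    intro h; rw [h] at hcre; simp at hcre; linarith
  have hzre : 1 / 2 ≤ z.re := by
    have h1 := (Complex.abs_re_le_norm (z - c)).trans hz
    rw [Complex.sub_re, hcre] at h1
    linarith [(abs_le.1 h1).1]
  have hcn : ‖c‖ ≤ 2 + |t| := by
    rw [hc]
    refine (norm_add_le _ _).trans ?_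
    have h1 : ‖(1 + η : ℂ)‖ ≤ 2 := by
      refine (norm_add_le _ _).trans ?_
      rw [Complex.norm_real, Real.norm_of_nonneg hη.le, norm_one]; linarith
    rw [norm_mul, Complex.norm_I, mul_one, Complex.norm_real, Real.norm_eq_abs]
    linarith
  have hzn : ‖z‖ + 1 ≤ 4 + |t| := by
    have := norm_add_le (z - c) c
    rw [sub_add_cancel] at this
    linarith
  have hE : 1 ≤ Real.exp L := Real.one_le_exp (by linarith)
  have hz2 : ‖z‖ + 1 ≤ 7 * Real.exp L := by linarith
  have h1 : ‖Lreg χ z‖ ≤ 343 * Real.exp (3 * L) := by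
    have e3 : Real.exp (3 * L) = Real.exp L * (Real.exp L) ^ 2 := by
      rw [← Real.exp_nat_mul, ← Real.exp_add]; congr 1; push_cast; ring
    calc _ ≤ 7 * q * (‖z‖ + 1) ^ 2 := norm_Lreg_le χ hzre
      _ ≤ 7 * Real.exp L * (7 * Real.exp L) ^ 2 := by gcongr
      _ = _ := by rw [e3]; ring
  have h2 : η ^ 2 / 8 ≤ ‖Lreg χ c‖ := by
    rw [Lreg_eq χ hcne, norm_mul]
    have h3 := le_norm_LFunction χ (s := c) (by rw [hcre]; linarith)
    rw [hcre] at h3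
    have h4 : η / 8 ≤ ‖LFunction χ c‖ := by
      refine le_trans ?_ h3
      rw [div_le_div_iff₀ (by norm_num) (by linarith)]
      nlinarith
    have h5 : η ≤ ‖(if χ = 1 then c - 1 else 1 : ℂ)‖ := by
      split_ifs
      · refine le_trans ?_ (Complex.re_le_norm _)
        simp [hcre]
      · simpa using hη1
    calc η ^ 2 / 8 = η * (η / 8) := by ring
      _ ≤ _ := by gcongr
  have h3 : Real.exp (-(2 * L)) / 8 ≤ ‖Lreg χ c‖ := by
    refine le_trans ?_ h2
    have : Real.exp (-(2 * L)) = Real.exp (-L) ^ 2 := by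
      rw [← Real.exp_nat_mul]; congr 1; push_cast; ring
    rw [this]
    gcongr
  have h4 : (2744 : ℝ) ≤ Real.exp (8 * L) := by
    have h5 : (2.7 : ℝ) ≤ Real.exp L :=
      le_trans (by linarith [Real.exp_one_gt_d9]) (Real.exp_le_exp.2 hL)
    have h6 : Real.exp (8 * L) = Real.exp L ^ 8 := by
      rw [← Real.exp_nat_mul]; norm_num
    rw [h6]
    calc (2744 : ℝ) ≤ 2.7 ^ 8 := by norm_num
      _ ≤ _ := by gcongr
  calc _ ≤ 343 * Real.exp (3 * L) := h1
    _ = 2744 * Real.exp (5 * L) * (Real.exp (-(2 * L)) / 8) := by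
        have : Real.exp (3 * L) = Real.exp (5 * L) * Real.exp (-(2 * L)) := by
          rw [← Real.exp_add]; congr 1; ring
        rw [this]; ring
    _ ≤ Real.exp (8 * L) * Real.exp (5 * L) * ‖Lreg χ c‖ := by gcongr
    _ = _ := by rw [← Real.exp_add]; congr 2; ring

lemma landau_Lreg (χ : DirichletCharacter ℂ q) {L η t : ℝ} (hL : 1 ≤ L)
    (hq : (q : ℝ) ≤ Real.exp L) (ht : |t| ≤ 3 * Real.exp L) (hη : 0 < η) (hη1 : η ≤ 1)
    (hηL : Real.exp (-L) ≤ η) :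
    -(logDeriv (Lreg χ) (1 + η + t * Complex.I)).re ≤ 624 * L ∧
      ∀ ρ, ‖ρ - (1 + η + t * Complex.I)‖ ≤ 1 / 6 → Lreg χ ρ = 0 →
        -(logDeriv (Lreg χ) (1 + η + t * Complex.I)).re ≤
          624 * L - (1 / (1 + η + t * Complex.I - ρ)).re := by
  have h := landau_lemma (differentiable_Lreg χ) (c := 1 + η + t * Complex.I) (R := 1 / 6)
    (M := 13 * L) (by norm_num) (by linarith)
    (Lreg_ne_zero_of_one_le_re χ (by simp; linarith))
    (fun z hz => norm_Lreg_ball_le χ hL hq ht hη hη1 hηL (by linarith))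
    (fun ρ _ h0 => by
      by_contra hcon
      push Not at hcon
      refine Lreg_ne_zero_of_one_le_re χ (le_trans ?_ hcon) h0
      simp; linarith)
  have e : 8 * (13 * L) / (1 / 6) = 624 * L := by ring
  rwa [e] at h

lemma three_four_one (χ : DirichletCharacter ℂ q) {σ : ℝ} (hσ : 1 < σ) (t : ℝ) :
    0 ≤ 3 * (LSeries (twistVM (1 : DirichletCharacter ℂ q)) σ).re +
      4 * (LSeries (twistVM χ) (σ + t * Complex.I)).re +
      (LSeries (twistVM (χ ^ 2)) (σ + (2 * t : ℝ) * Complex.I)).re := by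
  have s1 := LSeriesSummable_twistVM (1 : DirichletCharacter ℂ q) (s := σ) (by simpa using hσ)
  have s2 := LSeriesSummable_twistVM χ (s := σ + t * Complex.I) (by simpa using hσ)
  have s3 := LSeriesSummable_twistVM (χ ^ 2) (s := σ + (2 * t : ℝ) * Complex.I)
    (by simpa using hσ)
  have H := (((Complex.hasSum_re s1.hasSum).mul_left 3).add
    ((Complex.hasSum_re s2.hasSum).mul_left 4)).add (Complex.hasSum_re s3.hasSum)
  refine H.nonneg fun n => ?_
  rcases eq_or_ne n 0 with rfl | hn
  · simp
  rw [LSeries.term_of_ne_zero hn, LSeries.term_of_ne_zero hn, LSeries.term_of_ne_zero hn]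
  have hn0 : (n : ℂ) ≠ 0 := by exact_mod_cast hn
  obtain ⟨w, hw⟩ : ∃ w : ℂ, w = χ n * (n : ℂ) ^ (-(t * Complex.I)) := ⟨_, rfl⟩
  set b : ℝ := ArithmeticFunction.vonMangoldt n * (n : ℝ) ^ (-σ) with hb
  have hb0 : 0 ≤ b := mul_nonneg ArithmeticFunction.vonMangoldt_nonneg (by positivity)
  have hσn : (n : ℂ) ^ (-(σ : ℂ)) = (((n : ℝ) ^ (-σ) : ℝ) : ℂ) := by
    rw [Complex.ofReal_cpow (by positivity)]; push_cast; rfl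
  have e1 : twistVM (1 : DirichletCharacter ℂ q) n / (n : ℂ) ^ (σ : ℂ) =
      (b : ℂ) * (1 : DirichletCharacter ℂ q) n := by
    rw [div_eq_mul_inv, ← Complex.cpow_neg, hσn, twistVM, hb]; push_cast; ring
  have e2 : twistVM χ n / (n : ℂ) ^ (σ + t * Complex.I) = (b : ℂ) * w := by
    rw [div_eq_mul_inv, ← Complex.cpow_neg, neg_add, Complex.cpow_add _ _ hn0, hσn, twistVM, hb,
      hw]
    push_cast; ring
  have e3 : twistVM (χ ^ 2) n / (n : ℂ) ^ (σ + (2 * t : ℝ) * Complex.I) = (b : ℂ) * w ^ 2 := by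
    rw [div_eq_mul_inv, ← Complex.cpow_neg, neg_add, Complex.cpow_add _ _ hn0, hσn, twistVM, hb,
      hw, show -(((2 * t : ℝ) : ℂ) * Complex.I) = -(t * Complex.I) + -(t * Complex.I) by
        push_cast; ring, Complex.cpow_add _ _ hn0, MulChar.pow_apply' χ two_ne_zero]
    push_cast; ring
  rw [e1, e2, e3, Complex.re_ofReal_mul, Complex.re_ofReal_mul, Complex.re_ofReal_mul]
  have key : 0 ≤ 3 * ((1 : DirichletCharacter ℂ q) n).re + 4 * w.re + (w ^ 2).re := by
    by_cases hu : IsUnit (n : ZMod q)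
    · have hw1 : ‖w‖ = 1 := by
        rw [hw, norm_mul, ← hu.unit_spec, DirichletCharacter.unit_norm_eq_one χ hu.unit, one_mul,
          Complex.norm_natCast_cpow_of_pos (Nat.pos_of_ne_zero hn)]
        simp
      rw [MulChar.one_apply hu]
      have h2 : w.re ^ 2 + w.im ^ 2 = 1 := by
        have := Complex.sq_norm w
        rw [hw1, Complex.normSq_apply] at this
        nlinarith
      rw [sq, Complex.mul_re, Complex.one_re]
      nlinarith [sq_nonneg (w.re + 1)]
    · have hw0 : w = 0 := by rw [hw, MulChar.map_nonunit χ hu, zero_mul]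
      rw [hw0, MulChar.map_nonunit _ hu]; simp
  nlinarith [mul_nonneg hb0 key]

lemma re_one_div_add_mul_I (x y : ℝ) :
    (1 / ((x : ℂ) + y * Complex.I)).re = x / (x ^ 2 + y ^ 2) := by
  rw [one_div, Complex.inv_re]
  simp [Complex.normSq_apply, sq]

lemma Lreg_ne_zero_of_near_one (χ : DirichletCharacter ℂ q) {L η β γ : ℝ} (hL : 1 ≤ L)
    (hq : (q : ℝ) ≤ Real.exp L) (hη : η = 1 / (10 ^ 6 * L)) (hηL : Real.exp (-L) ≤ η)
    (hγ : |γ| ≤ 3 / 2 * Real.exp L) (h : χ ^ 2 ≠ 1 ∨ 4 * η ≤ |γ|) (hβ : 1 - η / 5 ≤ β) :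
    Lreg χ (β + γ * Complex.I) ≠ 0 := by
  intro h0
  have hLpos : (0 : ℝ) < L := by linarith
  have hηpos : 0 < η := by rw [hη]; positivity
  have hηLe : L * η = 1 / 10 ^ 6 := by rw [hη]; field_simp
  have hη1 : η ≤ 1 / 10 ^ 6 := by nlinarith
  have hβ1 : β < 1 := by
    by_contra hcon
    push Not at hcon
    exact Lreg_ne_zero_of_one_le_re χ (by simpa using hcon) h0
  have hE : 0 < Real.exp L := Real.exp_pos L
  have a1 := (landau_Lreg (1 : DirichletCharacter ℂ q) (t := 0) hL hq (by simp; linarith) hηpos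
    (by linarith) hηL).1
  have a2 := (landau_Lreg χ (t := γ) hL hq (by linarith) hηpos
    (by linarith) hηL).2 (β + γ * Complex.I) (by
      have : ((β : ℂ) + γ * Complex.I - (1 + η + γ * Complex.I)) = ((β - 1 - η : ℝ) : ℂ) := by
        push_cast; ring
      rw [this, Complex.norm_real, Real.norm_eq_abs, abs_le]
      constructor <;> linarith) h0
  have a3 := (landau_Lreg (χ ^ 2) (t := 2 * γ) hL hq (by rw [abs_mul, abs_two]; linarith) hηpos
    (by linarith) hηL).1
  have h341 := three_four_one χ (σ := 1 + η) (by linarith) γ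
  have e0 : ((1 + η : ℝ) : ℂ) = 1 + η + (0 : ℝ) * Complex.I := by push_cast; ring
  rw [LSeries_twistVM_eq _ (by simpa using hηpos), LSeries_twistVM_eq _ (by simpa using hηpos),
    LSeries_twistVM_eq _ (by simpa using hηpos), if_pos rfl, e0] at h341
  have e1 : ((1 : ℂ) + η + (0 : ℝ) * Complex.I - 1) = (η : ℂ) + (0 : ℝ) * Complex.I := by ring
  have e2 : ((1 : ℂ) + η + (0 : ℝ) * Complex.I + γ * Complex.I) = 1 + η + γ * Complex.I := by
    push_cast; ring
  have e3 : ((1 : ℂ) + η + (0 : ℝ) * Complex.I + (2 * γ : ℝ) * Complex.I) =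
      1 + η + (2 * γ : ℝ) * Complex.I := by
    push_cast; ring
  have e4 : ((1 : ℂ) + η + γ * Complex.I - 1) = (η : ℂ) + γ * Complex.I := by ring
  have e5 : ((1 : ℂ) + η + (2 * γ : ℝ) * Complex.I - 1) = (η : ℂ) + (2 * γ : ℝ) * Complex.I := by
    ring
  rw [e1, e2, e3, e4, e5, Complex.add_re, Complex.add_re, Complex.add_re, re_one_div_add_mul_I,
    Complex.neg_re, Complex.neg_re, Complex.neg_re] at h341
  have e6 : (1 / ((1 : ℂ) + η + γ * Complex.I - (β + γ * Complex.I))).re = 1 / (1 + η - β) := by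
    have : ((1 : ℂ) + η + γ * Complex.I - (β + γ * Complex.I)) = ((1 + η - β : ℝ) : ℂ) := by
      push_cast; ring
    rw [this, ← Complex.ofReal_one, ← Complex.ofReal_div, Complex.ofReal_re]
  rw [e6] at a2
  have b0 : η / (η ^ 2 + 0 ^ 2) = 1 / η := by field_simp; ring
  rw [b0] at h341
  have hex : 4 * η ≤ |γ| → ∀ y : ℝ, |γ| ≤ |y| → η / (η ^ 2 + y ^ 2) ≤ 1 / (17 * η) := by
    intro h1 y hy
    rw [div_le_div_iff₀ (by positivity) (by positivity)]
    have h2 : (4 * η) ^ 2 ≤ y ^ 2 := by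
      rw [← sq_abs y]
      have := h1.trans hy
      gcongr
    nlinarith
  have b1 : (if χ = 1 then 1 / ((η : ℂ) + γ * Complex.I) else 0).re ≤ 1 / (17 * η) := by
    split_ifs with h1
    · rcases h with h | h
      · exact absurd (by rw [h1, one_pow]) h
      · rw [re_one_div_add_mul_I]
        exact hex h γ le_rfl
    · simp; positivity
  have b2 : (if χ ^ 2 = 1 then 1 / ((η : ℂ) + (2 * γ : ℝ) * Complex.I) else 0).re ≤
      1 / (17 * η) := by
    split_ifs with h1
    · rcases h with h | h
      · exact absurd h1 h
      · rw [re_one_div_add_mul_I]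
        refine hex h (2 * γ) ?_
        rw [abs_mul, abs_two]; linarith [abs_nonneg γ]
    · simp; positivity
  have c1 : 4 * (1 / (1 + η - β)) ≤ 3 * (1 / η) + 5 * (1 / (17 * η)) + 8 * (624 * L) := by
    linarith
  have c2 : 1 / (6 / 5 * η) ≤ 1 / (1 + η - β) := by
    apply one_div_le_one_div_of_le <;> linarith
  have c3 : 4 * (1 / (6 / 5 * η)) ≤ 3 * (1 / η) + 5 * (1 / (17 * η)) + 8 * (624 * L) := by
    linarith
  have c4 := mul_le_mul_of_nonneg_right c3 hηpos.le
  have d1 : 4 * (1 / (6 / 5 * η)) * η = 10 / 3 := by field_simp; norm_num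
  have d2 : (3 * (1 / η) + 5 * (1 / (17 * η)) + 8 * (624 * L)) * η =
      3 + 5 / 17 + 8 * 624 * (L * η) := by field_simp
  rw [d1, d2, hηLe] at c4
  norm_num at c4

lemma Lreg_ne_zero_of_zeroFree_disk (χ : DirichletCharacter ℂ q) {L η : ℝ} (hL : 1 ≤ L)
    (hq : (q : ℝ) ≤ Real.exp L) (hη : η = 1 / (10 ^ 6 * L)) (hηL : Real.exp (-L) ≤ η)
    (hS : χ ^ 2 = 1 → ∀ s, ‖s - 1‖ ≤ 5 * η → Lreg χ s ≠ 0) {s : ℂ}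
    (hs : |s.im| ≤ 3 / 2 * Real.exp L) (hs1 : 1 - η / 5 ≤ s.re) : Lreg χ s ≠ 0 := by
  have hLpos : (0 : ℝ) < L := by linarith
  have hηpos : 0 < η := by rw [hη]; positivity
  by_cases h1 : 1 ≤ s.re
  · exact Lreg_ne_zero_of_one_le_re χ h1
  push Not at h1
  by_cases h2 : χ ^ 2 = 1 ∧ |s.im| < 4 * η
  · refine hS h2.1 s ((Complex.norm_le_abs_re_add_abs_im _).trans ?_)
    have h3 : |(s - 1).re| ≤ η / 5 := by
      rw [Complex.sub_re, Complex.one_re, abs_le]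
      constructor <;> linarith
    have h4 : |(s - 1).im| ≤ 4 * η := by
      rw [Complex.sub_im, Complex.one_im, sub_zero]; exact h2.2.le
    linarith
  · have h3 : χ ^ 2 ≠ 1 ∨ 4 * η ≤ |s.im| := by
      by_contra hcon
      push Not at hcon
      exact h2 ⟨hcon.1, hcon.2⟩
    have := Lreg_ne_zero_of_near_one χ hL hq hη hηL hs h3 hs1
    rwa [Complex.re_add_im] at this

lemma norm_logDeriv_Lreg_le (χ : DirichletCharacter ℂ q) {L η : ℝ} (hL : 1 ≤ L)
    (hq : (q : ℝ) ≤ Real.exp L) (hη : η = 1 / (10 ^ 6 * L)) (hηL : Real.exp (-L) ≤ η)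
    (hS : χ ^ 2 = 1 → ∀ s, ‖s - 1‖ ≤ 5 * η → Lreg χ s ≠ 0) {s : ℂ}
    (hs : |s.im| ≤ Real.exp L) (hs1 : 1 - η / 10 ≤ s.re) (hs2 : s.re ≤ 1 + η) :
    ‖logDeriv (Lreg χ) s‖ ≤ 10 ^ 11 * L ^ 2 := by
  have hLpos : (0 : ℝ) < L := by linarith
  have hηpos : 0 < η := by rw [hη]; positivity
  have hη1 : η ≤ 1 / 10 ^ 6 := by
    rw [hη, div_le_div_iff₀ (by positivity) (by positivity)]
    nlinarith
  have hE : 1 ≤ Real.exp L := Real.one_le_exp (by linarith)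
  set c : ℂ := 1 + η + s.im * Complex.I with hc
  have hcre : c.re = 1 + η := by simp [hc]
  have hcim : c.im = s.im := by simp [hc]
  have h1 : ‖s - c‖ ≤ 11 / 10 * η := by
    have : s - c = ((s.re - 1 - η : ℝ) : ℂ) := by
      apply Complex.ext
      · rw [Complex.sub_re, hcre, Complex.ofReal_re]; ring
      · rw [Complex.sub_im, hcim, Complex.ofReal_im]; ring
    rw [this, Complex.norm_real, Real.norm_eq_abs, abs_le]
    constructor <;> linarith
  have h2 := norm_logDeriv_le_of_ball (f := Lreg χ) (c := c) (R := 6 / 5 * η) (M := 13 * L)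
    (r := 11 / 10 * η) (by positivity) (by positivity)
    (differentiable_Lreg χ).differentiableOn (fun z hz => by
      have hz' : ‖z - c‖ < 6 / 5 * η := by simpa [dist_eq_norm] using hz
      have r1 := (Complex.abs_re_le_norm (z - c)).trans hz'.le
      have r2 := (Complex.abs_im_le_norm (z - c)).trans hz'.le
      rw [Complex.sub_re, hcre] at r1
      rw [Complex.sub_im, hcim] at r2
      refine Lreg_ne_zero_of_zeroFree_disk χ hL hq hη hηL hS ?_ ?_
      · have := abs_add_le (z.im - s.im) s.im
        rw [sub_add_cancel] at this
        linarith
      · linarith [(abs_le.1 r1).1])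
    (fun z hz => by
      have hz' : ‖z - c‖ < 6 / 5 * η := by simpa [dist_eq_norm] using hz
      exact norm_Lreg_ball_le χ hL hq (by linarith) hηpos (by linarith) hηL (by linarith))
    (by linarith) h1
  rw [logDeriv_apply]
  refine h2.trans ?_
  have e1 : 8 * (13 * L) * (6 / 5 * η) / (6 / 5 * η - 11 / 10 * η) ^ 2 = 12480 * L / η := by
    field_simp; norm_num
  rw [e1, hη]
  have e2 : 12480 * L / (1 / (10 ^ 6 * L)) = 12480 * 10 ^ 6 * L ^ 2 := by field_simp
  rw [e2]
  nlinarith [sq_nonneg L]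

end ZeroFree

section Siegel

set_option linter.unusedSectionVars false

open DirichletCharacter

open scoped ComplexOrder in
/-- `-F' / F` is the sum of the Dirichlet series with coefficients `d` on `1 < re s`. -/
def HasDirichletLogDeriv (F : ℂ → ℂ) (d : ℕ → ℂ) : Prop :=
  ∀ s : ℂ, 1 < s.re → LSeriesSummable d s ∧ HasDerivAt F (-(LSeries d s) * F s) s

lemma HasDirichletLogDeriv.mul {F₁ F₂ : ℂ → ℂ} {d₁ d₂ : ℕ → ℂ} (h₁ : HasDirichletLogDeriv F₁ d₁)
    (h₂ : HasDirichletLogDeriv F₂ d₂) :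
    HasDirichletLogDeriv (fun s => F₁ s * F₂ s) (d₁ + d₂) := by
  intro s hs
  obtain ⟨a1, b1⟩ := h₁ s hs
  obtain ⟨a2, b2⟩ := h₂ s hs
  refine ⟨a1.add a2, ?_⟩
  rw [LSeries_add a1 a2]
  refine (b1.fun_mul b2).congr_deriv ?_
  ring

open scoped ComplexOrder in
lemma HasDirichletLogDeriv.alternating {F : ℂ → ℂ} {d : ℕ → ℂ} (h : HasDirichletLogDeriv F d)
    (hd : 0 ≤ d) (hF : 0 ≤ F 2) (n : ℕ) : 0 ≤ (-1) ^ n * iteratedDeriv n F 2 := by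
  have hopen : IsOpen {s : ℂ | 1 < s.re} := isOpen_lt continuous_const Complex.continuous_re
  have hmem : {s : ℂ | 1 < s.re} ∈ nhds (2 : ℂ) := hopen.mem_nhds (by simp)
  have hFan : AnalyticAt ℂ F 2 :=
    DifferentiableOn.analyticAt (s := {s : ℂ | 1 < s.re})
      (fun s hs => (h s hs).2.differentiableAt.differentiableWithinAt) hmem
  have habs : LSeries.abscissaOfAbsConv d < (2 : ℝ) := by
    have h1 := (h ((3 / 2 : ℝ) : ℂ) (by rw [Complex.ofReal_re]; norm_num)).1.abscissaOfAbsConv_le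
    refine lt_of_le_of_lt h1 ?_
    rw [Complex.ofReal_re, EReal.coe_lt_coe_iff]
    norm_num
  have hDan : AnalyticAt ℂ (LSeries d) 2 := by
    refine LSeries_analyticOnNhd d 2 ?_
    simpa using habs
  have hev : deriv F =ᶠ[nhds 2] fun s => -((LSeries d * F) s) := by
    filter_upwards [hmem] with s hs
    rw [(h s hs).2.deriv, Pi.mul_apply, neg_mul]
  induction n using Nat.strong_induction_on with
  | _ n ih =>
    rcases n with _ | n
    · simpa using hF
    · have e1 : iteratedDeriv (n + 1) F 2 = -iteratedDeriv n (LSeries d * F) 2 := by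
        rw [iteratedDeriv_succ', Filter.EventuallyEq.iteratedDeriv_eq n hev,
          iteratedDeriv_fun_neg]
      rw [e1, iteratedDeriv_mul hDan.contDiffAt hFan.contDiffAt, pow_succ, mul_assoc, neg_one_mul,
        neg_neg, Finset.mul_sum]
      refine Finset.sum_nonneg fun i hi => ?_
      have hi' : i ≤ n := Nat.lt_succ_iff.1 (Finset.mem_range.1 hi)
      have h2 := LSeries.iteratedDeriv_alternating hd habs i
      have h3 := ih (n - i) (by omega)
      have e2 : (-1 : ℂ) ^ n * (n.choose i * iteratedDeriv i (LSeries d) 2 *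
          iteratedDeriv (n - i) F 2) = (n.choose i : ℂ) *
          (((-1) ^ i * iteratedDeriv i (LSeries d) ((2 : ℝ) : ℂ)) *
          ((-1) ^ (n - i) * iteratedDeriv (n - i) F 2)) := by
        have : (-1 : ℂ) ^ n = (-1) ^ i * (-1) ^ (n - i) := by
          rw [← pow_add, Nat.add_sub_cancel' hi']
        rw [this]
        push_cast
        ring
      rw [e2]
      exact mul_nonneg (by exact_mod_cast Nat.zero_le _) (mul_nonneg h2 h3)

open scoped ComplexOrder in
/-- Estermann's lower bound for the residue of a product of `L`-functions. -/
lemma HasDirichletLogDeriv.le_norm_residue {F G : ℂ → ℂ} {d : ℕ → ℂ}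
    (h : HasDirichletLogDeriv F d) (hd : 0 ≤ d) (hG : Differentiable ℂ G)
    (hGF : ∀ s : ℂ, 1 < s.re → G s = (s - 1) * F s) {c₀ B : ℝ} (hc₀ : 0 < c₀)
    (hF : (c₀ : ℂ) ≤ F 2) (hB : ∀ z, ‖z - 2‖ ≤ 3 / 2 → ‖G z‖ ≤ B) {M : ℕ} (hM : 1 ≤ M)
    (hMB : 16 * B * (3 / 4) ^ M ≤ c₀ / 2) {β : ℝ} (hβ : 7 / 8 ≤ β) (hβ1 : β < 1)
    (hGβ : 0 ≤ (G β).re) :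
    c₀ / 2 * (1 - β) * Real.exp (-(M * (1 - β))) ≤ ‖G 1‖ := by
  have hc₀' : (0 : ℂ) ≤ c₀ := by exact_mod_cast hc₀.le
  set H : ℂ → ℂ := dslope G 1 with hH
  have hHd : Differentiable ℂ H := by
    rw [← differentiableOn_univ] at hG ⊢
    exact (Complex.differentiableOn_dslope Filter.univ_mem).2 hG
  have hHe : ∀ s, s ≠ 1 → H s = (G s - G 1) / (s - 1) := by
    intro s hs
    rw [hH, dslope_of_ne _ hs, slope_def_field]
  have hopen : IsOpen {s : ℂ | 1 < s.re} := isOpen_lt continuous_const Complex.continuous_re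
  have hmem : {s : ℂ | 1 < s.re} ∈ nhds (2 : ℂ) := hopen.mem_nhds (by simp)
  have hFan : AnalyticAt ℂ F 2 :=
    DifferentiableOn.analyticAt (s := {s : ℂ | 1 < s.re})
      (fun s hs => (h s hs).2.differentiableAt.differentiableWithinAt) hmem
  have hinv : ∀ n, iteratedDeriv n (fun s : ℂ => (s - 1)⁻¹) 2 = (-1) ^ n * n.factorial := by
    intro n
    rw [iteratedDeriv_comp_sub_const (f := fun z : ℂ => z⁻¹)]
    change iteratedDeriv n Inv.inv ((2 : ℂ) - 1) = _
    rw [iteratedDeriv_eq_iterate, iter_deriv_inv]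
    norm_num
  have hevH : H =ᶠ[nhds 2] fun s => F s - G 1 * (s - 1)⁻¹ := by
    filter_upwards [hmem] with s hs
    have hs' : 1 < s.re := hs
    have hs1 : s ≠ 1 := by
      rintro rfl
      simp at hs'
    have hs2 := sub_ne_zero.2 hs1
    rw [hHe s hs1, hGF s hs']
    field_simp
  have hHn : ∀ n, iteratedDeriv n H 2 =
      iteratedDeriv n F 2 - G 1 * ((-1) ^ n * n.factorial) := by
    intro n
    have a1 : AnalyticAt ℂ (fun s : ℂ => (s - 1)⁻¹) 2 :=
      AnalyticAt.inv (by fun_prop) (by norm_num)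
    have a2 : AnalyticAt ℂ (fun s : ℂ => G 1 * (s - 1)⁻¹) 2 := analyticAt_const.mul a1
    rw [Filter.EventuallyEq.iteratedDeriv_eq n hevH,
      iteratedDeriv_fun_sub hFan.contDiffAt a2.contDiffAt,
      iteratedDeriv_const_mul_field, hinv]
  have hB0 : 0 ≤ B := (norm_nonneg _).trans (hB 2 (by norm_num))
  have hHb : ∀ z ∈ Metric.sphere (2 : ℂ) (3 / 2), ‖H z‖ ≤ 4 * B := by
    intro z hz
    have hz' : ‖z - 2‖ = 3 / 2 := by simpa [dist_eq_norm] using hz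
    have hz1 : 1 / 2 ≤ ‖z - 1‖ := by
      have := norm_sub_le (z - 1) 1
      rw [show z - 1 - 1 = z - 2 by ring, hz', norm_one] at this
      linarith
    have hz2 : z ≠ 1 := by
      rintro rfl
      norm_num at hz1
    rw [hHe z hz2, norm_div, div_le_iff₀ (by linarith)]
    have := norm_sub_le (G z) (G 1)
    have b1 := hB z hz'.le
    have b2 := hB 1 (by norm_num)
    nlinarith
  have hHc : ∀ n, ‖iteratedDeriv n H 2‖ ≤ n.factorial * (4 * B) / (3 / 2) ^ n := fun n =>
    Complex.norm_iteratedDeriv_le_of_forall_mem_sphere_norm_le n (by norm_num)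
      hHd.diffContOnCl hHb
  have hβ2 : ‖((β : ℂ) - 2)‖ = 2 - β := by
    rw [show ((β : ℂ) - 2) = ((β - 2 : ℝ) : ℂ) by push_cast; ring, Complex.norm_real,
      Real.norm_eq_abs, abs_of_neg (by linarith)]
    ring
  set f : ℕ → ℂ := fun n => (n.factorial : ℂ)⁻¹ • ((β : ℂ) - 2) ^ n • iteratedDeriv n H 2 with hf
  have hsum : HasSum f (H β) :=
    Complex.hasSum_taylorSeries_on_ball (r := 3 / 2) hHd.differentiableOn
      (by rw [Metric.mem_ball, dist_eq_norm, hβ2]; linarith)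
  have hfb : ∀ n, ‖f n‖ ≤ 4 * B * (3 / 4) ^ n := by
    intro n
    have hn : (0 : ℝ) < n.factorial := by exact_mod_cast n.factorial_pos
    rw [hf]
    simp only [smul_eq_mul]
    rw [norm_mul, norm_mul, norm_inv, Complex.norm_natCast, norm_pow, hβ2]
    calc (n.factorial : ℝ)⁻¹ * ((2 - β) ^ n * ‖iteratedDeriv n H 2‖)
        ≤ (n.factorial : ℝ)⁻¹ * ((9 / 8) ^ n * (n.factorial * (4 * B) / (3 / 2) ^ n)) := by
          gcongr
          · linarith
          · linarith
          · exact hHc n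
      _ = 4 * B * ((9 / 8) / (3 / 2)) ^ n := by
          rw [div_pow (9 / 8 : ℝ) (3 / 2)]
          field_simp
      _ = _ := by norm_num
  have htail : ‖∑' n, f (n + M)‖ ≤ c₀ / 2 := by
    refine (tsum_of_norm_bounded (g := fun n => 4 * B * (3 / 4) ^ M * (3 / 4) ^ n)
      ((hasSum_geometric_of_lt_one (by norm_num) (by norm_num : (3 / 4 : ℝ) < 1)).mul_left _)
      fun n => ?_).trans ?_
    · refine (hfb (n + M)).trans (le_of_eq ?_)
      rw [pow_add]; ring
    · refine le_trans (le_of_eq ?_) hMB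
      ring
  set x : ℝ := 2 - β with hx
  have hre : ∀ n, (f n).re = (((n.factorial : ℂ)⁻¹ * ((-1) ^ n * iteratedDeriv n F 2)).re -
      (G 1).re) * x ^ n := by
    intro n
    have hn : (n.factorial : ℂ) ≠ 0 := by exact_mod_cast n.factorial_ne_zero
    have e1 : f n = ((x ^ n : ℝ) : ℂ) *
        ((n.factorial : ℂ)⁻¹ * ((-1) ^ n * iteratedDeriv n F 2) - G 1) := by
      have e2 : ((β : ℂ) - 2) ^ n = (-1) ^ n * (x : ℂ) ^ n := by
        rw [← mul_pow, hx]; push_cast; ring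
      have e3 : (-1 : ℂ) ^ n * (-1) ^ n = 1 := by rw [← mul_pow]; simp
      rw [hf]
      simp only [smul_eq_mul]
      rw [hHn, e2]
      push_cast
      field_simp
      linear_combination (-(G 1) * (x : ℂ) ^ n * n.factorial) * e3
    rw [e1, Complex.re_ofReal_mul, Complex.sub_re]
    ring
  have hFb : ∀ n, 0 ≤ ((n.factorial : ℂ)⁻¹ * ((-1) ^ n * iteratedDeriv n F 2)).re := by
    intro n
    have h1 := h.alternating hd (hc₀'.trans hF) n
    have h2 : (0 : ℂ) ≤ (n.factorial : ℂ)⁻¹ := by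
      rw [← Complex.ofReal_natCast, ← Complex.ofReal_inv]
      exact_mod_cast (by positivity : (0 : ℝ) ≤ (n.factorial : ℝ)⁻¹)
    exact (Complex.nonneg_iff.1 (mul_nonneg h2 h1)).1
  have hF0 : c₀ ≤ ((Nat.factorial 0 : ℂ)⁻¹ * ((-1) ^ 0 * iteratedDeriv 0 F 2)).re := by
    simpa using (Complex.le_def.1 hF).1
  have hx1 : 1 < x := by rw [hx]; linarith
  have hGre : (G 1).re ≤ ‖G 1‖ := Complex.re_le_norm _
  have hgeom : (∑ n ∈ Finset.range M, x ^ n) * (1 - β) = x ^ M - 1 := by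
    rw [← geom_sum_mul x M, hx]; ring
  have hhead : c₀ - ‖G 1‖ * ∑ n ∈ Finset.range M, x ^ n ≤ (∑ n ∈ Finset.range M, f n).re := by
    rw [Complex.re_sum, Finset.sum_congr rfl fun n _ => hre n]
    have e1 : ∀ n, (((n.factorial : ℂ)⁻¹ * ((-1) ^ n * iteratedDeriv n F 2)).re -
      (G 1).re) * x ^ n = ((n.factorial : ℂ)⁻¹ * ((-1) ^ n * iteratedDeriv n F 2)).re * x ^ n -
      (G 1).re * x ^ n := fun n => by ring
    rw [Finset.sum_congr rfl fun n _ => e1 n, Finset.sum_sub_distrib, ← Finset.mul_sum]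
    have h1 : c₀ ≤ ∑ n ∈ Finset.range M,
        ((n.factorial : ℂ)⁻¹ * ((-1) ^ n * iteratedDeriv n F 2)).re * x ^ n := by
      refine le_trans ?_ (Finset.single_le_sum (f := fun n : ℕ =>
        ((n.factorial : ℂ)⁻¹ * ((-1) ^ n * iteratedDeriv n F 2)).re * x ^ n)
        (fun n _ => mul_nonneg (hFb n) (by positivity)) (Finset.mem_range.2 hM))
      simpa using hF0
    have h2 : 0 ≤ ∑ n ∈ Finset.range M, x ^ n := Finset.sum_nonneg fun n _ => by positivity
    nlinarith
  have hHβ : (H β).re * (1 - β) ≤ ‖G 1‖ := by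
    have hb : (β : ℂ) ≠ 1 := by exact_mod_cast hβ1.ne
    have e1 : H β * ((1 - β : ℝ) : ℂ) = G 1 - G β := by
      rw [hHe _ hb]
      have := sub_ne_zero.2 hb
      push_cast
      field_simp
      ring
    have e2 := congrArg Complex.re e1
    rw [mul_comm, Complex.re_ofReal_mul, Complex.sub_re] at e2
    linarith
  have hfin : c₀ - ‖G 1‖ * ∑ n ∈ Finset.range M, x ^ n - c₀ / 2 ≤ (H β).re := by
    have e1 := hsum.summable.sum_add_tsum_nat_add M
    rw [hsum.tsum_eq] at e1
    rw [← e1, Complex.add_re]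
    have := (Complex.abs_re_le_norm (∑' n, f (n + M))).trans htail
    linarith [(abs_le.1 this).1]
  have hfin2 : c₀ / 2 * (1 - β) ≤ ‖G 1‖ * x ^ M := by
    have := mul_le_mul_of_nonneg_right hfin (by linarith : 0 ≤ 1 - β)
    have e1 : ‖G 1‖ * (∑ n ∈ Finset.range M, x ^ n) * (1 - β) = ‖G 1‖ * (x ^ M - 1) := by
      rw [mul_assoc, hgeom]
    linarith
  have hxM : x ^ M ≤ Real.exp (M * (1 - β)) := by
    rw [Real.exp_nat_mul]
    have := Real.add_one_le_exp (1 - β)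
    refine pow_le_pow_left₀ (by linarith) ?_ M
    rw [hx]; linarith
  rw [Real.exp_neg, ← div_eq_mul_inv, div_le_iff₀ (Real.exp_pos _)]
  exact hfin2.trans (by gcongr)

end Siegel

section SiegelBound

set_option linter.unusedSectionVars false

open DirichletCharacter

variable {q : ℕ} [NeZero q]

lemma conj_apply_of_sq_eq_one {χ : DirichletCharacter ℂ q} (hχ : χ ^ 2 = 1) (a : ZMod q) :
    (starRingEnd ℂ) (χ a) = χ a := by
  rcases (MulChar.isQuadratic_iff_sq_eq_one.2 hχ) a with h | h | h <;> simp [h]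

lemma conj_charInt {χ : DirichletCharacter ℂ q} (hχ : χ ^ 2 = 1) (s : ℂ) :
    (starRingEnd ℂ) (charInt χ s) = charInt χ ((starRingEnd ℂ) s) := by
  have hm : (starRingEnd ℂ) (charMean χ) = charMean χ := by
    simp only [charMean]
    split_ifs <;> simp
  have he : ∀ u, (starRingEnd ℂ) (charErr χ u) = charErr χ u := by
    intro u
    simp only [charErr]
    rw [map_sub, map_sum, map_mul, hm, Complex.conj_ofReal]
    simp only [conj_apply_of_sq_eq_one hχ]
  simp only [charInt]
  rw [← integral_conj]
  refine MeasureTheory.setIntegral_congr_fun measurableSet_Ioi fun u hu => ?_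
  have hu0 : (0 : ℝ) < u := lt_trans one_pos hu
  simp only [map_mul]
  rw [he, show -((starRingEnd ℂ) s + 1) = (starRingEnd ℂ) (-(s + 1)) by simp, Complex.cpow_conj,
    Complex.conj_ofReal]
  · rw [Complex.arg_ofReal_of_nonneg hu0.le]
    exact Real.pi_pos.ne

lemma conj_Lreg {χ : DirichletCharacter ℂ q} (hχ : χ ^ 2 = 1) {s : ℂ} (hs : 0 < s.re) :
    (starRingEnd ℂ) (Lreg χ s) = Lreg χ ((starRingEnd ℂ) s) := by
  have hm : (starRingEnd ℂ) (charMean χ) = charMean χ := by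
    simp only [charMean]
    split_ifs <;> simp
  rw [Lreg_eq_charInt χ hs, Lreg_eq_charInt χ (by simpa using hs), map_add, map_mul, hm, map_mul,
    map_mul, conj_charInt hχ]
  split_ifs <;> simp

lemma Lreg_ofReal_im {χ : DirichletCharacter ℂ q} (hχ : χ ^ 2 = 1) {x : ℝ} (hx : 0 < x) :
    (Lreg χ x).im = 0 := by
  rw [← Complex.conj_eq_iff_im, conj_Lreg hχ (by simpa using hx), Complex.conj_ofReal]

lemma re_LFunction_two (χ : DirichletCharacter ℂ q) : 1 / 4 ≤ (LFunction χ 2).re := by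
  rw [LFunction_eq_LSeries χ (by simp)]
  have hs : LSeriesSummable (fun n : ℕ => χ n) 2 :=
    LSeriesSummable_of_one_lt_re χ (by simp)
  have h1 : HasSum (fun n => LSeries.term (fun n : ℕ => χ n) 2 n) (LSeries (fun n : ℕ => χ n) 2) :=
    hs.hasSum
  have hn : ∀ n, ‖LSeries.term (fun n : ℕ => χ n) 2 (n + 2)‖ ≤ 1 / ((n + 2 : ℕ) : ℝ) ^ 2 := by
    intro n
    rw [LSeries.term_of_ne_zero (by omega), norm_div]
    refine div_le_div₀ zero_le_one (DirichletCharacter.norm_le_one χ _) (by positivity) ?_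
    rw [Complex.norm_natCast_cpow_of_pos (by omega)]
    simp
  have hz : HasSum (fun n : ℕ => 1 / ((n + 2 : ℕ) : ℝ) ^ 2) (Real.pi ^ 2 / 6 - 1) := by
    have := (hasSum_nat_add_iff' (f := fun n : ℕ => 1 / (n : ℝ) ^ 2) 2).2 hasSum_zeta_two
    simpa [Finset.sum_range_succ] using this
  have h2 := hs.sum_add_tsum_nat_add 2
  have h3 : ∑ i ∈ Finset.range 2, LSeries.term (fun n : ℕ => χ n) 2 i = 1 := by
    simp [Finset.sum_range_succ, LSeries.term]
  rw [h3] at h2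
  have h4 := tsum_of_norm_bounded hz hn
  change 1 / 4 ≤ (∑' n, LSeries.term (fun n : ℕ => χ n) 2 n).re
  rw [← h2, Complex.add_re, Complex.one_re]
  have h5 := (abs_le.1 ((Complex.abs_re_le_norm _).trans h4)).1
  have h6 := Real.pi_lt_d2
  have h7 := Real.pi_pos
  nlinarith

lemma one_sub_mul_cpow_ne_zero {M : ℕ} (χ : DirichletCharacter ℂ M) {p : ℕ} (hp : p.Prime) {s : ℂ}
    (hs : 0 < s.re) : 1 - χ p * (p : ℂ) ^ (-s) ≠ 0 := by
  intro h
  have h1 : ‖χ p * (p : ℂ) ^ (-s)‖ = 1 := by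
    rw [← sub_eq_zero.1 h, norm_one]
  have h2 : ‖χ p * (p : ℂ) ^ (-s)‖ < 1 := by
    rw [norm_mul, Complex.norm_natCast_cpow_of_pos hp.pos, Complex.neg_re]
    have h3 : (p : ℝ) ^ (-s.re) < 1 :=
      Real.rpow_lt_one_of_one_lt_of_neg (by exact_mod_cast hp.one_lt) (by linarith)
    have h4 := DirichletCharacter.norm_le_one χ (p : ZMod M)
    have h5 : (0 : ℝ) ≤ (p : ℝ) ^ (-s.re) := by positivity
    nlinarith [norm_nonneg (χ (p : ZMod M))]
  linarith

lemma Lreg_changeLevel_eq_zero_iff {M N : ℕ} [NeZero M] [NeZero N] (hMN : M ∣ N)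
    (χ : DirichletCharacter ℂ M) {s : ℂ} (hs : 0 < s.re) (hs1 : s ≠ 1) :
    Lreg (changeLevel hMN χ) s = 0 ↔ Lreg χ s = 0 := by
  have h1 : ∏ p ∈ N.primeFactors, (1 - χ p * (p : ℂ) ^ (-s)) ≠ 0 :=
    Finset.prod_ne_zero_iff.2 fun p hp =>
      one_sub_mul_cpow_ne_zero χ (Nat.prime_of_mem_primeFactors hp) hs
  have h2 := sub_ne_zero.2 hs1
  rw [Lreg_eq _ hs1, Lreg_eq _ hs1, LFunction_changeLevel hMN χ (Or.inr hs1)]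
  split_ifs <;> simp [h1, h2]

lemma exists_Lreg_one_ne_zero : ∃ r > 0, ∀ (q : ℕ) [NeZero q], ∀ s : ℂ, ‖s - 1‖ ≤ r →
    Lreg (1 : DirichletCharacter ℂ q) s ≠ 0 := by
  have h0 := Lreg_ne_zero_of_one_le_re (1 : DirichletCharacter ℂ 1) (s := 1) (by simp)
  have hc := (differentiable_Lreg (1 : DirichletCharacter ℂ 1)).continuous.continuousAt (x := 1)
  obtain ⟨r, hr, h⟩ := Metric.eventually_nhds_iff.1 (hc.eventually_ne h0)
  refine ⟨min (r / 2) (1 / 2), by positivity, fun q _ s hs => ?_⟩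
  by_cases hs1 : s = 1
  · exact Lreg_ne_zero_of_one_le_re _ (by simp [hs1])
  have hs2 : 0 < s.re := by
    have := (abs_le.1 ((Complex.abs_re_le_norm _).trans (hs.trans (min_le_right _ _)))).1
    simp at this
    linarith
  have h1 : (1 : DirichletCharacter ℂ q) =
      changeLevel (one_dvd q) (1 : DirichletCharacter ℂ 1) := by
    simp
  rw [h1, Ne, Lreg_changeLevel_eq_zero_iff _ _ hs2 hs1]
  refine h ?_
  rw [dist_eq_norm]
  exact lt_of_le_of_lt (hs.trans (min_le_left _ _)) (by linarith)

lemma norm_Lreg_le_near_one (χ : DirichletCharacter ℂ q) {θ : ℝ} (hθ : 0 < θ) (hθ1 : θ ≤ 1) {s : ℂ}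
    (hs : ‖s - 1‖ ≤ θ / 2) : ‖Lreg χ s‖ ≤ 20 * (q : ℝ) ^ θ / θ := by
  have hq : (1 : ℝ) ≤ q := by exact_mod_cast Nat.one_le_iff_ne_zero.2 (NeZero.ne q)
  have hre : 1 - θ / 2 ≤ s.re := by
    have := (abs_le.1 ((Complex.abs_re_le_norm _).trans hs)).1
    simp at this
    linarith
  have hK : ∀ u : ℝ, 1 ≤ u → ‖charErr χ u‖ ≤ 3 * (q : ℝ) ^ θ * u ^ (1 - θ) := by
    intro u hu
    have a1 := norm_charErr_le χ (by linarith : 0 ≤ u)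
    have a2 : ‖charErr χ u‖ ≤ 3 * u := by
      simp only [charErr]
      refine (norm_sub_le _ _).trans ?_
      have b1 : ‖∑ k ∈ Finset.Icc 1 ⌊u⌋₊, χ k‖ ≤ u := by
        refine (norm_sum_le_of_le _ fun k _ => DirichletCharacter.norm_le_one χ _).trans ?_
        simpa using Nat.floor_le (by linarith : 0 ≤ u)
      have b2 : ‖charMean χ * u‖ ≤ u := by
        rw [norm_mul, Complex.norm_real, Real.norm_eq_abs, abs_of_nonneg (by linarith)]
        nlinarith [norm_charMean_le χ]
      linarith
    rcases le_total (q : ℝ) u with h | h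
    · refine a1.trans ?_
      have : (q : ℝ) = (q : ℝ) ^ θ * (q : ℝ) ^ (1 - θ) := by
        rw [← Real.rpow_add (by linarith)]; simp
      rw [mul_assoc]
      conv_lhs => rw [this]
      gcongr
    · refine a2.trans ?_
      have : u = u ^ θ * u ^ (1 - θ) := by
        rw [← Real.rpow_add (by linarith)]; simp
      rw [mul_assoc]
      conv_lhs => rw [this]
      gcongr
  have h1 := norm_charInt_le χ hK (s := s) (by linarith)
  have hqθ : 1 ≤ (q : ℝ) ^ θ := Real.one_le_rpow hq hθ.le
  have h2 : ‖charInt χ s‖ ≤ 6 * (q : ℝ) ^ θ / θ := by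
    refine h1.trans ?_
    rw [div_le_div_iff₀ (by linarith) hθ]
    nlinarith
  have h3 : ‖s‖ ≤ 3 / 2 := by
    have := norm_add_le (s - 1) 1
    rw [sub_add_cancel, norm_one] at this
    linarith
  have h4 : ‖(if χ = 1 then s - 1 else 1 : ℂ)‖ ≤ 1 := by
    split_ifs
    · linarith
    · simp
  rw [Lreg_eq_charInt χ (by linarith)]
  have h5 : 1 ≤ (q : ℝ) ^ θ / θ := by
    rw [le_div_iff₀ hθ]; linarith
  calc ‖charMean χ * s + (if χ = 1 then s - 1 else 1) * (s * charInt χ s)‖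
      ≤ 1 * (3 / 2) + 1 * (3 / 2 * (6 * (q : ℝ) ^ θ / θ)) := by
        refine (norm_add_le _ _).trans ?_
        rw [norm_mul, norm_mul, norm_mul]
        gcongr
        exact norm_charMean_le χ
    _ ≤ _ := by
        rw [mul_div_assoc, mul_div_assoc]
        linarith

end SiegelBound

section SiegelTheorem

set_option linter.unusedSectionVars false

open DirichletCharacter

variable {q : ℕ} [NeZero q]

lemma hasDirichletLogDeriv_LFunction (χ : DirichletCharacter ℂ q) :
    HasDirichletLogDeriv (LFunction χ) (twistVM χ) := by
  intro s hs
  have hs1 : s ≠ 1 := by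
    rintro rfl
    simp at hs
  have hL := LFunction_ne_zero_of_one_le_re χ (Or.inr hs1) hs.le
  refine ⟨LSeriesSummable_twistVM χ hs, ?_⟩
  rw [LSeries_twistVM_eq χ hs, logDeriv_Lreg χ hs1 hL]
  refine (differentiableAt_LFunction χ s (Or.inl hs1)).hasDerivAt.congr_deriv ?_
  rw [logDeriv_apply]
  split_ifs <;> field_simp <;> ring

lemma LFunction_two_eq {χ : DirichletCharacter ℂ q} (hχ : χ ^ 2 = 1) :
    ∃ r : ℝ, 1 / 4 ≤ r ∧ LFunction χ 2 = r := by
  refine ⟨(LFunction χ 2).re, re_LFunction_two χ, ?_⟩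
  have h1 : Lreg χ 2 = LFunction χ 2 := by
    rw [Lreg_eq χ (by norm_num)]
    split_ifs <;> norm_num
  have h2 := Lreg_ofReal_im hχ (x := 2) (by norm_num)
  push_cast at h2
  rw [h1] at h2
  exact Complex.ext (by simp) (by simp [h2])

/-- The product of the `L`-functions of `1, ψ₁, ψ₂, ψ₁ψ₂`, with the pole at `1` removed. -/
noncomputable def Lreg₄ (ψ₁ ψ₂ : DirichletCharacter ℂ q) (s : ℂ) : ℂ :=
  Lreg (1 : DirichletCharacter ℂ q) s * Lreg ψ₁ s * (Lreg ψ₂ s * Lreg (ψ₁ * ψ₂) s)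

open scoped ComplexOrder in
lemma le_norm_Lreg₄ {ψ₁ ψ₂ : DirichletCharacter ℂ q} (h₁ : ψ₁ ^ 2 = 1) (h₂ : ψ₂ ^ 2 = 1)
    (n₁ : ψ₁ ≠ 1) (n₂ : ψ₂ ≠ 1) (n₃ : ψ₁ * ψ₂ ≠ 1) {β : ℝ} (hβ : 7 / 8 ≤ β) (hβ1 : β < 1)
    (hG : 0 ≤ (Lreg₄ ψ₁ ψ₂ β).re) :
    Real.exp (-22) / 512 * (1 - β) * (q : ℝ) ^ (-(16 * (1 - β))) ≤ ‖Lreg₄ ψ₁ ψ₂ 1‖ := by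
  have hq : (1 : ℝ) ≤ q := by exact_mod_cast Nat.one_le_iff_ne_zero.2 (NeZero.ne q)
  have h₃ : (ψ₁ * ψ₂) ^ 2 = 1 := by rw [mul_pow, h₁, h₂, one_mul]
  have h := ((hasDirichletLogDeriv_LFunction (1 : DirichletCharacter ℂ q)).mul
    (hasDirichletLogDeriv_LFunction ψ₁)).mul
      ((hasDirichletLogDeriv_LFunction ψ₂).mul (hasDirichletLogDeriv_LFunction (ψ₁ * ψ₂)))
  have hd : 0 ≤ twistVM (1 : DirichletCharacter ℂ q) + twistVM ψ₁ +
      (twistVM ψ₂ + twistVM (ψ₁ * ψ₂)) := by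
    intro n
    have hΛ : (0 : ℂ) ≤ (ArithmeticFunction.vonMangoldt n : ℂ) := by
      exact_mod_cast ArithmeticFunction.vonMangoldt_nonneg
    simp only [Pi.add_apply, Pi.zero_apply, twistVM, MulChar.mul_apply]
    by_cases hu : IsUnit (n : ZMod q)
    · rw [MulChar.one_apply hu]
      have e1 : ∀ x y l : ℂ, 1 * l + x * l + (y * l + x * y * l) = (1 + x) * (1 + y) * l :=
        fun x y l => by ring
      rw [e1]
      have e2 : ∀ {χ : DirichletCharacter ℂ q}, χ ^ 2 = 1 → (0 : ℂ) ≤ 1 + χ n := by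
        intro χ hχ
        rcases (MulChar.isQuadratic_iff_sq_eq_one.2 hχ) n with h | h | h <;> rw [h] <;> norm_num
      exact mul_nonneg (mul_nonneg (e2 h₁) (e2 h₂)) hΛ
    · simp [MulChar.map_nonunit _ hu]
  have hGd : Differentiable ℂ (Lreg₄ ψ₁ ψ₂) :=
    ((differentiable_Lreg _).mul (differentiable_Lreg _)).mul
      ((differentiable_Lreg _).mul (differentiable_Lreg _))
  have hGF : ∀ s : ℂ, 1 < s.re → Lreg₄ ψ₁ ψ₂ s =
      (s - 1) * (LFunction (1 : DirichletCharacter ℂ q) s * LFunction ψ₁ s *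
        (LFunction ψ₂ s * LFunction (ψ₁ * ψ₂) s)) := by
    intro s hs
    have hs1 : s ≠ 1 := by
      rintro rfl
      simp at hs
    simp only [Lreg₄]
    rw [Lreg_eq _ hs1, Lreg_eq _ hs1, Lreg_eq _ hs1, Lreg_eq _ hs1, if_pos rfl, if_neg n₁,
      if_neg n₂, if_neg n₃]
    ring
  have hF : ((1 / 256 : ℝ) : ℂ) ≤ LFunction (1 : DirichletCharacter ℂ q) 2 * LFunction ψ₁ 2 *
        (LFunction ψ₂ 2 * LFunction (ψ₁ * ψ₂) 2) := by
    obtain ⟨r₀, hr₀, e₀⟩ := LFunction_two_eq (χ := (1 : DirichletCharacter ℂ q)) (one_pow 2)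
    obtain ⟨r₁, hr₁, e₁⟩ := LFunction_two_eq h₁
    obtain ⟨r₂, hr₂, e₂⟩ := LFunction_two_eq h₂
    obtain ⟨r₃, hr₃, e₃⟩ := LFunction_two_eq h₃
    rw [e₀, e₁, e₂, e₃]
    have : 1 / 256 ≤ r₀ * r₁ * (r₂ * r₃) := by
      calc (1 / 256 : ℝ) = 1 / 4 * (1 / 4) * (1 / 4 * (1 / 4)) := by norm_num
        _ ≤ _ := by gcongr
    exact_mod_cast this
  have hB : ∀ z, ‖z - 2‖ ≤ 3 / 2 → ‖Lreg₄ ψ₁ ψ₂ z‖ ≤ (142 * q) ^ 4 := by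
    intro z hz
    have hre : 1 / 2 ≤ z.re := by
      have := (abs_le.1 ((Complex.abs_re_le_norm _).trans hz)).1
      simp at this
      linarith
    have hz2 : ‖z‖ ≤ 7 / 2 := by
      have := norm_add_le (z - 2) 2
      rw [sub_add_cancel] at this
      norm_num at this
      linarith
    have hL : ∀ χ : DirichletCharacter ℂ q, ‖Lreg χ z‖ ≤ 142 * q := by
      intro χ
      refine (norm_Lreg_le χ hre).trans ?_
      have : (‖z‖ + 1) ^ 2 ≤ 142 / 7 := by nlinarith [norm_nonneg z]
      nlinarith
    simp only [Lreg₄]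
    rw [norm_mul, norm_mul, norm_mul]
    calc _ ≤ (142 * q : ℝ) * (142 * q) * (142 * q * (142 * q)) := by gcongr <;> exact hL _
      _ = _ := by ring
  have hlq : 0 ≤ Real.log q := Real.log_nonneg hq
  set M : ℕ := ⌈168 + 16 * Real.log q⌉₊ with hM
  have hM1 : 168 + 16 * Real.log q ≤ M := Nat.le_ceil _
  have hM2 : (M : ℝ) ≤ 169 + 16 * Real.log q := by
    have := (Nat.ceil_lt_add_one (by positivity : 0 ≤ 168 + 16 * Real.log q)).le
    linarith
  have hMpos : 1 ≤ M := by
    have : (1 : ℝ) ≤ M := by linarith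
    exact_mod_cast this
  have h34 : (3 / 4 : ℝ) ^ M ≤ ((2 : ℝ) ^ 42 * q ^ 4)⁻¹ := by
    have a1 : (3 / 4 : ℝ) ≤ Real.exp (-(1 / 4)) := by
      have := Real.add_one_le_exp (-(1 / 4) : ℝ)
      linarith
    have a2 : (2 : ℝ) ^ 42 * q ^ 4 ≤ Real.exp (42 + 4 * Real.log q) := by
      rw [Real.exp_add]
      have b1 : (2 : ℝ) ≤ Real.exp 1 := by
        have := Real.add_one_le_exp (1 : ℝ)
        linarith
      have b2 : Real.exp 42 = Real.exp 1 ^ 42 := by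
        rw [← Real.exp_nat_mul]; norm_num
      have b3 : Real.exp (4 * Real.log q) = (q : ℝ) ^ 4 := by
        rw [show (4 : ℝ) * Real.log q = ((4 : ℕ) : ℝ) * Real.log q by norm_num, Real.exp_nat_mul,
          Real.exp_log (by linarith)]
      rw [b2, b3]
      gcongr
    calc (3 / 4 : ℝ) ^ M ≤ Real.exp (-(1 / 4)) ^ M := pow_le_pow_left₀ (by norm_num) a1 M
      _ = Real.exp (-(M / 4)) := by rw [← Real.exp_nat_mul]; ring_nf
      _ ≤ Real.exp (-(42 + 4 * Real.log q)) := Real.exp_le_exp.2 (by linarith)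
      _ = (Real.exp (42 + 4 * Real.log q))⁻¹ := Real.exp_neg _
      _ ≤ _ := inv_anti₀ (by positivity) a2
  have key := h.le_norm_residue hd hGd hGF (by norm_num : (0 : ℝ) < 1 / 256) hF hB hMpos (by
    calc 16 * (142 * (q : ℝ)) ^ 4 * (3 / 4) ^ M
        ≤ 16 * (142 * (q : ℝ)) ^ 4 * ((2 : ℝ) ^ 42 * q ^ 4)⁻¹ := by gcongr
      _ = 16 * 142 ^ 4 / 2 ^ 42 := by
          field_simp
      _ ≤ 1 / 256 / 2 := by norm_num) hβ hβ1 hG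
  refine le_trans ?_ key
  have e1 : (q : ℝ) ^ (-(16 * (1 - β))) = Real.exp (-(16 * Real.log q * (1 - β))) := by
    rw [Real.rpow_def_of_pos (by linarith)]
    ring_nf
  have e2 : Real.exp (-22) * (q : ℝ) ^ (-(16 * (1 - β))) ≤ Real.exp (-(M * (1 - β))) := by
    rw [e1, ← Real.exp_add]
    refine Real.exp_le_exp.2 ?_
    nlinarith
  have : 0 ≤ (1 - β) / 512 := by linarith
  nlinarith

lemma Lreg_ne_zero_of_le_norm {χ : DirichletCharacter ℂ q} {θ l : ℝ} (hθ : 0 < θ) (hθ1 : θ ≤ 1)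
    (hl : 0 < l) (h : l ≤ ‖Lreg χ 1‖) {s : ℂ}
    (hs : ‖s - 1‖ ≤ l * θ ^ 2 / (100 * (q : ℝ) ^ θ)) : Lreg χ s ≠ 0 := by
  have hq : (1 : ℝ) ≤ q := by exact_mod_cast Nat.one_le_iff_ne_zero.2 (NeZero.ne q)
  have hqθ : 1 ≤ (q : ℝ) ^ θ := Real.one_le_rpow hq hθ.le
  have hb : ∀ z : ℂ, ‖z - 1‖ ≤ θ / 2 → ‖Lreg χ z‖ ≤ 20 * (q : ℝ) ^ θ / θ := fun z hz =>
    norm_Lreg_le_near_one χ hθ hθ1 hz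
  have h1 := hb 1 (by simpa using by linarith)
  have hl' := h.trans h1
  rw [le_div_iff₀ hθ] at hl'
  have hsθ : ‖s - 1‖ < θ / 2 := by
    refine lt_of_le_of_lt hs ?_
    rw [div_lt_iff₀ (by positivity)]
    nlinarith
  have hd : dist (Lreg χ s) (Lreg χ 1) ≤ (40 * (q : ℝ) ^ θ / θ) / (θ / 2) * dist s 1 := by
    refine Complex.dist_le_div_mul_dist_of_mapsTo_ball (differentiable_Lreg χ).differentiableOn
      (fun z hz => ?_) (by rwa [Metric.mem_ball, dist_eq_norm])
    rw [Metric.mem_ball, dist_eq_norm] at hz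
    rw [Metric.mem_closedBall, dist_eq_norm]
    refine (norm_sub_le _ _).trans ((add_le_add (hb z hz.le) h1).trans (le_of_eq ?_))
    ring
  intro h0
  rw [h0, dist_eq_norm, zero_sub, norm_neg, dist_eq_norm] at hd
  have : (40 * (q : ℝ) ^ θ / θ) / (θ / 2) * ‖s - 1‖ ≤ 4 / 5 * l := by
    calc _ ≤ (40 * (q : ℝ) ^ θ / θ) / (θ / 2) * (l * θ ^ 2 / (100 * (q : ℝ) ^ θ)) := by gcongr
      _ = 4 / 5 * l := by field_simp; norm_num
  linarith

end SiegelTheorem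

section SiegelZeroFree

set_option linter.unusedSectionVars false

open DirichletCharacter

lemma exists_real_character :
    ∃ χ : DirichletCharacter ℂ 4, χ ^ 2 = 1 ∧ χ ≠ 1 := by
  refine ⟨ZMod.χ₄.ringHomComp (Int.castRingHom ℂ), ?_, fun h => ?_⟩
  · exact MulChar.isQuadratic_iff_sq_eq_one.1 (ZMod.isQuadratic_χ₄.comp _)
  · have h3 := congrArg (fun χ : DirichletCharacter ℂ 4 => χ 3) h
    have hu : IsUnit (3 : ZMod 4) := by decide
    have e1 : ZMod.χ₄ 3 = -1 := by decide
    simp only [MulChar.ringHomComp_apply, MulChar.one_apply hu, e1] at h3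
    norm_num at h3

lemma re_Lreg_nonneg {q : ℕ} [NeZero q] {χ : DirichletCharacter ℂ q} (hχ : χ ^ 2 = 1) {β : ℝ}
    (hβ : 0 < β) (hβ2 : β ≤ 2) (h : ∀ x : ℝ, β ≤ x → x < 1 → Lreg χ x ≠ 0) :
    0 ≤ (Lreg χ β).re := by
  by_contra! hneg
  have hc : ContinuousOn (fun x : ℝ => (Lreg χ x).re) (Set.Icc β 2) :=
    (Complex.continuous_re.comp ((differentiable_Lreg χ).continuous.comp
      Complex.continuous_ofReal)).continuousOn
  have h2 : 0 ≤ (Lreg χ (2 : ℝ)).re := by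
    have e1 : Lreg χ 2 = LFunction χ 2 := by
      rw [Lreg_eq χ (by norm_num)]
      split_ifs <;> norm_num
    push_cast
    rw [e1]
    linarith [re_LFunction_two χ]
  obtain ⟨x, hx, hx0⟩ := intermediate_value_Icc hβ2 hc ⟨hneg.le, h2⟩
  have hz : Lreg χ x = 0 := Complex.ext hx0 (Lreg_ofReal_im hχ (hβ.trans_le hx.1))
  rcases lt_or_ge x 1 with h1 | h1
  · exact h x hx.1 h1 hz
  · exact Lreg_ne_zero_of_one_le_re χ (by simpa using h1) hz

lemma exists_auxiliary_character {δ : ℝ} (hδ : 0 < δ) : ∃ (q₁ : ℕ) (_ : NeZero q₁)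
    (χ₁ : DirichletCharacter ℂ q₁) (β : ℝ), χ₁ ^ 2 = 1 ∧ χ₁ ≠ 1 ∧ 1 - δ ≤ β ∧ 7 / 8 ≤ β ∧ β < 1 ∧
      ∀ (m : ℕ) [NeZero m] (hm : q₁ ∣ m) (ψ : DirichletCharacter ℂ m), ψ ^ 2 = 1 → ψ ≠ 1 →
        changeLevel hm χ₁ * ψ ≠ 1 → 0 ≤ (Lreg₄ (changeLevel hm χ₁) ψ β).re := by
  obtain ⟨r, hr, hr1⟩ := exists_Lreg_one_ne_zero
  obtain ⟨δ₁, hδ₁⟩ : ∃ δ₁, δ₁ = min δ (min r (1 / 8)) := ⟨_, rfl⟩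
  have hδp : 0 < δ₁ := by rw [hδ₁]; positivity
  have hδa : δ₁ ≤ δ := by rw [hδ₁]; exact min_le_left _ _
  have hδb : δ₁ ≤ r := by rw [hδ₁]; exact (min_le_right _ _).trans (min_le_left _ _)
  have hδc : δ₁ ≤ 1 / 8 := by rw [hδ₁]; exact (min_le_right _ _).trans (min_le_right _ _)
  by_cases hex : ∃ (q₁ : ℕ) (_ : NeZero q₁) (χ₁ : DirichletCharacter ℂ q₁) (β : ℝ),
      χ₁ ^ 2 = 1 ∧ χ₁ ≠ 1 ∧ 1 - δ₁ ≤ β ∧ β < 1 ∧ Lreg χ₁ β = 0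
  · obtain ⟨q₁, i₁, χ₁, β, h1, h2, h3, h4, h5⟩ := hex
    refine ⟨q₁, i₁, χ₁, β, h1, h2, by linarith, by linarith, h4, fun m _ hm ψ _ _ _ => ?_⟩
    have hb : (β : ℂ) ≠ 1 := by exact_mod_cast h4.ne
    have : Lreg (changeLevel hm χ₁) β = 0 :=
      (Lreg_changeLevel_eq_zero_iff hm χ₁ (by rw [Complex.ofReal_re]; linarith) hb).2 h5
    simp [Lreg₄, this]
  · obtain ⟨χ₁, h1, h2⟩ := exists_real_character
    refine ⟨4, inferInstance, χ₁, 1 - δ₁, h1, h2, by linarith, by linarith, by linarith,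
      fun m _ hm ψ hψ hψ1 hψ2 => ?_⟩
    have hns : ∀ χ : DirichletCharacter ℂ m, χ ^ 2 = 1 →
        ∃ t : ℝ, 0 ≤ t ∧ Lreg χ ((1 - δ₁ : ℝ) : ℂ) = t := by
      intro χ hχ
      refine ⟨(Lreg χ ((1 - δ₁ : ℝ) : ℂ)).re, re_Lreg_nonneg hχ (by linarith) (by linarith)
        fun x hx hx1 h0 => ?_, Complex.ext (by simp) ?_⟩
      · by_cases hχ1 : χ = 1
        · subst hχ1
          refine hr1 m x ?_ h0
          rw [show (x : ℂ) - 1 = ((x - 1 : ℝ) : ℂ) by push_cast; ring, Complex.norm_real,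
            Real.norm_eq_abs, abs_of_neg (by linarith)]
          linarith
        · exact hex ⟨m, inferInstance, χ, x, hχ, hχ1, hx, hx1, h0⟩
      · rw [Lreg_ofReal_im hχ (by linarith)]
        simp
    have hl : (changeLevel hm χ₁) ^ 2 = 1 := by rw [← map_pow, h1, map_one]
    obtain ⟨t₀, p₀, e₀⟩ := hns 1 (one_pow 2)
    obtain ⟨t₁, p₁, e₁⟩ := hns _ hl
    obtain ⟨t₂, p₂, e₂⟩ := hns _ hψ
    obtain ⟨t₃, p₃, e₃⟩ := hns (changeLevel hm χ₁ * ψ) (by rw [mul_pow, hl, hψ, one_mul])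
    simp only [Lreg₄]
    rw [e₀, e₁, e₂, e₃]
    have : (0 : ℝ) ≤ t₀ * t₁ * (t₂ * t₃) := by positivity
    exact_mod_cast this

/-- Siegel's theorem: real characters have no zeros in a disk of radius `≫ q ^ (-δ)` at `1`. -/
theorem siegel_zeroFree_disk {δ : ℝ} (hδ : 0 < δ) : ∃ c > 0, ∀ (q : ℕ) [NeZero q]
    (χ : DirichletCharacter ℂ q), χ ^ 2 = 1 → ∀ s : ℂ, ‖s - 1‖ ≤ c * (q : ℝ) ^ (-δ) →
      Lreg χ s ≠ 0 := by
  obtain ⟨r, hr, hr1⟩ := exists_Lreg_one_ne_zero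
  obtain ⟨q₁, i₁, χ₁, β, h1, h2, h3, h4, h5, h6⟩ :=
    exists_auxiliary_character (δ := δ / 32) (by linarith)
  have hq₁ : (1 : ℝ) ≤ q₁ := by exact_mod_cast Nat.one_le_iff_ne_zero.2 (NeZero.ne q₁)
  obtain ⟨r₁, hr₁, hr₁'⟩ : ∃ r₁ > 0, ∀ s : ℂ, ‖s - 1‖ ≤ r₁ → Lreg χ₁ s ≠ 0 := by
    have h0 := Lreg_ne_zero_of_one_le_re χ₁ (s := 1) (by simp)
    have hc := (differentiable_Lreg χ₁).continuous.continuousAt (x := 1)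
    obtain ⟨r, hr, h⟩ := Metric.eventually_nhds_iff.1 (hc.eventually_ne h0)
    refine ⟨r / 2, by positivity, fun s hs => h ?_⟩
    rw [dist_eq_norm]
    linarith
  obtain ⟨θ, hθ⟩ : ∃ θ, θ = min (δ / 8) 1 := ⟨_, rfl⟩
  have hθp : 0 < θ := by rw [hθ]; positivity
  have hθ1 : θ ≤ 1 := by rw [hθ]; exact min_le_right _ _
  have hθδ : θ ≤ δ / 8 := by rw [hθ]; exact min_le_left _ _
  obtain ⟨K, hK⟩ : ∃ K, K = Real.exp (-22) / 512 * (1 - β) := ⟨_, rfl⟩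
  have hKp : 0 < K := by
    rw [hK]
    have : 0 < 1 - β := by linarith
    positivity
  obtain ⟨c₀, hc₀⟩ : ∃ c₀, c₀ = K * (θ / 20) ^ 3 * θ ^ 2 / 100 * (q₁ : ℝ) ^ (-δ) := ⟨_, rfl⟩
  have hc₀p : 0 < c₀ := by rw [hc₀]; positivity
  refine ⟨min (min r (1 / 2)) (min r₁ c₀), by positivity, fun q _ χ hχ s hs => ?_⟩
  have hq : (1 : ℝ) ≤ q := by exact_mod_cast Nat.one_le_iff_ne_zero.2 (NeZero.ne q)
  have hqδ : (q : ℝ) ^ (-δ) ≤ 1 := Real.rpow_le_one_of_one_le_of_nonpos hq (by linarith)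
  have hqδ0 : 0 < (q : ℝ) ^ (-δ) := by positivity
  have hs' : ‖s - 1‖ ≤ min (min r (1 / 2)) (min r₁ c₀) :=
    hs.trans (mul_le_of_le_one_right (by positivity) hqδ)
  have hsr : ‖s - 1‖ ≤ r := hs'.trans ((min_le_left _ _).trans (min_le_left _ _))
  have hs2 : ‖s - 1‖ ≤ 1 / 2 := hs'.trans ((min_le_left _ _).trans (min_le_right _ _))
  have hs3 : ‖s - 1‖ ≤ r₁ := hs'.trans ((min_le_right _ _).trans (min_le_left _ _))
  have hs4 : ‖s - 1‖ ≤ c₀ * (q : ℝ) ^ (-δ) :=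
    hs.trans (mul_le_mul_of_nonneg_right ((min_le_right _ _).trans (min_le_right _ _)) hqδ0.le)
  have hre : 0 < s.re := by
    have := (abs_le.1 ((Complex.abs_re_le_norm _).trans hs2)).1
    simp at this
    linarith
  by_cases hs1 : s = 1
  · exact Lreg_ne_zero_of_one_le_re χ (by simp [hs1])
  by_cases hχ1 : χ = 1
  · subst hχ1
    exact hr1 q s hsr
  have hd₁ : q₁ ∣ q₁ * q := dvd_mul_right _ _
  have hd : q ∣ q₁ * q := dvd_mul_left _ _
  obtain ⟨ψ₁, hψ₁⟩ : ∃ ψ₁, ψ₁ = changeLevel hd₁ χ₁ := ⟨_, rfl⟩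
  obtain ⟨ψ, hψ⟩ : ∃ ψ, ψ = changeLevel hd χ := ⟨_, rfl⟩
  have hψ₁2 : ψ₁ ^ 2 = 1 := by rw [hψ₁, ← map_pow, h1, map_one]
  have hψ2 : ψ ^ 2 = 1 := by rw [hψ, ← map_pow, hχ, map_one]
  have hψ₁1 : ψ₁ ≠ 1 := by rwa [hψ₁, Ne, changeLevel_eq_one_iff]
  have hψ1 : ψ ≠ 1 := by rwa [hψ, Ne, changeLevel_eq_one_iff]
  rw [Ne, ← Lreg_changeLevel_eq_zero_iff hd χ hre hs1, ← hψ]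
  by_cases hmul : ψ₁ * ψ = 1
  · have : ψ = ψ₁ := by
      calc ψ = ψ₁ ^ 2 * ψ := by rw [hψ₁2, one_mul]
        _ = ψ₁ * (ψ₁ * ψ) := by rw [pow_two, mul_assoc]
        _ = ψ₁ := by rw [hmul, mul_one]
    rw [this, hψ₁, Lreg_changeLevel_eq_zero_iff hd₁ χ₁ hre hs1]
    exact hr₁' s hs3
  have hG : 0 ≤ (Lreg₄ ψ₁ ψ β).re := by
    rw [hψ₁]
    exact h6 _ hd₁ ψ hψ2 hψ1 (by rwa [← hψ₁])
  have key := le_norm_Lreg₄ hψ₁2 hψ2 hψ₁1 hψ1 hmul h4 h5 hG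
  rw [← hK] at key
  have hub : ∀ χ : DirichletCharacter ℂ (q₁ * q),
      ‖Lreg χ 1‖ ≤ 20 * ((q₁ * q : ℕ) : ℝ) ^ θ / θ := fun χ =>
    norm_Lreg_le_near_one χ hθp hθ1 (by rw [sub_self, norm_zero]; linarith)
  obtain ⟨m, hm⟩ : ∃ m : ℝ, m = ((q₁ * q : ℕ) : ℝ) := ⟨_, rfl⟩
  have hm1 : 1 ≤ m := by
    rw [hm]; push_cast; nlinarith
  have hm0 : 0 < m := by linarith
  rw [← hm] at key
  simp only [← hm] at hub
  have hl : K * (θ / 20) ^ 3 * m ^ (-(16 * (1 - β)) - 3 * θ) ≤ ‖Lreg ψ 1‖ := by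
    have a1 : ‖Lreg₄ ψ₁ ψ 1‖ ≤ (20 * m ^ θ / θ) ^ 3 * ‖Lreg ψ 1‖ := by
      simp only [Lreg₄]
      rw [norm_mul, norm_mul, norm_mul]
      calc _ ≤ (20 * m ^ θ / θ) * (20 * m ^ θ / θ) * (‖Lreg ψ 1‖ * (20 * m ^ θ / θ)) := by
            gcongr <;> exact hub _
        _ = _ := by ring
    have a2 := key.trans a1
    have a3 : m ^ (-(16 * (1 - β)) - 3 * θ) = m ^ (-(16 * (1 - β))) / (m ^ θ) ^ 3 := by
      rw [Real.rpow_sub hm0, ← Real.rpow_natCast, ← Real.rpow_mul hm0.le]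
      congr 2
      push_cast
      ring
    rw [a3]
    have hmθ : 0 < m ^ θ := by positivity
    calc K * (θ / 20) ^ 3 * (m ^ (-(16 * (1 - β))) / (m ^ θ) ^ 3)
        = K * m ^ (-(16 * (1 - β))) / (20 * m ^ θ / θ) ^ 3 := by
          field_simp
      _ ≤ _ := by
          rw [div_le_iff₀ (by positivity)]
          linarith
  refine Lreg_ne_zero_of_le_norm hθp hθ1 (by positivity) hl (hs4.trans ?_)
  rw [← hm]
  have a4 : c₀ * (q : ℝ) ^ (-δ) = K * (θ / 20) ^ 3 * θ ^ 2 / 100 * m ^ (-δ) := by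
    rw [hc₀, hm, Nat.cast_mul, Real.mul_rpow (by linarith) (by linarith)]
    ring
  have a5 : m ^ (-δ) ≤ m ^ (-(16 * (1 - β)) - 3 * θ) / m ^ θ := by
    rw [← Real.rpow_sub hm0]
    refine Real.rpow_le_rpow_of_exponent_le hm1 ?_
    linarith
  rw [a4]
  calc K * (θ / 20) ^ 3 * θ ^ 2 / 100 * m ^ (-δ)
      ≤ K * (θ / 20) ^ 3 * θ ^ 2 / 100 * (m ^ (-(16 * (1 - β)) - 3 * θ) / m ^ θ) := by
        gcongr
    _ = _ := by
        field_simp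

end SiegelZeroFree

section Perron

open MeasureTheory

/-- The tent function `u ↦ max (1 - u) 0`. -/
noncomputable def tent (u : ℝ) : ℂ := ((max (1 - u) 0 : ℝ) : ℂ)

lemma tent_eq_indicator {u : ℝ} (hu : 0 < u) :
    tent u = Set.indicator (Set.Ioc 0 1) (fun _ => (1 : ℂ)) u -
      Set.indicator (Set.Ioc 0 1) (fun t : ℝ => (t : ℂ) ^ (1 : ℂ)) u := by
  by_cases h : u ≤ 1
  · have hm : u ∈ Set.Ioc (0 : ℝ) 1 := ⟨hu, h⟩
    rw [Set.indicator_of_mem hm, Set.indicator_of_mem hm, tent,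
      max_eq_left (by linarith)]
    simp
  · have hm : u ∉ Set.Ioc (0 : ℝ) 1 := fun h' => h h'.2
    rw [Set.indicator_of_notMem hm, Set.indicator_of_notMem hm, tent, max_eq_right (by linarith)]
    simp

lemma hasMellin_tent {s : ℂ} (hs : 0 < s.re) : HasMellin tent s (1 / (s * (s + 1))) := by
  have h := hasMellin_sub (hasMellin_one_Ioc hs).1
    (hasMellin_cpow_Ioc 1 (s := s) (by simp; linarith)).1
  rw [(hasMellin_one_Ioc hs).2, (hasMellin_cpow_Ioc 1 (s := s) (by simp; linarith)).2] at h
  have e : ∀ u ∈ Set.Ioi (0 : ℝ), (u : ℂ) ^ (s - 1) • tent u = (u : ℂ) ^ (s - 1) •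
      (Set.indicator (Set.Ioc 0 1) (fun _ => (1 : ℂ)) u -
      Set.indicator (Set.Ioc 0 1) (fun t : ℝ => (t : ℂ) ^ (1 : ℂ)) u) := fun u hu => by
    rw [tent_eq_indicator hu]
  have hs0 : s ≠ 0 := by rintro rfl; simp at hs
  have hs1 : s + 1 ≠ 0 := by
    intro h0
    have := congrArg Complex.re h0
    simp at this
    linarith
  refine ⟨(integrableOn_congr_fun e measurableSet_Ioi).2 h.1, ?_⟩
  rw [mellin, setIntegral_congr_fun measurableSet_Ioi e]
  refine h.2.trans ?_
  field_simp
  ring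

lemma norm_one_div_mul_add_one_le {σ : ℝ} (hσ : 1 ≤ σ) (t : ℝ) :
    ‖1 / (((σ : ℂ) + t * Complex.I) * ((σ : ℂ) + t * Complex.I + 1))‖ ≤ (1 + t ^ 2)⁻¹ := by
  rw [norm_div, norm_one, norm_mul, one_div]
  refine inv_anti₀ (by positivity) ?_
  have h1 : ‖(σ : ℂ) + t * Complex.I‖ ^ 2 = σ ^ 2 + t ^ 2 := by
    rw [← Complex.normSq_eq_norm_sq, Complex.normSq_add_mul_I]
  have h2 : ‖(σ : ℂ) + t * Complex.I + 1‖ ^ 2 = (σ + 1) ^ 2 + t ^ 2 := by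
    rw [← Complex.normSq_eq_norm_sq, ← Complex.normSq_add_mul_I]
    push_cast
    ring_nf
  have h3 : ‖(σ : ℂ) + t * Complex.I‖ ≤ ‖(σ : ℂ) + t * Complex.I + 1‖ := by
    refine le_of_sq_le_sq ?_ (norm_nonneg _)
    rw [h1, h2]; nlinarith
  nlinarith [norm_nonneg ((σ : ℂ) + t * Complex.I)]

lemma integrable_one_div_mul_add_one {σ : ℝ} (hσ : 1 ≤ σ) :
    Integrable fun t : ℝ =>
      1 / (((σ : ℂ) + t * Complex.I) * ((σ : ℂ) + t * Complex.I + 1)) := by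
  refine integrable_inv_one_add_sq.mono' ?_ (Filter.Eventually.of_forall fun t =>
    norm_one_div_mul_add_one_le hσ t)
  exact Measurable.aestronglyMeasurable (by fun_prop)

lemma integral_cpow_div_eq_tent {σ : ℝ} (hσ : 1 ≤ σ) {u : ℝ} (hu : 0 < u) :
    ∫ t : ℝ, (u : ℂ) ^ (-((σ : ℂ) + t * Complex.I)) *
      (1 / (((σ : ℂ) + t * Complex.I) * ((σ : ℂ) + t * Complex.I + 1))) =
      2 * Real.pi * tent u := by
  have hm : ∀ t : ℝ, mellin tent ((σ : ℂ) + t * Complex.I) =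
      1 / (((σ : ℂ) + t * Complex.I) * ((σ : ℂ) + t * Complex.I + 1)) := fun t =>
    (hasMellin_tent (by simp; linarith)).2
  have h := mellinInv_mellin_eq σ tent hu (hasMellin_tent (by simp; linarith)).1
    (by
      have := integrable_one_div_mul_add_one hσ
      simp only [Complex.VerticalIntegrable]
      simpa only [hm] using this)
    (by
      have : Continuous tent := by unfold tent; fun_prop
      exact this.continuousAt)
  rw [mellinInv] at h
  simp only [hm, smul_eq_mul] at h
  rw [← h, Complex.real_smul, ← mul_assoc]
  have := Complex.ofReal_ne_zero.2 Real.pi_pos.ne'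
  push_cast
  rw [mul_one_div_cancel (mul_ne_zero two_ne_zero this), one_mul]

lemma integral_compl_Ioc_inv_one_add_sq_le {T : ℝ} (hT : 0 < T) :
    ∫ t in (Set.Ioc (-T) T)ᶜ, (1 + t ^ 2)⁻¹ ≤ 2 / T := by
  have h0 := integrable_inv_one_add_sq
  rw [Set.compl_Ioc, setIntegral_union (Set.Iic_disjoint_Ioi (by linarith)) measurableSet_Ioi
    h0.integrableOn h0.integrableOn, integral_Iic_inv_one_add_sq, integral_Ioi_inv_one_add_sq,
    Real.arctan_neg]
  have h1 := Real.arctan_inv_of_pos hT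
  have h2 : Real.arctan T⁻¹ ≤ T⁻¹ := by
    by_contra! hlt
    have h3 := Real.lt_tan (inv_pos.2 hT |>.trans hlt) (Real.arctan_lt_pi_div_two _)
    rw [Real.tan_arctan] at h3
    linarith
  rw [show 2 / T = T⁻¹ + T⁻¹ by ring]
  linarith

/-- The Perron integrand `D s * x ^ s / (s (s + 1))`. -/
noncomputable def perronKernel (D : ℂ → ℂ) (x : ℝ) (s : ℂ) : ℂ :=
  D s * (x : ℂ) ^ s * (1 / (s * (s + 1)))

lemma norm_perronKernel_le {D : ℂ → ℂ} {x σ W : ℝ} (hx : 0 < x) (hσ : 1 ≤ σ)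
    (hD : ∀ t : ℝ, ‖D ((σ : ℂ) + t * Complex.I)‖ ≤ W) (t : ℝ) :
    ‖perronKernel D x ((σ : ℂ) + t * Complex.I)‖ ≤ W * x ^ σ * (1 + t ^ 2)⁻¹ := by
  rw [perronKernel, norm_mul, norm_mul, Complex.norm_cpow_eq_rpow_re_of_pos hx]
  have hW := (norm_nonneg _).trans (hD t)
  have e1 : ((σ : ℂ) + t * Complex.I).re = σ := by simp
  rw [e1]
  gcongr
  · exact hD t
  · exact norm_one_div_mul_add_one_le hσ t

lemma integral_perronKernel {d : ℕ → ℂ} {x σ : ℝ} (hx : 0 < x) (hσ : 1 ≤ σ)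
    (hd : LSeriesSummable d σ) :
    Integrable (fun t : ℝ => perronKernel (LSeries d) x ((σ : ℂ) + t * Complex.I)) ∧
    ∫ t : ℝ, perronKernel (LSeries d) x ((σ : ℂ) + t * Complex.I) =
      2 * Real.pi * ∑ n ∈ Finset.Icc 1 ⌊x⌋₊, d n * (1 - n / x) := by
  have hnt : ∀ (n : ℕ) (t : ℝ), ‖LSeries.term d ((σ : ℂ) + t * Complex.I) n‖ =
      ‖LSeries.term d σ n‖ := by
    intro n t
    rw [LSeries.norm_term_eq, LSeries.norm_term_eq]
    simp
  set F : ℕ → ℝ → ℂ := fun n t => perronKernel (fun s => LSeries.term d s n) x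
    ((σ : ℂ) + t * Complex.I) with hF
  have hmeas : ∀ n, AEStronglyMeasurable (F n) := by
    intro n
    refine Measurable.aestronglyMeasurable ?_
    simp only [hF, perronKernel]
    refine Measurable.mul (Measurable.mul ?_ (by fun_prop)) (by fun_prop)
    rcases eq_or_ne n 0 with rfl | hn
    · simp
    · simp only [LSeries.term_of_ne_zero hn]
      fun_prop
  have hFn : ∀ n t, ‖F n t‖ ≤ ‖LSeries.term d σ n‖ * x ^ σ * (1 + t ^ 2)⁻¹ := fun n t =>
    norm_perronKernel_le hx hσ (fun t => (hnt n t).le) t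
  have hInt : ∀ n, Integrable (F n) := fun n =>
    (integrable_inv_one_add_sq.const_mul _).mono' (hmeas n) (Filter.Eventually.of_forall (hFn n))
  have hFI : ∀ n, ∫ t, ‖F n t‖ ≤ ‖LSeries.term d σ n‖ * (x ^ σ * Real.pi) := by
    intro n
    refine (integral_mono (hInt n).norm (integrable_inv_one_add_sq.const_mul _) (hFn n)).trans
      (le_of_eq ?_)
    rw [integral_const_mul, integral_univ_inv_one_add_sq]
    ring
  have hsum : Summable fun n => ∫ t, ‖F n t‖ :=
    Summable.of_nonneg_of_le (fun n => integral_nonneg fun t => norm_nonneg _) hFI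
      (hd.norm.mul_right _)
  have hterm : ∀ n : ℕ, ∫ t, F n t = if n ∈ Finset.Icc 1 ⌊x⌋₊ then
      2 * Real.pi * (d n * (1 - n / x)) else 0 := by
    intro n
    rcases eq_or_ne n 0 with rfl | hn
    · simp [hF, perronKernel]
    have hn0 : (0 : ℝ) < n := by exact_mod_cast Nat.pos_of_ne_zero hn
    have e1 : ∀ t, F n t = d n * (((n / x : ℝ) : ℂ) ^ (-((σ : ℂ) + t * Complex.I)) *
      (1 / (((σ : ℂ) + t * Complex.I) * ((σ : ℂ) + t * Complex.I + 1)))) := by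
      intro t
      simp only [hF, perronKernel]
      rw [LSeries.term_of_ne_zero hn, div_eq_mul_inv (n : ℝ), Complex.ofReal_mul,
        Complex.mul_cpow_ofReal_nonneg hn0.le (by positivity), Complex.ofReal_inv,
        Complex.inv_cpow, ← Complex.cpow_neg, neg_neg, Complex.cpow_neg, Complex.ofReal_natCast]
      · ring
      · rw [Complex.arg_ofReal_of_nonneg hx.le]
        exact Real.pi_pos.ne
    simp only [e1]
    rw [integral_const_mul, integral_cpow_div_eq_tent hσ (by positivity)]
    split_ifs with h
    · have : (n : ℝ) / x ≤ 1 := by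
        rw [div_le_one hx]
        exact (Nat.le_floor_iff hx.le).1 (Finset.mem_Icc.1 h).2
      rw [tent, max_eq_left (by linarith)]
      push_cast
      ring
    · have : 1 ≤ (n : ℝ) / x := by
        rw [one_le_div hx]
        by_contra! hlt
        exact h (Finset.mem_Icc.2 ⟨Nat.pos_of_ne_zero hn, Nat.le_floor hlt.le⟩)
      rw [tent, max_eq_right (by linarith)]
      simp
  have htsum : ∀ t : ℝ, perronKernel (LSeries d) x ((σ : ℂ) + t * Complex.I) = ∑' n, F n t := by
    intro t
    simp only [hF, perronKernel, LSeries, tsum_mul_right]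
  have key := hasSum_integral_of_summable_integral_norm hInt hsum
  refine ⟨?_, ?_⟩
  · have hm : AEStronglyMeasurable (fun t : ℝ => perronKernel (LSeries d) x
        ((σ : ℂ) + t * Complex.I)) := by
      refine aestronglyMeasurable_of_tendsto_ae (u := Filter.atTop)
        (f := fun N t => ∑ n ∈ Finset.range N, F n t)
        (fun N => Finset.aestronglyMeasurable_fun_sum _ fun n _ => hmeas n)
        (Filter.Eventually.of_forall fun t => ?_)
      simp only [htsum]
      refine (Summable.hasSum (Summable.of_norm_bounded (g := fun n => ‖LSeries.term d σ n‖ *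
        (x ^ σ * (1 + t ^ 2)⁻¹)) (hd.norm.mul_right _) fun n => ?_)).tendsto_sum_nat
      rw [← mul_assoc]
      exact hFn n t
    refine (integrable_inv_one_add_sq.const_mul ((∑' n, ‖LSeries.term d σ n‖) * x ^ σ)).mono' hm
      (Filter.Eventually.of_forall (norm_perronKernel_le hx hσ fun t => ?_))
    refine (norm_tsum_le_tsum_norm ?_).trans (le_of_eq ?_)
    · simpa only [hnt] using hd.norm
    · simp only [hnt]
  · simp only [htsum]
    rw [← key.tsum_eq]
    simp only [hterm]
    rw [tsum_eq_sum (s := Finset.Icc 1 ⌊x⌋₊) fun n hn => if_neg hn, Finset.mul_sum]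
    exact Finset.sum_congr rfl fun n hn => if_pos hn

end Perron

section ContourShift

open MeasureTheory

lemma norm_perronKernel_le_div {D : ℂ → ℂ} {x K : ℝ} (hx : 0 < x) {s : ℂ} (hs : 1 / 2 ≤ s.re)
    (hD : ‖D s‖ ≤ K * (1 + ‖s‖)) :
    ‖perronKernel D x s‖ ≤ K * x ^ s.re * (3 / ‖s‖) := by
  have h1 : ‖s‖ ≤ ‖s + 1‖ := by
    refine le_of_sq_le_sq ?_ (norm_nonneg _)
    rw [← Complex.normSq_eq_norm_sq, ← Complex.normSq_eq_norm_sq, Complex.normSq_apply,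
      Complex.normSq_apply]
    simp
    nlinarith
  have h2 : 1 / 2 ≤ ‖s‖ := hs.trans (Complex.re_le_norm s)
  have hK : 0 ≤ K := by
    have := (norm_nonneg _).trans hD
    by_contra! h
    nlinarith
  rw [perronKernel, norm_mul, norm_mul, Complex.norm_cpow_eq_rpow_re_of_pos hx, norm_div, norm_one,
    norm_mul]
  calc ‖D s‖ * x ^ s.re * (1 / (‖s‖ * ‖s + 1‖))
      ≤ K * (1 + ‖s‖) * x ^ s.re * (1 / (‖s‖ * ‖s‖)) := by gcongr
    _ = K * x ^ s.re * ((1 + ‖s‖) / ‖s‖ / ‖s‖) := by field_simp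
    _ ≤ K * x ^ s.re * (3 / ‖s‖) := by
        gcongr
        rw [div_le_iff₀ (by linarith)]
        linarith

lemma norm_setIntegral_compl_perronKernel_le {D : ℂ → ℂ} {x σ W T : ℝ} (hx : 0 < x)
    (hσ : 1 ≤ σ) (hT : 0 < T)
    (hD : ∀ t : ℝ, ‖D ((σ : ℂ) + t * Complex.I)‖ ≤ W) :
    ‖∫ t in (Set.Ioc (-T) T)ᶜ, perronKernel D x ((σ : ℂ) + t * Complex.I)‖ ≤
      W * x ^ σ * (2 / T) := by
  have hW := (norm_nonneg _).trans (hD 0)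
  refine (norm_integral_le_of_norm_le
    (integrable_inv_one_add_sq.const_mul (W * x ^ σ)).integrableOn
    (Filter.Eventually.of_forall (norm_perronKernel_le hx hσ hD))).trans ?_
  rw [integral_const_mul]
  exact mul_le_mul_of_nonneg_left (integral_compl_Ioc_inv_one_add_sq_le hT) (by positivity)

/-- Truncated Perron formula with a kernel of order two, after shifting the contour. -/
lemma norm_sum_tent_le {d : ℕ → ℂ} {D : ℂ → ℂ} {K T σ₀ σ x W : ℝ} (hσ : 1 < σ) (hσ2 : σ ≤ 2)
    (hσ₀ : 1 / 2 ≤ σ₀) (hσ₀' : σ₀ ≤ 1) (hT : 1 ≤ T) (hx : 1 ≤ x) (hd : LSeriesSummable d σ)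
    (hW : ∑' n, ‖LSeries.term d σ n‖ ≤ W) (hdD : ∀ s : ℂ, 1 < s.re → LSeries d s = D s)
    (hDd : DifferentiableOn ℂ D (Set.uIcc σ₀ σ ×ℂ Set.uIcc (-T) T))
    (hDb : ∀ s : ℂ, σ₀ ≤ s.re → s.re ≤ σ → |s.im| ≤ T → ‖D s‖ ≤ K * (1 + ‖s‖)) :
    ‖∑ n ∈ Finset.Icc 1 ⌊x⌋₊, d n * (1 - n / x)‖ ≤
      (W + 2 * K) * x ^ σ / T + 2 * T * K * x ^ σ₀ := by
  have hx0 : 0 < x := by linarith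
  obtain ⟨hInt, hval⟩ := integral_perronKernel hx0 hσ.le hd
  have hLD : ∀ t : ℝ, LSeries d ((σ : ℂ) + t * Complex.I) = D ((σ : ℂ) + t * Complex.I) := fun t =>
    hdD _ (by simpa using hσ)
  have hk : ∀ t : ℝ, perronKernel (LSeries d) x ((σ : ℂ) + t * Complex.I) =
      perronKernel D x ((σ : ℂ) + t * Complex.I) := fun t => by
    simp only [perronKernel, hLD]
  have hDW : ∀ t : ℝ, ‖D ((σ : ℂ) + t * Complex.I)‖ ≤ W := by
    intro t
    have hnt : ∀ n, ‖LSeries.term d ((σ : ℂ) + t * Complex.I) n‖ = ‖LSeries.term d σ n‖ := by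
      intro n
      rw [LSeries.norm_term_eq, LSeries.norm_term_eq]
      simp
    rw [← hLD]
    refine (norm_tsum_le_tsum_norm ?_).trans (le_trans (le_of_eq ?_) hW)
    · simpa only [hnt] using hd.norm
    · simp only [hnt]
  simp only [hk] at hInt hval
  have hK : 0 ≤ K := by
    have := (norm_nonneg _).trans (hDb 1 (by simpa using hσ₀') (by simpa using hσ.le)
      (by simpa using by linarith))
    norm_num at this
    linarith
  have hre : ∀ (y : ℝ) (t : ℝ), ((y : ℂ) + t * Complex.I).re = y := by simp
  have him : ∀ (y : ℝ) (t : ℝ), ((y : ℂ) + t * Complex.I).im = t := by simp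
  have hrect := Complex.integral_boundary_rect_eq_zero_of_differentiableOn (perronKernel D x)
    (⟨σ₀, -T⟩ : ℂ) (⟨σ, T⟩ : ℂ) (by
      intro s hs
      have hs' := hs.1
      simp only [Set.mem_preimage] at hs'
      rw [Set.uIcc_of_le (by linarith)] at hs'
      have hsre : 0 < s.re := lt_of_lt_of_le (by linarith) hs'.1
      have hs0 : s ≠ 0 := by rintro rfl; simp at hsre
      have hs1 : s + 1 ≠ 0 := by
        intro h0
        have := congrArg Complex.re h0
        simp at this
        linarith
      have hxs : DifferentiableAt ℂ (fun s : ℂ => (x : ℂ) ^ s) s :=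
        differentiableAt_id.const_cpow (Or.inl (by exact_mod_cast hx0.ne'))
      have hinv : DifferentiableAt ℂ (fun s : ℂ => 1 / (s * (s + 1))) s :=
        (differentiableAt_const _).div (by fun_prop) (mul_ne_zero hs0 hs1)
      exact ((hDd s hs).mul hxs.differentiableWithinAt).mul hinv.differentiableWithinAt)
  simp only [smul_eq_mul] at hrect
  have hhor : ∀ τ : ℝ, |τ| = T →
      ‖∫ y in σ₀..σ, perronKernel D x (y + τ * Complex.I)‖ ≤ 5 * (K * x ^ σ / T) := by
    intro τ hτ
    have := intervalIntegral.norm_integral_le_of_norm_le_const (a := σ₀) (b := σ)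
      (f := fun y : ℝ => perronKernel D x (y + τ * Complex.I)) (C := K * x ^ σ * (3 / T))
      (fun y hy => by
        rw [Set.uIoc_of_le (by linarith)] at hy
        refine (norm_perronKernel_le_div hx0 (by rw [hre]; linarith [hy.1]) (hDb _
          (by rw [hre]; exact hy.1.le) (by rw [hre]; exact hy.2) (by rw [him, hτ]))).trans ?_
        rw [hre]
        have h1 : T ≤ ‖(y : ℂ) + τ * Complex.I‖ := by
          rw [← hτ]
          simpa using Complex.abs_im_le_norm ((y : ℂ) + τ * Complex.I)
        have : 0 < ‖(y : ℂ) + τ * Complex.I‖ := by linarith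
        gcongr
        exact hy.2)
    refine this.trans ?_
    rw [abs_of_nonneg (by linarith)]
    have h0 : 0 ≤ K * x ^ σ / T := by positivity
    calc K * x ^ σ * (3 / T) * (σ - σ₀) = K * x ^ σ / T * (3 * (σ - σ₀)) := by ring
      _ ≤ K * x ^ σ / T * 5 := by gcongr; linarith
      _ = _ := by ring
  have hleft : ‖∫ t in (-T)..T, perronKernel D x (σ₀ + t * Complex.I)‖ ≤
      12 * (T * K * x ^ σ₀) := by
    have := intervalIntegral.norm_integral_le_of_norm_le_const (a := -T) (b := T)
      (f := fun t : ℝ => perronKernel D x (σ₀ + t * Complex.I)) (C := K * x ^ σ₀ * 6)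
      (fun t ht => by
        rw [Set.uIoc_of_le (by linarith)] at ht
        refine (norm_perronKernel_le_div hx0 (by rw [hre]; linarith) (hDb _
          (by rw [hre]) (by rw [hre]; linarith) (by
            rw [him, abs_le]; exact ⟨ht.1.le, ht.2⟩))).trans ?_
        rw [hre]
        have h1 : 1 / 2 ≤ ‖(σ₀ : ℂ) + t * Complex.I‖ := by
          have := Complex.re_le_norm ((σ₀ : ℂ) + t * Complex.I)
          rw [hre] at this
          linarith
        have h2 : 3 / ‖(σ₀ : ℂ) + t * Complex.I‖ ≤ 6 := by
          rw [div_le_iff₀ (by linarith)]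
          linarith
        gcongr)
    refine this.trans (le_of_eq ?_)
    rw [abs_of_nonneg (by linarith)]
    ring
  have hmid : ‖∫ t in (-T)..T, perronKernel D x (σ + t * Complex.I)‖ ≤
      12 * (T * K * x ^ σ₀) + 10 * (K * x ^ σ / T) := by
    have e1 : ∫ t in (-T)..T, perronKernel D x (σ + t * Complex.I) =
        (∫ t in (-T)..T, perronKernel D x (σ₀ + t * Complex.I)) +
        Complex.I * ((∫ y in σ₀..σ, perronKernel D x (y + (-T : ℝ) * Complex.I)) -
          ∫ y in σ₀..σ, perronKernel D x (y + T * Complex.I)) := by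
      linear_combination (-Complex.I) * hrect +
        ((∫ t in (-T)..T, perronKernel D x (σ + t * Complex.I)) -
        ∫ t in (-T)..T, perronKernel D x (σ₀ + t * Complex.I)) * Complex.I_mul_I
    rw [e1]
    refine (norm_add_le _ _).trans ?_
    rw [norm_mul, Complex.norm_I, one_mul]
    have h1 := hhor (-T) (by rw [abs_neg, abs_of_nonneg (by linarith)])
    have h2 := hhor T (abs_of_nonneg (by linarith))
    linarith [norm_sub_le (∫ y in σ₀..σ, perronKernel D x (y + (-T : ℝ) * Complex.I))
      (∫ y in σ₀..σ, perronKernel D x (y + T * Complex.I))]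
  have htail := norm_setIntegral_compl_perronKernel_le hx0 hσ.le (by linarith : 0 < T) hDW
  have hsplit := integral_add_compl (measurableSet_Ioc (a := -T) (b := T)) hInt
  rw [← intervalIntegral.integral_of_le (by linarith), hval] at hsplit
  have hfin : 2 * Real.pi * ‖∑ n ∈ Finset.Icc 1 ⌊x⌋₊, d n * (1 - n / x)‖ ≤
      12 * (T * K * x ^ σ₀) + 10 * (K * x ^ σ / T) + W * x ^ σ * (2 / T) := by
    have e1 : 2 * Real.pi * ‖∑ n ∈ Finset.Icc 1 ⌊x⌋₊, d n * (1 - n / x)‖ =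
        ‖2 * Real.pi * ∑ n ∈ Finset.Icc 1 ⌊x⌋₊, d n * (1 - n / x)‖ := by
      rw [norm_mul]
      simp [abs_of_pos Real.pi_pos]
    rw [e1, ← hsplit]
    refine (norm_add_le _ _).trans ?_
    linarith
  have hpi := Real.pi_gt_three
  have h0 := norm_nonneg (∑ n ∈ Finset.Icc 1 ⌊x⌋₊, d n * (1 - n / x))
  have hW0 : 0 ≤ W := (norm_nonneg _).trans (hDW 0)
  have a1 : 0 ≤ K * x ^ σ / T := by positivity
  have a2 : 0 ≤ W * x ^ σ / T := by positivity
  have e2 : W * x ^ σ * (2 / T) = 2 * (W * x ^ σ / T) := by ring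
  have e3 : (W + 2 * K) * x ^ σ / T = W * x ^ σ / T + 2 * (K * x ^ σ / T) := by ring
  rw [e2] at hfin
  rw [e3]
  nlinarith

lemma tsum_norm_term_le {d : ℕ → ℂ} {K τ σ : ℝ} (hd : ∀ n : ℕ, n ≠ 0 → ‖d n‖ ≤ K * (n : ℝ) ^ τ)
    (hσ : 1 + τ < σ) :
    LSeriesSummable d σ ∧
      ∑' n, ‖LSeries.term d σ n‖ ≤ K * (4 * (σ - τ) / (σ - τ - 1)) := by
  have hK : 0 ≤ K := by simpa using (norm_nonneg _).trans (hd 1 one_ne_zero)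
  have h1 : LSeriesSummable (1 : ℕ → ℂ) ((σ - τ : ℝ) : ℂ) :=
    LSeriesSummable_one_iff.2 (by rw [Complex.ofReal_re]; linarith)
  have h2 : ∀ n, ‖LSeries.term d σ n‖ ≤ K * ‖LSeries.term (1 : ℕ → ℂ) ((σ - τ : ℝ) : ℂ) n‖ := by
    intro n
    rcases eq_or_ne n 0 with rfl | hn
    · simp
    have hn0 : (0 : ℝ) < n := by exact_mod_cast Nat.pos_of_ne_zero hn
    rw [LSeries.norm_term_eq, LSeries.norm_term_eq, if_neg hn, if_neg hn, Complex.ofReal_re,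
      Complex.ofReal_re, Pi.one_apply, norm_one, Real.rpow_sub hn0, one_div_div, ← mul_div_assoc]
    gcongr
    exact hd n hn
  have h3 : LSeriesSummable d σ := Summable.of_norm_bounded (h1.norm.mul_left K) h2
  refine ⟨h3, (h3.norm.tsum_le_tsum h2 (h1.norm.mul_left K)).trans ?_⟩
  rw [tsum_mul_left]
  refine mul_le_mul_of_nonneg_left ?_ hK
  have h4 := norm_LSeries_le_of_norm_le_one (f := 1) (s := ((σ - τ : ℝ) : ℂ)) (by simp)
    (by rw [Complex.ofReal_re]; linarith)
  rw [Complex.ofReal_re] at h4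
  refine le_trans (le_of_eq ?_) h4
  have h5 : ∀ n, LSeries.term (1 : ℕ → ℂ) ((σ - τ : ℝ) : ℂ) n =
      ((‖LSeries.term (1 : ℕ → ℂ) ((σ - τ : ℝ) : ℂ) n‖ : ℝ) : ℂ) := by
    intro n
    have := LSeries.term_nonneg (a := (1 : ℕ → ℂ)) (n := n)
      (by open ComplexOrder in simp) (σ - τ)
    rw [← Complex.eq_coe_norm_of_nonneg this]
  have h6 : LSeries (1 : ℕ → ℂ) ((σ - τ : ℝ) : ℂ) =
      ((∑' n, ‖LSeries.term (1 : ℕ → ℂ) ((σ - τ : ℝ) : ℂ) n‖ : ℝ) : ℂ) := by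
    rw [LSeries, tsum_congr h5, Complex.ofReal_tsum]
  rw [h6, Complex.norm_real, Real.norm_eq_abs, abs_of_nonneg (tsum_nonneg fun n => norm_nonneg _)]

end ContourShift

section SiegelWalfisz

set_option linter.unusedSectionVars false

open DirichletCharacter

lemma eventually_mul_rpow_le_exp (C s : ℝ) {c : ℝ} (hc : 0 < c) :
    ∀ᶠ L : ℝ in Filter.atTop, C * L ^ s ≤ Real.exp (c * L) := by
  have h := (isLittleO_rpow_exp_pos_mul_atTop s hc).const_mul_left C
  filter_upwards [h.bound one_pos] with L hL
  rw [one_mul, Real.norm_eq_abs, Real.norm_eq_abs, abs_of_pos (Real.exp_pos _)] at hL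
  exact (le_abs_self _).trans hL

lemma eventually_mul_pow_le_exp (C : ℝ) (k : ℕ) {c : ℝ} (hc : 0 < c) :
    ∀ᶠ L : ℝ in Filter.atTop, C * L ^ k ≤ Real.exp (c * L) := by
  filter_upwards [eventually_mul_rpow_le_exp C k hc] with L hL
  rwa [Real.rpow_natCast] at hL

variable {q : ℕ} [NeZero q]

/-- `χ(n) Λ(n)`, minus `1` if `χ` is principal. -/
noncomputable def primeErr (χ : DirichletCharacter ℂ q) (n : ℕ) : ℂ :=
  twistVM χ n - if χ = 1 then 1 else 0

lemma norm_primeErr_le (χ : DirichletCharacter ℂ q) (n : ℕ) :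
    ‖primeErr χ n‖ ≤ Real.log n + 1 := by
  have h1 : ‖twistVM χ n‖ ≤ Real.log n := by
    rw [twistVM, norm_mul, Complex.norm_real, Real.norm_eq_abs,
      abs_of_nonneg ArithmeticFunction.vonMangoldt_nonneg]
    have a1 := DirichletCharacter.norm_le_one χ n
    have a2 := ArithmeticFunction.vonMangoldt_le_log (n := n)
    have a3 := ArithmeticFunction.vonMangoldt_nonneg (n := n)
    nlinarith
  refine (norm_sub_le _ _).trans (add_le_add h1 ?_)
  split_ifs <;> simp

/-- The analytic continuation of the Dirichlet series of `primeErr χ`. -/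
noncomputable def primeErrFun (χ : DirichletCharacter ℂ q) (s : ℂ) : ℂ :=
  -logDeriv (Lreg χ) s - if χ = 1 then 1 + s * charInt (1 : DirichletCharacter ℂ 1) s else 0

lemma LSeries_primeErr (χ : DirichletCharacter ℂ q) {s : ℂ} (hs : 1 < s.re) :
    LSeries (primeErr χ) s = primeErrFun χ s := by
  have hs1 : s - 1 ≠ 0 := by
    intro h
    rw [sub_eq_zero] at h
    simp [h] at hs
  have h1 := LSeries_twistVM_eq χ hs
  by_cases hχ : χ = 1
  · have h2 := LFunction_eq_charInt_of_one_lt_re (1 : DirichletCharacter ℂ 1) hs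
    rw [LFunction_eq_LSeries _ hs, LSeries_modOne_eq] at h2
    have h3 : charMean (1 : DirichletCharacter ℂ 1) = 1 := by simp [charMean]
    rw [h3] at h2
    have h4 : primeErr χ = twistVM χ - 1 := by
      funext n
      simp [primeErr, hχ]
    rw [h4, LSeries_sub (LSeriesSummable_twistVM χ hs) (LSeriesSummable_one_iff.2 hs), h1, h2,
      primeErrFun, if_pos hχ, if_pos hχ]
    field_simp
    ring
  · have h4 : primeErr χ = twistVM χ := by
      funext n
      simp [primeErr, hχ]
    rw [h4, h1, primeErrFun, if_neg hχ, if_neg hχ, add_zero, sub_zero]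

lemma norm_primeErrFun_le (χ : DirichletCharacter ℂ q) {K : ℝ} (hK : 7 ≤ K) {s : ℂ}
    (hs : 1 / 2 ≤ s.re) (h : ‖logDeriv (Lreg χ) s‖ ≤ K) :
    ‖primeErrFun χ s‖ ≤ 2 * K * (1 + ‖s‖) := by
  have h1 : ‖charInt (1 : DirichletCharacter ℂ 1) s‖ ≤ 6 := by
    refine (norm_charInt_le (1 : DirichletCharacter ℂ 1) (norm_charErr_le_rpow _)
      (by linarith)).trans ?_
    rw [div_le_iff₀ (by linarith)]
    push_cast
    linarith
  have h2 : ‖(if χ = 1 then 1 + s * charInt (1 : DirichletCharacter ℂ 1) s else 0 : ℂ)‖ ≤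
      1 + 6 * ‖s‖ := by
    split_ifs
    · refine (norm_add_le _ _).trans ?_
      rw [norm_one, norm_mul]
      nlinarith [norm_nonneg s]
    · rw [norm_zero]
      positivity
  rw [primeErrFun]
  refine (norm_sub_le _ _).trans ?_
  rw [norm_neg]
  nlinarith [norm_nonneg s]

lemma eventually_zeroFree {lam : ℝ} (hlam : 0 < lam) :
    ∀ᶠ L : ℝ in Filter.atTop, ∀ (q : ℕ) [NeZero q] (χ : DirichletCharacter ℂ q),
      (q : ℝ) ≤ L ^ (2 * lam) → ∀ s : ℂ, |s.im| ≤ Real.exp L → 1 - 1 / (10 ^ 7 * L) ≤ s.re →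
        s.re ≤ 1 + 1 / (10 ^ 6 * L) → Lreg χ s ≠ 0 ∧ ‖logDeriv (Lreg χ) s‖ ≤ 10 ^ 11 * L ^ 2 := by
  obtain ⟨c, hc, hS⟩ := siegel_zeroFree_disk (δ := 1 / (4 * lam)) (by positivity)
  have hhalf : ∀ᶠ L : ℝ in Filter.atTop, 5 / (10 ^ 6 * c) ≤ L ^ (1 / 2 : ℝ) :=
    (tendsto_rpow_atTop (by norm_num)).eventually_ge_atTop _
  filter_upwards [Filter.eventually_ge_atTop 1, eventually_mul_rpow_le_exp 1 (2 * lam) one_pos,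
    eventually_mul_pow_le_exp (10 ^ 6) 1 one_pos, hhalf] with L hL1 hL2 hL3 hL4 q _ χ hq s hs1 hs2
    hs3
  have hL0 : 0 < L := by linarith
  have hq1 : (1 : ℝ) ≤ q := by exact_mod_cast Nat.one_le_iff_ne_zero.2 (NeZero.ne q)
  obtain ⟨η, hη⟩ : ∃ η, η = 1 / (10 ^ 6 * L) := ⟨_, rfl⟩
  have hη0 : 0 < η := by rw [hη]; positivity
  have hqL : (q : ℝ) ≤ Real.exp L := by
    rw [one_mul, one_mul] at hL2
    exact hq.trans hL2
  have hηL : Real.exp (-L) ≤ η := by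
    rw [hη, Real.exp_neg, ← one_div]
    rw [one_mul, pow_one] at hL3
    exact one_div_le_one_div_of_le (by positivity) hL3
  have hη5 : 5 * η ≤ c * (q : ℝ) ^ (-(1 / (4 * lam))) := by
    have h1 : L ^ (-(1 / 2) : ℝ) ≤ (q : ℝ) ^ (-(1 / (4 * lam))) := by
      have := Real.rpow_le_rpow_of_nonpos (by linarith : (0 : ℝ) < q) hq
        (by rw [neg_nonpos]; positivity : -(1 / (4 * lam)) ≤ 0)
      rw [← Real.rpow_mul hL0.le] at this
      convert this using 2
      field_simp
      norm_num
    refine le_trans ?_ (mul_le_mul_of_nonneg_left h1 hc.le)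
    have h2 : L ^ (-(1 / 2) : ℝ) = L ^ (1 / 2 : ℝ) / L := by
      rw [eq_div_iff hL0.ne']
      nth_rewrite 2 [← Real.rpow_one L]
      rw [← Real.rpow_add hL0]
      norm_num
    rw [h2, hη]
    rw [div_le_iff₀ (by positivity)] at hL4
    rw [mul_one_div, ← mul_div_assoc, div_le_div_iff₀ (by positivity) hL0]
    nlinarith
  have hS' : χ ^ 2 = 1 → ∀ s, ‖s - 1‖ ≤ 5 * η → Lreg χ s ≠ 0 := fun h s hs =>
    hS q χ h s (hs.trans hη5)
  have e1 : 1 - η / 10 ≤ s.re := by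
    refine le_trans (le_of_eq ?_) hs2
    rw [hη]
    field_simp
  refine ⟨Lreg_ne_zero_of_zeroFree_disk χ hL1 hqL hη hηL hS' ?_ (by linarith),
    norm_logDeriv_Lreg_le χ hL1 hqL hη hηL hS' hs1 e1 (by rwa [hη])⟩
  have := Real.exp_pos L
  linarith

lemma eventually_norm_sum_tent_primeErr_le {lam : ℝ} (hlam : 0 < lam) :
    ∃ c > 0, c ≤ 1 ∧ ∀ᶠ L : ℝ in Filter.atTop, ∀ (q : ℕ) [NeZero q] (χ : DirichletCharacter ℂ q),
      (q : ℝ) ≤ L ^ (2 * lam) → ∀ x : ℝ, 0 < x → L ^ 2 / 2 ≤ Real.log x → Real.log x ≤ 2 * L ^ 2 →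
        ‖∑ n ∈ Finset.Icc 1 ⌊x⌋₊, primeErr χ n * (1 - n / x)‖ ≤ x * Real.exp (-(c * L)) := by
  obtain ⟨κ, hκ⟩ : ∃ κ : ℝ, κ = 1 / (4 * 10 ^ 7) := ⟨_, rfl⟩
  have hκ0 : 0 < κ := by rw [hκ]; norm_num
  refine ⟨κ / 2, by positivity, by rw [hκ]; norm_num, ?_⟩
  filter_upwards [eventually_zeroFree hlam, Filter.eventually_ge_atTop (10 ^ 6),
    eventually_mul_pow_le_exp (10 ^ 14) 4 (by positivity : 0 < κ / 2)] with L hZ hL hLe q _ χ hq x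
    hx hx1 hx2
  have hL1 : 1 ≤ L := le_trans (by norm_num) hL
  have hL0 : 0 < L := by linarith
  have hx1' : 1 ≤ x := by
    by_contra! h
    have := Real.log_neg hx h
    nlinarith [sq_nonneg L]
  obtain ⟨σ, hσ⟩ : ∃ σ, σ = 1 + 1 / L ^ 2 := ⟨_, rfl⟩
  obtain ⟨σ₀, hσ₀⟩ : ∃ σ₀, σ₀ = 1 - 1 / (10 ^ 7 * L) := ⟨_, rfl⟩
  have hLinv : 0 < 1 / L ^ 2 := by positivity
  have hLinv1 : 1 / L ^ 2 ≤ 1 := by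
    rw [div_le_one (by positivity)]
    nlinarith
  have hσ1 : 1 < σ := by linarith
  have hση : σ ≤ 1 + 1 / (10 ^ 6 * L) := by
    rw [hσ]
    gcongr
    nlinarith
  have hs₀ : 0 < 1 / (10 ^ 7 * L) := by positivity
  have hs₀' : 1 / (10 ^ 7 * L) ≤ 1 / 2 := by
    rw [div_le_div_iff₀ (by positivity) (by norm_num)]
    nlinarith
  have hT1 : 1 ≤ Real.exp (κ * L) := Real.one_le_exp (by positivity)
  have hTL : Real.exp (κ * L) ≤ Real.exp L := by
    refine Real.exp_le_exp.2 ?_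
    have : κ ≤ 1 := by rw [hκ]; norm_num
    nlinarith
  have hτ : 0 < 1 / (2 * L ^ 2) := by positivity
  have hdb : ∀ n : ℕ, n ≠ 0 → ‖primeErr χ n‖ ≤ 4 * L ^ 2 * (n : ℝ) ^ (1 / (2 * L ^ 2)) := by
    intro n hn
    have hn1 : (1 : ℝ) ≤ n := by exact_mod_cast Nat.one_le_iff_ne_zero.2 hn
    refine (norm_primeErr_le χ n).trans ?_
    have a1 := Real.log_le_rpow_div (by linarith : (0 : ℝ) ≤ n) hτ
    have a2 : 1 ≤ (n : ℝ) ^ (1 / (2 * L ^ 2)) := Real.one_le_rpow hn1 hτ.le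
    have a3 : (n : ℝ) ^ (1 / (2 * L ^ 2)) / (1 / (2 * L ^ 2)) =
        2 * L ^ 2 * (n : ℝ) ^ (1 / (2 * L ^ 2)) := by field_simp
    rw [a3] at a1
    nlinarith
  have hhalf : 1 / (2 * L ^ 2) = 1 / L ^ 2 / 2 := by field_simp
  obtain ⟨hsumm, hW⟩ := tsum_norm_term_le (σ := σ) hdb (by rw [hσ, hhalf]; linarith)
  have hW' : ∑' n, ‖LSeries.term (primeErr χ) σ n‖ ≤ 64 * L ^ 4 := by
    refine hW.trans ?_
    have e1 : σ - 1 / (2 * L ^ 2) - 1 = 1 / (2 * L ^ 2) := by rw [hσ, hhalf]; ring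
    rw [e1]
    have e2 : 4 * (σ - 1 / (2 * L ^ 2)) / (1 / (2 * L ^ 2)) ≤ 16 * L ^ 2 := by
      rw [div_le_iff₀ hτ]
      have : 16 * L ^ 2 * (1 / (2 * L ^ 2)) = 8 := by field_simp; norm_num
      rw [this]
      linarith
    calc 4 * L ^ 2 * (4 * (σ - 1 / (2 * L ^ 2)) / (1 / (2 * L ^ 2)))
        ≤ 4 * L ^ 2 * (16 * L ^ 2) := by
          gcongr
      _ = _ := by ring
  have hmain := norm_sum_tent_le (d := primeErr χ) (D := primeErrFun χ) (K := 2 * (10 ^ 11 * L ^ 2))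
    (T := Real.exp (κ * L)) (σ₀ := σ₀) (σ := σ) (x := x) (W := 64 * L ^ 4) hσ1 (by linarith)
    (by linarith) (by linarith) hT1 hx1' hsumm hW' (fun s hs => LSeries_primeErr χ hs)
    (fun s hs => by
      obtain ⟨h1, h2⟩ := hs
      simp only [Set.mem_preimage] at h1 h2
      rw [Set.uIcc_of_le (by linarith)] at h1 h2
      have hz := (hZ q χ hq s ((abs_le.2 h2).trans hTL) (by rw [← hσ₀]; exact h1.1)
        (h1.2.trans hση)).1
      have hsre : 0 < s.re := lt_of_lt_of_le (by linarith) h1.1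
      have d1 : DifferentiableAt ℂ (logDeriv (Lreg χ)) s :=
        ((differentiable_Lreg χ).analyticAt s).deriv.differentiableAt.div
          (differentiable_Lreg χ s) hz
      have d2 : DifferentiableAt ℂ (fun s => (if χ = 1 then
          1 + s * charInt (1 : DirichletCharacter ℂ 1) s else 0 : ℂ)) s := by
        split_ifs
        · exact (differentiableAt_const _).add
            (differentiableAt_id.mul (differentiableAt_charInt _ hsre))
        · exact differentiableAt_const _
      exact (d1.neg.sub d2).differentiableWithinAt)
    (fun s h1 h2 h3 => norm_primeErrFun_le χ (by nlinarith) (by linarith)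
      (hZ q χ hq s (h3.trans hTL) (by rwa [← hσ₀]) (h2.trans hση)).2)
  refine hmain.trans ?_
  have hxσ : x ^ σ ≤ x * 8 := by
    rw [hσ, Real.rpow_add hx, Real.rpow_one]
    refine mul_le_mul_of_nonneg_left ?_ hx.le
    rw [Real.rpow_def_of_pos hx]
    have h1 : Real.log x * (1 / L ^ 2) ≤ 2 := by
      rw [mul_one_div, div_le_iff₀ (by positivity)]
      exact hx2
    have h2 : Real.exp 2 = Real.exp 1 * Real.exp 1 := by rw [← Real.exp_add]; norm_num
    have h3 := Real.exp_one_lt_d9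
    have h4 := Real.exp_pos 1
    have h5 := Real.exp_le_exp.2 h1
    nlinarith
  have hxσ₀ : x ^ σ₀ ≤ x * Real.exp (-(2 * κ * L)) := by
    rw [hσ₀, Real.rpow_sub hx, Real.rpow_one, div_eq_mul_inv]
    refine mul_le_mul_of_nonneg_left ?_ hx.le
    rw [Real.rpow_def_of_pos hx, ← Real.exp_neg]
    refine Real.exp_le_exp.2 (neg_le_neg ?_)
    have : Real.log x * (1 / (10 ^ 7 * L)) - 2 * κ * L =
        (Real.log x - L ^ 2 / 2) * (1 / (10 ^ 7 * L)) := by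
      rw [hκ]
      field_simp
      ring
    nlinarith
  have hE : Real.exp (-(κ * L)) = Real.exp (-(κ / 2 * L)) * Real.exp (-(κ / 2 * L)) := by
    rw [← Real.exp_add]; ring_nf
  have hE1 : 10 ^ 14 * L ^ 4 * Real.exp (-(κ / 2 * L)) ≤ 1 := by
    rw [Real.exp_neg, ← div_eq_mul_inv, div_le_one (Real.exp_pos _)]
    exact hLe
  have hL24 : L ^ 2 ≤ L ^ 4 := pow_le_pow_right₀ hL1 (by norm_num)
  calc (64 * L ^ 4 + 2 * (2 * (10 ^ 11 * L ^ 2))) * x ^ σ / Real.exp (κ * L) +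
        2 * Real.exp (κ * L) * (2 * (10 ^ 11 * L ^ 2)) * x ^ σ₀
      ≤ (64 * L ^ 4 + 2 * (2 * (10 ^ 11 * L ^ 2))) * (x * 8) / Real.exp (κ * L) +
        2 * Real.exp (κ * L) * (2 * (10 ^ 11 * L ^ 2)) * (x * Real.exp (-(2 * κ * L))) := by
        gcongr
    _ = (8 * (64 * L ^ 4 + 2 * (2 * (10 ^ 11 * L ^ 2))) + 4 * (10 ^ 11 * L ^ 2)) *
        x * Real.exp (-(κ * L)) := by
        have e2 : Real.exp (-(2 * κ * L)) = Real.exp (-(κ * L)) * Real.exp (-(κ * L)) := by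
          rw [← Real.exp_add]; ring_nf
        have e3 : Real.exp (κ * L) * Real.exp (-(κ * L)) = 1 := by
          rw [← Real.exp_add]; simp
        rw [e2, div_eq_mul_inv, ← Real.exp_neg]
        linear_combination (4 * (10 ^ 11 * L ^ 2) * x * Real.exp (-(κ * L))) * e3
    _ ≤ 10 ^ 14 * L ^ 4 * x * Real.exp (-(κ * L)) := by
        gcongr
        linarith
    _ = x * Real.exp (-(κ / 2 * L)) * (10 ^ 14 * L ^ 4 * Real.exp (-(κ / 2 * L))) := by
        rw [hE]; ring
    _ ≤ x * Real.exp (-(κ / 2 * L)) * 1 := by gcongr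
    _ = _ := mul_one _

lemma norm_sum_le_of_tent {d : ℕ → ℂ} {x h R : ℝ} (hx : 0 < x) (hh : 0 < h) (hR0 : 0 ≤ R)
    (hR : ∀ n : ℕ, n ≠ 0 → (n : ℝ) ≤ x + h → ‖d n‖ ≤ R) :
    ‖∑ n ∈ Finset.Icc 1 ⌊x⌋₊, d n‖ ≤
      ((x + h) * ‖∑ n ∈ Finset.Icc 1 ⌊x + h⌋₊, d n * (1 - n / (x + h : ℝ))‖ +
        x * ‖∑ n ∈ Finset.Icc 1 ⌊x⌋₊, d n * (1 - n / x)‖) / h + (h + 1) * R := by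
  have hxh : ((x + h : ℝ) : ℂ) ≠ 0 := by exact_mod_cast (by positivity : x + h ≠ 0)
  have hx' : (x : ℂ) ≠ 0 := by exact_mod_cast hx.ne'
  have hle : ⌊x⌋₊ ≤ ⌊x + h⌋₊ := Nat.floor_le_floor (by linarith)
  have hsplit : ∀ f : ℕ → ℂ, ∑ n ∈ Finset.Icc 1 ⌊x + h⌋₊, f n =
      ∑ n ∈ Finset.Icc 1 ⌊x⌋₊, f n + ∑ n ∈ Finset.Ioc ⌊x⌋₊ ⌊x + h⌋₊, f n := by
    intro f
    have e : ∀ N : ℕ, Finset.Icc 1 N = Finset.Ioc 0 N := fun N => by ext; simp; omega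
    rw [e, e, Finset.sum_Ioc_consecutive f (Nat.zero_le _) hle]
  have e1 : (h : ℂ) * ∑ n ∈ Finset.Icc 1 ⌊x⌋₊, d n =
      ((x + h : ℝ) : ℂ) * ∑ n ∈ Finset.Icc 1 ⌊x + h⌋₊, d n * (1 - n / (x + h : ℝ)) -
      x * ∑ n ∈ Finset.Icc 1 ⌊x⌋₊, d n * (1 - n / x) -
      ∑ n ∈ Finset.Ioc ⌊x⌋₊ ⌊x + h⌋₊, d n * ((x + h : ℝ) - n) := by
    rw [hsplit, mul_add, Finset.mul_sum, Finset.mul_sum, Finset.mul_sum, Finset.mul_sum]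
    have a1 : ∀ n : ℕ, ((x + h : ℝ) : ℂ) * (d n * (1 - n / (x + h : ℝ))) =
        d n * ((x + h : ℝ) - n) := fun n => by field_simp
    have a2 : ∀ n : ℕ, (x : ℂ) * (d n * (1 - n / x)) = d n * (x - n) := fun n => by field_simp
    simp only [a1, a2]
    rw [add_sub_right_comm, add_sub_cancel_right, ← Finset.sum_sub_distrib]
    refine Finset.sum_congr rfl fun n _ => ?_
    push_cast
    ring
  have e2 : ‖∑ n ∈ Finset.Ioc ⌊x⌋₊ ⌊x + h⌋₊, d n * ((x + h : ℝ) - n)‖ ≤ h * ((h + 1) * R) := by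
    have b1 : ∀ n ∈ Finset.Ioc ⌊x⌋₊ ⌊x + h⌋₊, ‖d n * ((x + h : ℝ) - n)‖ ≤ R * h := by
      intro n hn
      rw [Finset.mem_Ioc] at hn
      have c1 : x < n := (Nat.floor_lt hx.le).1 hn.1
      have c2 : (n : ℝ) ≤ x + h := (Nat.le_floor_iff (by positivity)).1 hn.2
      have c3 := hR n (by omega) c2
      rw [norm_mul, show ((x + h : ℝ) : ℂ) - n = ((x + h - n : ℝ) : ℂ) by push_cast; ring,
        Complex.norm_real, Real.norm_eq_abs, abs_of_nonneg (by linarith)]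
      exact mul_le_mul c3 (by linarith) (by linarith) ((norm_nonneg _).trans c3)
    refine (norm_sum_le_of_le _ b1).trans ?_
    rw [Finset.sum_const, nsmul_eq_mul, Nat.card_Ioc]
    have c4 : ((⌊x + h⌋₊ - ⌊x⌋₊ : ℕ) : ℝ) ≤ h + 1 := by
      rw [Nat.cast_sub hle]
      have := Nat.floor_le (by positivity : 0 ≤ x + h)
      have := Nat.lt_floor_add_one x
      linarith
    calc ((⌊x + h⌋₊ - ⌊x⌋₊ : ℕ) : ℝ) * (R * h) ≤ (h + 1) * (R * h) := by gcongr
      _ = _ := by ring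
  have e3 : h * ‖∑ n ∈ Finset.Icc 1 ⌊x⌋₊, d n‖ =
      ‖(h : ℂ) * ∑ n ∈ Finset.Icc 1 ⌊x⌋₊, d n‖ := by
    rw [norm_mul, Complex.norm_real, Real.norm_eq_abs, abs_of_pos hh]
  have e4 : h * ‖∑ n ∈ Finset.Icc 1 ⌊x⌋₊, d n‖ ≤
      ((x + h) * ‖∑ n ∈ Finset.Icc 1 ⌊x + h⌋₊, d n * (1 - n / (x + h : ℝ))‖ +
        x * ‖∑ n ∈ Finset.Icc 1 ⌊x⌋₊, d n * (1 - n / x)‖) + h * ((h + 1) * R) := by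
    rw [e3, e1]
    refine (norm_sub_le _ _).trans (add_le_add ((norm_sub_le _ _).trans (le_of_eq ?_)) e2)
    rw [norm_mul, norm_mul, Complex.norm_real, Complex.norm_real, Real.norm_eq_abs,
      Real.norm_eq_abs, abs_of_pos hx, abs_of_pos (by positivity : 0 < x + h)]
  rw [div_add' _ _ _ hh.ne', le_div_iff₀ hh]
  linarith

end SiegelWalfisz

section ShortSums

/-- The Siegel–Walfisz bound `∑_{n ≤ y} (χ(n) Λ(n) - [χ = 1]) ≪ X exp(-c √log X)`. -/
lemma eventually_norm_sum_primeErr_le {lam : ℝ} (hlam : 0 < lam) :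
    ∃ c > 0, c ≤ 1 ∧ ∀ᶠ L : ℝ in Filter.atTop, ∀ (q : ℕ) [NeZero q] (χ : DirichletCharacter ℂ q),
      (q : ℝ) ≤ L ^ (2 * lam) → ∀ X : ℝ, Real.exp (3 * L ^ 2 / 4) ≤ X → X ≤ Real.exp (L ^ 2) →
        ∀ y : ℝ, 0 ≤ y → y ≤ X →
          ‖∑ n ∈ Finset.Icc 1 ⌊y⌋₊, primeErr χ n‖ ≤ X * Real.exp (-(c * L)) := by
  obtain ⟨c, hc, hc1, H⟩ := eventually_norm_sum_tent_primeErr_le hlam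
  refine ⟨c / 4, by positivity, by linarith, ?_⟩
  filter_upwards [H, Filter.eventually_ge_atTop 8, eventually_mul_pow_le_exp 13 2
    (by positivity : 0 < c / 4)] with L hL hL8 hLe q _ χ hq X hX1 hX2 y hy0 hyX
  have hLe' : 13 * L ^ 2 ≤ Real.exp L := hLe.trans (Real.exp_le_exp.2 (by nlinarith))
  have hX0 : 0 < X := (Real.exp_pos _).trans_le hX1
  have hterm : ∀ z : ℝ, 0 < z → ∀ n : ℕ, (n : ℝ) ≤ z → 1 ≤ z → ‖primeErr χ n‖ ≤ Real.log z + 1 := by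
    intro z hz n hn hz1
    refine (norm_primeErr_le χ n).trans ?_
    rcases Nat.eq_zero_or_pos n with h | h
    · subst h
      simp [Real.log_nonneg hz1]
    · have : (0 : ℝ) < n := by exact_mod_cast h
      gcongr
  rcases le_or_gt (Real.exp (L ^ 2 / 2)) y with hy | hy
  · have hypos : 0 < y := (Real.exp_pos _).trans_le hy
    have hly1 : L ^ 2 / 2 ≤ Real.log y := (Real.le_log_iff_exp_le hypos).2 hy
    have hly2 : Real.log y ≤ L ^ 2 := (Real.log_le_iff_le_exp hypos).2 (hyX.trans hX2)
    obtain ⟨h, hh⟩ : ∃ h, h = y * Real.exp (-(c / 2 * L)) := ⟨_, rfl⟩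
    have hh0 : 0 < h := by rw [hh]; positivity
    have hhy : h ≤ y := by
      rw [hh]
      refine mul_le_of_le_one_right hypos.le (Real.exp_le_one_iff.2 ?_)
      rw [neg_nonpos]; positivity
    have hh1 : 1 ≤ h := by
      rw [hh]
      calc (1 : ℝ) = Real.exp (c / 2 * L) * Real.exp (-(c / 2 * L)) := by
            rw [← Real.exp_add, add_neg_cancel, Real.exp_zero]
        _ ≤ _ := by
          gcongr
          refine le_trans (Real.exp_le_exp.2 ?_) hy
          nlinarith
    have hyh : 0 < y + h := by positivity
    have hl2 : Real.log (2 * y) ≤ L ^ 2 + 1 := by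
      rw [Real.log_mul (by norm_num) hypos.ne']
      have := Real.log_two_lt_d9
      linarith
    have hlyh : Real.log (y + h) ≤ L ^ 2 + 1 :=
      (Real.log_le_log hyh (by linarith)).trans hl2
    have hy1 : 1 ≤ y := hh1.trans hhy
    have t1 := hL q χ hq y hypos hly1 (by nlinarith)
    have t2 := hL q χ hq (y + h) hyh (hly1.trans (Real.log_le_log hypos (by linarith)))
      (by nlinarith)
    have h3 := norm_sum_le_of_tent (d := primeErr χ) (R := L ^ 2 + 2) hypos hh0 (by positivity)
      (fun n _ hn => (hterm _ hyh n hn (by linarith)).trans (by linarith))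
    refine h3.trans ?_
    obtain ⟨E, hE⟩ : ∃ E, E = Real.exp (-(c / 2 * L)) := ⟨_, rfl⟩
    have hE0 : 0 < E := by rw [hE]; positivity
    have hEE : Real.exp (-(c * L)) = E * E := by
      rw [hE, ← Real.exp_add]; congr 1; ring
    rw [← hE] at hh
    rw [hEE] at t1 t2
    have h4 : ((y + h) * ‖∑ n ∈ Finset.Icc 1 ⌊y + h⌋₊, primeErr χ n * (1 - n / (y + h : ℝ))‖ +
        y * ‖∑ n ∈ Finset.Icc 1 ⌊y⌋₊, primeErr χ n * (1 - n / y)‖) / h ≤ 5 * (y * E) := by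
      rw [div_le_iff₀ hh0]
      have e1 := mul_le_mul_of_nonneg_left t1 hypos.le
      have e2 := mul_le_mul_of_nonneg_left t2 hyh.le
      have e3 : (y + h) * ((y + h) * (E * E)) ≤ (2 * y) * ((2 * y) * (E * E)) := by
        gcongr <;> linarith
      rw [hh] at *
      nlinarith
    have h5 : (h + 1) * (L ^ 2 + 2) ≤ 2 * (y * E) * (L ^ 2 + 2) := by
      rw [← hh]
      gcongr
      linarith
    have h6 : y * E * (13 * L ^ 2) ≤ X * Real.exp (-(c / 4 * L)) := by
      have : E = Real.exp (-(c / 4 * L)) * Real.exp (-(c / 4 * L)) := by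
        rw [hE, ← Real.exp_add]; congr 1; ring
      have h7 : Real.exp (-(c / 4 * L)) * (13 * L ^ 2) ≤ 1 := by
        rw [Real.exp_neg, inv_mul_le_iff₀ (Real.exp_pos _), mul_one]
        exact hLe
      calc y * E * (13 * L ^ 2) = y * Real.exp (-(c / 4 * L)) *
            (Real.exp (-(c / 4 * L)) * (13 * L ^ 2)) := by rw [this]; ring
        _ ≤ X * Real.exp (-(c / 4 * L)) * 1 := by gcongr
        _ = _ := mul_one _
    have h8 : y * E * 9 ≤ y * E * L ^ 2 := by
      gcongr
      nlinarith
    linarith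
  · have h1 : ‖∑ n ∈ Finset.Icc 1 ⌊y⌋₊, primeErr χ n‖ ≤
        Real.exp (L ^ 2 / 2) * (L ^ 2 / 2 + 1) := by
      refine (norm_sum_le _ _).trans ((Finset.sum_le_card_nsmul _ _ (L ^ 2 / 2 + 1) ?_).trans ?_)
      · intro n hn
        have hn' : (n : ℝ) ≤ Real.exp (L ^ 2 / 2) :=
          ((Nat.le_floor_iff hy0).1 (Finset.mem_Icc.1 hn).2).trans hy.le
        have := hterm _ (Real.exp_pos _) n hn' (Real.one_le_exp (by positivity))
        rwa [Real.log_exp] at this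
      · rw [nsmul_eq_mul, Nat.card_Icc, Nat.add_sub_cancel]
        gcongr
        exact (Nat.floor_le hy0).trans hy.le
    refine h1.trans ?_
    calc Real.exp (L ^ 2 / 2) * (L ^ 2 / 2 + 1)
        ≤ Real.exp (L ^ 2 / 2) * Real.exp L := by gcongr; nlinarith
      _ ≤ Real.exp (3 * L ^ 2 / 4) * Real.exp (-(c / 4 * L)) := by
          rw [← Real.exp_add, ← Real.exp_add]
          apply Real.exp_le_exp.2
          nlinarith
      _ ≤ _ := by gcongr

end ShortSums

section ExponentialSums

lemma e_add (x y : ℝ) : e (x + y) = e x * e y := by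
  rw [e, e, e, ← Complex.exp_add]
  congr 1
  push_cast
  ring

lemma norm_e (x : ℝ) : ‖e x‖ = 1 := by
  rw [e, show 2 * (π : ℂ) * Complex.I * x = ((2 * π * x : ℝ) : ℂ) * Complex.I by push_cast; ring]
  exact Complex.norm_exp_ofReal_mul_I _

lemma e_intCast (n : ℤ) : e n = 1 := by
  rw [e, show 2 * (π : ℂ) * Complex.I * ((n : ℝ) : ℂ) = n * (2 * π * Complex.I) by push_cast; ring]
  exact Complex.exp_int_mul_two_pi_mul_I n

lemma conj_e (x : ℝ) : (starRingEnd ℂ) (e x) = e (-x) := by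
  rw [e, e, ← Complex.exp_conj]
  congr 1
  simp only [map_mul, Complex.conj_I, Complex.conj_ofReal, Complex.ofReal_neg, map_ofNat]
  ring

lemma e_mul_natCast (x : ℝ) (k : ℕ) : e (x * k) = e x ^ k := by
  rw [e, e, ← Complex.exp_nat_mul]
  congr 1
  push_cast
  ring

lemma norm_e_sub_one (x : ℝ) : ‖e x - 1‖ = 2 * |Real.sin (π * x)| := by
  have := Complex.norm_exp_I_mul_ofReal_sub_one (2 * π * x)
  rw [e, show 2 * (π : ℂ) * Complex.I * x = Complex.I * ((2 * π * x : ℝ) : ℂ) by push_cast; ring,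
    this, norm_mul, Real.norm_eq_abs, Real.norm_eq_abs, abs_two]
  congr 3
  ring

lemma norm_e_sub_one_le (x : ℝ) : ‖e x - 1‖ ≤ 2 * π * |x| := by
  rw [norm_e_sub_one]
  have := Real.abs_sin_le_abs (x := π * x)
  rw [abs_mul, abs_of_pos Real.pi_pos] at this
  linarith

lemma le_norm_e_sub_one {x η : ℝ} (h : ∀ z : ℤ, η ≤ |x - z|) : 4 * η ≤ ‖e x - 1‖ := by
  have h1 : e x = e (x - round x) := by
    have := e_add (x - round x) (round x)
    rwa [sub_add_cancel, e_intCast, mul_one] at this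
  have h2 := abs_sub_round x
  rw [h1, norm_e_sub_one]
  have h3 := Real.mul_abs_le_abs_sin (x := π * (x - round x)) (by
    rw [abs_mul, abs_of_pos Real.pi_pos]
    have := Real.pi_pos
    nlinarith)
  rw [abs_mul, abs_of_pos Real.pi_pos, ← mul_assoc, div_mul_cancel₀ _ Real.pi_pos.ne'] at h3
  have := h (round x)
  linarith

lemma norm_sum_range_e_le {x η : ℝ} (hη : 0 < η) (h : ∀ z : ℤ, η ≤ |x - z|) (K : ℕ) :
    ‖∑ k ∈ Finset.range K, e (x * k)‖ ≤ 1 / (2 * η) := by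
  have h1 := le_norm_e_sub_one h
  have h2 : e x ≠ 1 := by
    intro h'
    rw [h', sub_self, norm_zero] at h1
    linarith
  simp_rw [e_mul_natCast]
  rw [geom_sum_eq h2, norm_div, div_le_div_iff₀ (by linarith) (by linarith)]
  have h3 : ‖e x ^ K - 1‖ ≤ 2 := by
    refine (norm_sub_le _ _).trans ?_
    rw [norm_pow, norm_e]
    norm_num
  nlinarith

lemma sum_range_mul_eq_sub (w z : ℕ → ℂ) (n : ℕ) :
    ∑ k ∈ Finset.range n, w k * z k = w n * ∑ k ∈ Finset.range n, z k -
      ∑ k ∈ Finset.range n, (w (k + 1) - w k) * ∑ j ∈ Finset.range (k + 1), z j := by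
  induction n with
  | zero => simp
  | succ n ih =>
    rw [Finset.sum_range_succ, ih, Finset.sum_range_succ (fun k => (w (k + 1) - w k) * _),
      Finset.sum_range_succ z n]
    ring

lemma norm_sum_range_mul_le {w z : ℕ → ℂ} {n : ℕ} {G : ℝ}
    (h : ∀ k ≤ n, ‖∑ j ∈ Finset.range k, z j‖ ≤ G) :
    ‖∑ k ∈ Finset.range n, w k * z k‖ ≤
      (‖w n‖ + ∑ k ∈ Finset.range n, ‖w (k + 1) - w k‖) * G := by
  rw [sum_range_mul_eq_sub, add_mul, Finset.sum_mul]
  refine (norm_sub_le _ _).trans (add_le_add ?_ ((norm_sum_le _ _).trans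
    (Finset.sum_le_sum fun k hk => ?_)))
  · rw [norm_mul]
    exact mul_le_mul_of_nonneg_left (h n le_rfl) (norm_nonneg _)
  · rw [norm_mul]
    exact mul_le_mul_of_nonneg_left (h _ (Finset.mem_range.1 hk)) (norm_nonneg _)

lemma norm_sum_range_monotone_mul_le {w : ℕ → ℝ} {z : ℕ → ℂ} {n : ℕ} {G : ℝ} (hw : Monotone w)
    (hw0 : 0 ≤ w 0) (h : ∀ k ≤ n, ‖∑ j ∈ Finset.range k, z j‖ ≤ G) :
    ‖∑ k ∈ Finset.range n, (w k : ℂ) * z k‖ ≤ 2 * w n * G := by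
  have hG : 0 ≤ G := (norm_nonneg _).trans (h 0 (Nat.zero_le _))
  refine (norm_sum_range_mul_le h).trans ?_
  refine mul_le_mul_of_nonneg_right ?_ hG
  have h1 : ∑ k ∈ Finset.range n, ‖(w (k + 1) : ℂ) - w k‖ = w n - w 0 := by
    rw [← Finset.sum_range_sub]
    refine Finset.sum_congr rfl fun k _ => ?_
    rw [← Complex.ofReal_sub, Complex.norm_real, Real.norm_eq_abs,
      abs_of_nonneg (sub_nonneg.2 (hw (Nat.le_succ k)))]
  rw [h1, Complex.norm_real, Real.norm_eq_abs, abs_of_nonneg (hw0.trans (hw (Nat.zero_le _)))]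
  linarith

lemma sum_Ioc_zero_eq_sum_range {M : Type*} [AddCommMonoid M] (f : ℕ → M) (n : ℕ) :
    ∑ k ∈ Finset.Ioc 0 n, f k = ∑ k ∈ Finset.range n, f (k + 1) := by
  rw [Finset.range_eq_Ico, Finset.sum_Ico_add' f 0 n 1]
  rfl

lemma sum_Ioc_zero_inv_le (n : ℕ) : ∑ k ∈ Finset.Ioc 0 n, (k : ℝ)⁻¹ ≤ 1 + Real.log n := by
  have := harmonic_le_one_add_log n
  rw [harmonic_eq_sum_Icc] at this
  push_cast at this
  exact this

end ExponentialSums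

section Vaughan

open ArithmeticFunction

/-- The restriction of an arithmetic function to `n ≤ U`. -/
def lowPart (U : ℕ) (F : ArithmeticFunction ℝ) : ArithmeticFunction ℝ :=
  ⟨fun n => if n ≤ U then F n else 0, by simp⟩

/-- The restriction of an arithmetic function to `n > U`. -/
def highPart (U : ℕ) (F : ArithmeticFunction ℝ) : ArithmeticFunction ℝ :=
  ⟨fun n => if n ≤ U then 0 else F n, by simp⟩

lemma lowPart_apply (U : ℕ) (F : ArithmeticFunction ℝ) (n : ℕ) :
    lowPart U F n = if n ≤ U then F n else 0 := rfl

lemma highPart_apply (U : ℕ) (F : ArithmeticFunction ℝ) (n : ℕ) :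
    highPart U F n = if n ≤ U then 0 else F n := rfl

lemma lowPart_add_highPart (U : ℕ) (F : ArithmeticFunction ℝ) :
    lowPart U F + highPart U F = F := by
  ext n
  rw [ArithmeticFunction.add_apply, lowPart_apply, highPart_apply]
  split_ifs <;> simp

lemma vonMangoldt_eq_vaughan (U : ℕ) :
    vonMangoldt = lowPart U vonMangoldt +
      lowPart U (moebius : ArithmeticFunction ℝ) * ArithmeticFunction.log -
      lowPart U (moebius : ArithmeticFunction ℝ) * lowPart U vonMangoldt *
        (zeta : ArithmeticFunction ℝ) +
      highPart U (moebius : ArithmeticFunction ℝ) * (zeta : ArithmeticFunction ℝ) *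
        highPart U vonMangoldt := by
  have h1 := lowPart_add_highPart U (moebius : ArithmeticFunction ℝ)
  have h2 := lowPart_add_highPart U vonMangoldt
  have h3 : (moebius : ArithmeticFunction ℝ) * (zeta : ArithmeticFunction ℝ) = 1 :=
    coe_moebius_mul_coe_zeta
  have h4 := vonMangoldt_mul_zeta
  rw [← h4]
  generalize lowPart U (moebius : ArithmeticFunction ℝ) = a at *
  generalize highPart U (moebius : ArithmeticFunction ℝ) = b at *
  generalize lowPart U vonMangoldt = c at *
  generalize highPart U vonMangoldt = d at *
  generalize (zeta : ArithmeticFunction ℝ) = z at *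
  rw [← h1] at h3
  rw [← h2]
  linear_combination -d * h3

lemma sum_Ioc_mul_apply (F G : ArithmeticFunction ℝ) (f : ℕ → ℂ) (N : ℕ) :
    ∑ n ∈ Finset.Ioc 0 N, ((F * G) n : ℂ) * f n =
      ∑ m ∈ Finset.Ioc 0 N, (F m : ℂ) * ∑ k ∈ Finset.Ioc 0 (N / m), (G k : ℂ) * f (m * k) := by
  have h1 : ∀ n ∈ Finset.Ioc 0 N, ((F * G) n : ℂ) * f n =
      ∑ m ∈ Finset.Ioc 0 N, ∑ k ∈ Finset.Ioc 0 N,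
        if m * k = n then (F m : ℂ) * ((G k : ℂ) * f (m * k)) else 0 := by
    intro n hn
    rw [Finset.mem_Ioc] at hn
    rw [mul_apply, Nat.divisorsAntidiagonal_eq_prod_filter_of_le hn.1.ne' hn.2,
      ← Finset.sum_product', ← Finset.sum_filter]
    push_cast
    rw [Finset.sum_mul]
    refine Finset.sum_congr rfl fun x hx => ?_
    rw [(Finset.mem_filter.1 hx).2]
    ring
  rw [Finset.sum_congr rfl h1, Finset.sum_comm]
  refine Finset.sum_congr rfl fun m hm => ?_
  rw [Finset.mem_Ioc] at hm
  rw [Finset.sum_comm, Finset.mul_sum]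
  have h2 : Finset.Ioc 0 (N / m) = (Finset.Ioc 0 N).filter (fun k => m * k ≤ N) := by
    ext k
    rw [Finset.mem_filter, Finset.mem_Ioc, Finset.mem_Ioc, Nat.le_div_iff_mul_le hm.1, mul_comm k]
    constructor
    · rintro ⟨h3, h4⟩
      exact ⟨⟨h3, le_trans (Nat.le_mul_of_pos_left k hm.1) h4⟩, h4⟩
    · rintro ⟨h3, h4⟩
      exact ⟨h3.1, h4⟩
  rw [h2, Finset.sum_filter]
  refine Finset.sum_congr rfl fun k hk => ?_
  rw [Finset.mem_Ioc] at hk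
  rw [Finset.sum_ite_eq]
  simp only [Finset.mem_Ioc, Nat.mul_pos hm.1 hk.1, true_and]

variable {x B R : ℝ} {D M U : ℕ}

lemma norm_sum_range_e_add (x y : ℝ) (K : ℕ) :
    ‖∑ k ∈ Finset.range K, e (x * k + y)‖ = ‖∑ k ∈ Finset.range K, e (x * k)‖ := by
  simp_rw [e_add]
  rw [← Finset.sum_mul, norm_mul, norm_e, mul_one]

lemma norm_sum_Ioc_monotone_mul_e_le {w : ℕ → ℝ} (hw : MonotoneOn w (Set.Ici 1))
    (hw0 : 0 ≤ w 1) {y G : ℝ}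
    (hG : ∀ K : ℕ, ‖∑ k ∈ Finset.range K, e (y * k)‖ ≤ G) (n : ℕ) :
    ‖∑ k ∈ Finset.Ioc 0 n, (w k : ℂ) * e (y * k)‖ ≤ 2 * w (n + 1) * G := by
  rw [sum_Ioc_zero_eq_sum_range]
  refine norm_sum_range_monotone_mul_le (w := fun k => w (k + 1))
    (z := fun k => e (y * ((k + 1 : ℕ) : ℝ))) (fun a b hab => hw (by simp) (by simp) (by simpa))
    (by simpa using hw0) fun k _ => ?_
  have : ∀ j : ℕ, y * ((j + 1 : ℕ) : ℝ) = y * j + y := fun j => by push_cast; ring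
  simp_rw [this]
  rw [norm_sum_range_e_add]
  exact hG k

/-- The bound for Type I sums. -/
lemma norm_sum_mul_typeI_le {F G : ArithmeticFunction ℝ} {P W : ℝ} (hUM : U ≤ M)
    (hUD : U ≤ D) (hR : 0 ≤ R) (hB : 0 ≤ B) (hW : 0 ≤ W) (hF : ∀ m, U < m → F m = 0)
    (hFP : ∀ m ≤ U, |F m| ≤ P) (hGm : MonotoneOn G (Set.Ici 1)) (hG1 : 0 ≤ G 1)
    (hGW : G (M + 1) ≤ W)
    (hG : ∀ h : ℕ, 0 < h → h ≤ D → ∀ K : ℕ,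
      ‖∑ k ∈ Finset.range K, e (x * h * k)‖ ≤ R + B / h) :
    ‖∑ n ∈ Finset.Ioc 0 M, ((F * G) n : ℂ) * e (x * n)‖ ≤
      2 * P * W * (U * R + B * (1 + Real.log M)) := by
  have hP : 0 ≤ P := (abs_nonneg _).trans (hFP 0 (Nat.zero_le _))
  rcases Nat.eq_zero_or_pos M with rfl | hM
  · have : 0 ≤ 2 * P * W * (U * R + B * (1 + Real.log (0 : ℕ))) := by
      simp only [CharP.cast_eq_zero, Real.log_zero, add_zero]
      positivity
    simpa using this
  rw [sum_Ioc_mul_apply (f := fun n => e (x * n)),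
    ← Finset.sum_subset (Finset.Ioc_subset_Ioc_right hUM) (fun m _ hm => by
      rw [hF m (by
        by_contra h
        exact hm (Finset.mem_Ioc.2 ⟨(Finset.mem_Ioc.1 ‹_›).1, not_lt.1 h⟩))]
      simp)]
  have h1 : ∀ m ∈ Finset.Ioc 0 U, ‖(F m : ℂ) * ∑ k ∈ Finset.Ioc 0 (M / m), (G k : ℂ) *
      e (x * ((m * k : ℕ) : ℝ))‖ ≤ 2 * P * W * (R + B * (m : ℝ)⁻¹) := by
    intro m hm
    rw [Finset.mem_Ioc] at hm
    have h2 := norm_sum_Ioc_monotone_mul_e_le hGm hG1 (hG m hm.1 (hm.2.trans hUD)) (M / m)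
    have h3 : G (M / m + 1) ≤ W :=
      le_trans (hGm (by simp) (by simp) (by simpa using Nat.div_le_self M m)) hGW
    have h4 : ∀ k : ℕ, x * ((m * k : ℕ) : ℝ) = x * m * k := fun k => by push_cast; ring
    simp_rw [h4]
    rw [norm_mul, Complex.norm_real, Real.norm_eq_abs, ← div_eq_mul_inv]
    have h5 : 0 ≤ R + B / m := by positivity
    calc |F m| * _ ≤ P * (2 * W * (R + B / m)) := by
          refine mul_le_mul (hFP m hm.2) (h2.trans ?_) (norm_nonneg _) hP
          gcongr
      _ = _ := by ring
  refine (norm_sum_le _ _).trans ((Finset.sum_le_sum h1).trans ?_)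
  rw [← Finset.mul_sum, Finset.sum_add_distrib, ← Finset.mul_sum, Finset.sum_const, Nat.card_Ioc,
    nsmul_eq_mul, Nat.sub_zero]
  have h6 := sum_Ioc_zero_inv_le U
  have h7 : Real.log U ≤ Real.log M := by
    rcases Nat.eq_zero_or_pos U with rfl | hU
    · simp [Real.log_natCast_nonneg]
    · exact Real.log_le_log (by exact_mod_cast hU) (by exact_mod_cast hUM)
  gcongr
  linarith

lemma log_natCast_add_one_le (hM : 1 ≤ M) : Real.log ((M + 1 : ℕ) : ℝ) ≤ 1 + Real.log M := by
  have hM1 : (1 : ℝ) ≤ M := by exact_mod_cast hM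
  have h1 : Real.log ((M + 1 : ℕ) : ℝ) ≤ Real.log (2 * M) := by
    apply Real.log_le_log (by positivity)
    push_cast
    linarith
  rw [Real.log_mul (by norm_num) (by positivity)] at h1
  have := Real.log_two_lt_d9
  linarith

lemma abs_lowPart_moebius_le (m : ℕ) : |lowPart U (moebius : ArithmeticFunction ℝ) m| ≤ 1 := by
  rw [lowPart_apply]
  split_ifs
  · have := abs_moebius_le_one (n := m)
    rw [intCoe_apply]
    exact_mod_cast this
  · simp

lemma abs_lowPart_moebius_mul_lowPart_vonMangoldt_le (m : ℕ) :
    |(lowPart U (moebius : ArithmeticFunction ℝ) * lowPart U vonMangoldt) m| ≤ Real.log m := by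
  have h := vonMangoldt_mul_zeta
  rw [mul_comm] at h
  rw [← log_apply, ← h, mul_apply, mul_apply]
  refine (Finset.abs_sum_le_sum_abs _ _).trans (Finset.sum_le_sum fun y hy => ?_)
  have h0 := Nat.ne_zero_of_mem_divisorsAntidiagonal hy
  rw [abs_mul, natCoe_apply, zeta_apply_ne h0.1, Nat.cast_one]
  refine mul_le_mul (abs_lowPart_moebius_le _) ?_ (abs_nonneg _) zero_le_one
  rw [lowPart_apply]
  split_ifs
  · rw [abs_of_nonneg vonMangoldt_nonneg]
  · simp

lemma lowPart_mul_lowPart_eq_zero (F G : ArithmeticFunction ℝ) {m : ℕ} (hm : U * U < m) :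
    (lowPart U F * lowPart U G) m = 0 := by
  rw [mul_apply]
  refine Finset.sum_eq_zero fun y hy => ?_
  rw [Nat.mem_divisorsAntidiagonal] at hy
  rw [lowPart_apply, lowPart_apply]
  split_ifs with h1 h2 h2 <;> try simp
  have := Nat.mul_le_mul h1 h2
  omega

end Vaughan

section TypeTwo

open ArithmeticFunction

variable {x B R : ℝ} {D M U : ℕ}

lemma card_divisors_mul_le (u v : ℕ) :
    (u * v).divisors.card ≤ u.divisors.card * v.divisors.card := by
  rw [← Finset.card_product]
  refine (Finset.card_le_card (t := (u.divisors ×ˢ v.divisors).image fun p => p.1 * p.2) ?_).trans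
    Finset.card_image_le
  intro d hd
  rw [Nat.mem_divisors] at hd
  obtain ⟨a, b, ha, hb, hab⟩ := exists_dvd_and_dvd_of_dvd_mul hd.1
  rw [Finset.mem_image]
  refine ⟨(a, b), ?_, hab.symm⟩
  rw [Finset.mem_product, Nat.mem_divisors, Nat.mem_divisors]
  exact ⟨⟨ha, left_ne_zero_of_mul hd.2⟩, hb, right_ne_zero_of_mul hd.2⟩

lemma zeta_mul_zeta_apply (m : ℕ) :
    ((zeta : ArithmeticFunction ℝ) * (zeta : ArithmeticFunction ℝ)) m = m.divisors.card := by
  rw [coe_zeta_mul_apply, Finset.card_eq_sum_ones, Nat.cast_sum]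
  refine Finset.sum_congr rfl fun d hd => ?_
  rw [natCoe_apply, zeta_apply_ne (Nat.pos_of_mem_divisors hd).ne']

lemma sum_Ioc_card_divisors_mul (g : ℕ → ℝ) (N : ℕ) :
    ∑ m ∈ Finset.Ioc 0 N, (m.divisors.card : ℝ) * g m =
      ∑ u ∈ Finset.Ioc 0 N, ∑ v ∈ Finset.Ioc 0 (N / u), g (u * v) := by
  have h := sum_Ioc_mul_apply zeta zeta (fun n => (g n : ℂ)) N
  simp_rw [zeta_mul_zeta_apply] at h
  rw [← Complex.ofReal_inj]
  push_cast
  simp only [Complex.ofReal_natCast] at h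
  rw [h]
  refine Finset.sum_congr rfl fun u hu => ?_
  rw [natCoe_apply, zeta_apply_ne (Finset.mem_Ioc.1 hu).1.ne', Nat.cast_one, Complex.ofReal_one,
    one_mul]
  refine Finset.sum_congr rfl fun v hv => ?_
  rw [natCoe_apply, zeta_apply_ne (Finset.mem_Ioc.1 hv).1.ne', Nat.cast_one, Complex.ofReal_one,
    one_mul]

lemma sum_Ioc_card_divisors_div_le (N : ℕ) :
    ∑ m ∈ Finset.Ioc 0 N, (m.divisors.card : ℝ) * (m : ℝ)⁻¹ ≤ (1 + Real.log N) ^ 2 := by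
  rw [sum_Ioc_card_divisors_mul (fun m => (m : ℝ)⁻¹)]
  have h := sum_Ioc_zero_inv_le N
  calc _ ≤ ∑ u ∈ Finset.Ioc 0 N, ∑ v ∈ Finset.Ioc 0 N, (u : ℝ)⁻¹ * (v : ℝ)⁻¹ := by
        refine Finset.sum_le_sum fun u _ => ?_
        simp_rw [Nat.cast_mul, mul_inv]
        exact Finset.sum_le_sum_of_subset_of_nonneg
          (Finset.Ioc_subset_Ioc_right (Nat.div_le_self _ _)) fun _ _ _ => by positivity
    _ = (∑ u ∈ Finset.Ioc 0 N, (u : ℝ)⁻¹) ^ 2 := by rw [← Finset.sum_mul_sum, sq]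
    _ ≤ _ := by gcongr

lemma sum_Ioc_card_divisors_sq_div_le (N : ℕ) :
    ∑ m ∈ Finset.Ioc 0 N, (m.divisors.card : ℝ) ^ 2 * (m : ℝ)⁻¹ ≤ (1 + Real.log N) ^ 4 := by
  have h1 : ∀ m : ℕ, (m.divisors.card : ℝ) ^ 2 * (m : ℝ)⁻¹ =
      (m.divisors.card : ℝ) * ((m.divisors.card : ℝ) * (m : ℝ)⁻¹) := fun m => by ring
  simp_rw [h1]
  rw [sum_Ioc_card_divisors_mul (fun m => (m.divisors.card : ℝ) * (m : ℝ)⁻¹)]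
  have h := sum_Ioc_card_divisors_div_le N
  calc _ ≤ ∑ u ∈ Finset.Ioc 0 N, ∑ v ∈ Finset.Ioc 0 N, ((u.divisors.card : ℝ) * (u : ℝ)⁻¹) *
          ((v.divisors.card : ℝ) * (v : ℝ)⁻¹) := by
        refine Finset.sum_le_sum fun u _ => (Finset.sum_le_sum fun v _ => ?_).trans
          (Finset.sum_le_sum_of_subset_of_nonneg
          (Finset.Ioc_subset_Ioc_right (Nat.div_le_self N u)) fun _ _ _ => by positivity)
        have : ((u * v).divisors.card : ℝ) ≤ u.divisors.card * v.divisors.card := by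
          exact_mod_cast card_divisors_mul_le u v
        rw [Nat.cast_mul, mul_inv]
        calc _ ≤ (u.divisors.card * v.divisors.card : ℝ) * ((u : ℝ)⁻¹ * (v : ℝ)⁻¹) := by gcongr
          _ = _ := by ring
    _ = (∑ u ∈ Finset.Ioc 0 N, (u.divisors.card : ℝ) * (u : ℝ)⁻¹) ^ 2 := by
        rw [← Finset.sum_mul_sum, sq]
    _ ≤ ((1 + Real.log N) ^ 2) ^ 2 := by gcongr
    _ = _ := by ring

lemma sum_Ioc_natAbs_sub_inv_le {k : ℕ} (hk : k ≤ D) :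
    ∑ j ∈ Finset.Ioc U D, ((((k : ℤ) - j).natAbs : ℕ) : ℝ)⁻¹ ≤ 2 * (1 + Real.log D) := by
  have h := sum_Ioc_zero_inv_le D
  have key : ∀ s : Finset ℕ, Set.InjOn (fun j : ℕ => ((k : ℤ) - j).natAbs) s → s ⊆ Finset.Ioc U D →
      k ∉ s → ∑ j ∈ s, ((((k : ℤ) - j).natAbs : ℕ) : ℝ)⁻¹ ≤ 1 + Real.log D := by
    intro s hs hsD hks
    rw [← Finset.sum_image (f := fun i : ℕ => (i : ℝ)⁻¹) hs]
    refine (Finset.sum_le_sum_of_subset_of_nonneg ?_ fun _ _ _ => by positivity).trans h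
    intro i hi
    obtain ⟨j, hj, rfl⟩ := Finset.mem_image.1 hi
    have h1 := Finset.mem_Ioc.1 (hsD hj)
    have h2 : j ≠ k := fun h => hks (h ▸ hj)
    rw [Finset.mem_Ioc]
    omega
  have h1 := key ((Finset.Ioc U D).filter (· < k)) (fun a ha b hb hab => by
    simp only [Finset.coe_filter, Set.mem_ofPred_eq] at ha hb hab
    omega) (Finset.filter_subset _ _) (by simp)
  have h2 := key ((Finset.Ioc U D).filter (k < ·)) (fun a ha b hb hab => by
    simp only [Finset.coe_filter, Set.mem_ofPred_eq] at ha hb hab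
    omega) (Finset.filter_subset _ _) (by simp)
  have h3 : ∑ j ∈ Finset.Ioc U D, ((((k : ℤ) - j).natAbs : ℕ) : ℝ)⁻¹ =
      ∑ j ∈ (Finset.Ioc U D).filter (· < k), ((((k : ℤ) - j).natAbs : ℕ) : ℝ)⁻¹ +
      ∑ j ∈ (Finset.Ioc U D).filter (k < ·), ((((k : ℤ) - j).natAbs : ℕ) : ℝ)⁻¹ := by
    rw [Finset.sum_filter, Finset.sum_filter, ← Finset.sum_add_distrib]
    refine Finset.sum_congr rfl fun j _ => ?_
    rcases lt_trichotomy j k with h | h | h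
    · simp [h, h.le]
    · simp [h]
    · simp [h, h.le]
  linarith

end TypeTwo

section Bilinear

open ArithmeticFunction

variable {x B R : ℝ} {D M U : ℕ}

lemma norm_sum_range_e_neg (y : ℝ) (K : ℕ) :
    ‖∑ k ∈ Finset.range K, e (-y * k)‖ = ‖∑ k ∈ Finset.range K, e (y * k)‖ := by
  rw [← Complex.norm_conj, map_sum]
  simp_rw [conj_e]
  congr 2
  funext k
  ring_nf

lemma norm_sum_Ioc_natCast_mul_e_le {y G : ℝ}
    (hG : ∀ K : ℕ, ‖∑ k ∈ Finset.range K, e (y * k)‖ ≤ G) (U J : ℕ) :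
    ‖∑ m ∈ Finset.Ioc U J, (m : ℂ) * e (y * m)‖ ≤ 2 * (J + 1) * G := by
  have hG0 : 0 ≤ G := (norm_nonneg _).trans (hG 0)
  rcases le_or_gt J U with h | h
  · rw [Finset.Ioc_eq_empty_of_le h]
    simp only [Finset.sum_empty, norm_zero]
    positivity
  have h1 : ∑ m ∈ Finset.Ioc U J, (m : ℂ) * e (y * m) =
      ∑ k ∈ Finset.range (J - U), (((k + (U + 1) : ℕ) : ℝ) : ℂ) * e (y * k + y * (U + 1)) := by
    have h2 : Finset.Ioc U J = Finset.Ico (U + 1) (J + 1) := by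
      ext
      simp only [Finset.mem_Ioc, Finset.mem_Ico]
      omega
    rw [h2, Finset.sum_Ico_eq_sum_range, Nat.add_sub_add_right]
    refine Finset.sum_congr rfl fun k _ => ?_
    rw [add_comm (U + 1) k, Complex.ofReal_natCast]
    congr 2
    push_cast
    ring
  rw [h1]
  have h3 := norm_sum_range_monotone_mul_le (w := fun k : ℕ => ((k + (U + 1) : ℕ) : ℝ))
    (z := fun k => e (y * k + y * (U + 1))) (n := J - U) (G := G)
    (fun a b hab => by simpa using hab) (by positivity)
    (fun k _ => by rw [norm_sum_range_e_add]; exact hG k)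
  refine h3.trans (le_of_eq ?_)
  have h4 : J - U + (U + 1) = J + 1 := by omega
  simp only [h4]
  push_cast
  ring

/-- The correlation sum arising in the bound for bilinear sums. -/
lemma norm_correlation_le (hDM : D ≤ M) (hR : 0 ≤ R) (hB : 0 ≤ B)
    (hG : ∀ h : ℕ, 0 < h → h ≤ D → ∀ K : ℕ,
      ‖∑ k ∈ Finset.range K, e (x * h * k)‖ ≤ R + B / h)
    {k₁ k₂ : ℕ} (h₁ : k₁ ∈ Finset.Ioc U D) (h₂ : k₂ ∈ Finset.Ioc U D) :
    ‖∑ m ∈ (Finset.Ioc U D).filter (fun m => m * k₁ ≤ M ∧ m * k₂ ≤ M),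
      (m : ℂ) * e (x * ((k₁ : ℝ) - k₂) * m)‖ ≤
      M * (k₁ : ℝ)⁻¹ * (4 * (R + B * ((((k₁ : ℤ) - k₂).natAbs : ℕ) : ℝ)⁻¹) +
        if k₂ = k₁ then (D : ℝ) else 0) := by
  rw [Finset.mem_Ioc] at h₁ h₂
  have hk1 : 0 < k₁ := by omega
  have hk2 : 0 < k₂ := by omega
  have hk1' : (0 : ℝ) < k₁ := by exact_mod_cast hk1
  obtain ⟨J, hJ⟩ : ∃ J, J = min D (min (M / k₁) (M / k₂)) := ⟨_, rfl⟩
  have hset : (Finset.Ioc U D).filter (fun m => m * k₁ ≤ M ∧ m * k₂ ≤ M) = Finset.Ioc U J := by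
    ext m
    rw [Finset.mem_filter, Finset.mem_Ioc, Finset.mem_Ioc, hJ, le_min_iff, le_min_iff,
      Nat.le_div_iff_mul_le hk1, Nat.le_div_iff_mul_le hk2]
    tauto
  have hJ1 : (J : ℝ) ≤ M * (k₁ : ℝ)⁻¹ := by
    rw [← div_eq_mul_inv, le_div_iff₀ hk1']
    have : J * k₁ ≤ M := (Nat.le_div_iff_mul_le hk1).1
      (by rw [hJ]; exact (min_le_right _ _).trans (min_le_left _ _))
    exact_mod_cast this
  have hJD : (J : ℝ) ≤ D := by
    rw [hJ]
    exact_mod_cast min_le_left _ _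
  have hMk : 1 ≤ M * (k₁ : ℝ)⁻¹ := by
    rw [← div_eq_mul_inv, le_div_iff₀ hk1', one_mul]
    exact_mod_cast h₁.2.trans hDM
  rw [hset]
  split_ifs with hk
  · have h3 : ‖∑ m ∈ Finset.Ioc U J, (m : ℂ) * e (x * ((k₁ : ℝ) - k₂) * m)‖ ≤ J * J := by
      refine (norm_sum_le _ _).trans ((Finset.sum_le_card_nsmul _ _ (J : ℝ)
          fun m hm => ?_).trans ?_)
      · rw [norm_mul, norm_e, mul_one, Complex.norm_natCast]
        exact_mod_cast (Finset.mem_Ioc.1 hm).2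
      · rw [nsmul_eq_mul, Nat.card_Ioc]
        gcongr
        exact Nat.sub_le _ _
    refine h3.trans ?_
    have h4 : 0 ≤ 4 * (R + B * ((((k₁ : ℤ) - k₂).natAbs : ℕ) : ℝ)⁻¹) := by positivity
    exact mul_le_mul hJ1 (by linarith) (by positivity) (by positivity)
  · have hd0 : 0 < ((k₁ : ℤ) - k₂).natAbs := by omega
    have hdD : ((k₁ : ℤ) - k₂).natAbs ≤ D := by omega
    have habs : (((((k₁ : ℤ) - k₂).natAbs : ℕ)) : ℝ) = |(k₁ : ℝ) - k₂| := by
      rw [Nat.cast_natAbs]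
      push_cast
      rfl
    have h3 : ∀ K : ℕ, ‖∑ k ∈ Finset.range K, e (x * ((k₁ : ℝ) - k₂) * k)‖ ≤
        R + B * ((((k₁ : ℤ) - k₂).natAbs : ℕ) : ℝ)⁻¹ := by
      intro K
      have := hG _ hd0 hdD K
      rw [div_eq_mul_inv] at this
      refine le_trans (le_of_eq ?_) this
      rw [habs]
      rcases abs_choice ((k₁ : ℝ) - k₂) with h | h <;> rw [h]
      rw [← norm_sum_range_e_neg]
      congr 2
      funext k
      ring_nf
    refine (norm_sum_Ioc_natCast_mul_e_le h3 U J).trans ?_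
    rw [add_zero]
    have h5 : 0 ≤ R + B * ((((k₁ : ℤ) - k₂).natAbs : ℕ) : ℝ)⁻¹ := by positivity
    calc 2 * ((J : ℝ) + 1) * (R + B * ((((k₁ : ℤ) - k₂).natAbs : ℕ) : ℝ)⁻¹)
        ≤ 2 * (M * (k₁ : ℝ)⁻¹ + M * (k₁ : ℝ)⁻¹) *
          (R + B * ((((k₁ : ℤ) - k₂).natAbs : ℕ) : ℝ)⁻¹) := by gcongr
      _ = _ := by ring

/-- The bound for Type II sums. -/
lemma norm_sum_mul_typeII_le {F G : ArithmeticFunction ℝ} {P : ℝ} (hU : 0 < U)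
    (hD : M / U = D) (hR : 1 ≤ R) (hB : 0 ≤ B) (hM : 1 ≤ M)
    (hF : ∀ m ≤ U, F m = 0) (hFd : ∀ m, |F m| ≤ m.divisors.card)
    (hG0 : ∀ m ≤ U, G m = 0) (hGP : ∀ m ≤ M, |G m| ≤ P)
    (hG : ∀ h : ℕ, 0 < h → h ≤ D → ∀ K : ℕ,
      ‖∑ k ∈ Finset.range K, e (x * h * k)‖ ≤ R + B / h) :
    ‖∑ n ∈ Finset.Ioc 0 M, ((F * G) n : ℂ) * e (x * n)‖ ^ 2 ≤
      (1 + Real.log M) ^ 5 * P ^ 2 * M * (5 * D * R + 8 * B * (1 + Real.log M)) := by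
  have hM1 : (1 : ℝ) ≤ M := by exact_mod_cast hM
  have hl0 : 0 ≤ Real.log M := Real.log_nonneg hM1
  have hP : 0 ≤ P := (abs_nonneg _).trans (hGP 0 (Nat.zero_le _))
  have hDM : D ≤ M := hD ▸ Nat.div_le_self _ _
  have hDM' : (D : ℝ) ≤ M := by exact_mod_cast hDM
  have hlog : Real.log D ≤ Real.log M := by
    rcases Nat.eq_zero_or_pos D with h | h
    · rw [h]; simpa using hl0
    · exact Real.log_le_log (by exact_mod_cast h) hDM'
  obtain ⟨S, hS⟩ : ∃ S : ℕ → ℂ, S = fun m =>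
      ∑ k ∈ Finset.Ioc U D, if m * k ≤ M then (G k : ℂ) * e (x * m * k) else 0 := ⟨_, rfl⟩
  have hT : ∑ n ∈ Finset.Ioc 0 M, ((F * G) n : ℂ) * e (x * n) =
      ∑ m ∈ Finset.Ioc U D, (F m : ℂ) * S m := by
    rw [sum_Ioc_mul_apply (f := fun n => e (x * n))]
    symm
    apply Finset.sum_subset_zero_on_sdiff (Finset.Ioc_subset_Ioc (Nat.zero_le _) hDM)
    · intro m hm
      rw [Finset.mem_sdiff, Finset.mem_Ioc, Finset.mem_Ioc] at hm
      rcases le_or_gt m U with h | h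
      · rw [hF m h]; simp
      · rw [Finset.sum_eq_zero, mul_zero]
        intro k hk
        rw [hG0 k, Complex.ofReal_zero, zero_mul]
        rw [Finset.mem_Ioc, Nat.le_div_iff_mul_le hm.1.1] at hk
        by_contra! hk'
        have h1 : ¬ m ≤ M / U := by rw [hD]; tauto
        rw [Nat.le_div_iff_mul_le hU] at h1
        nlinarith
    · intro m hm
      rw [Finset.mem_Ioc] at hm
      have hm0 : 0 < m := by omega
      congr 1
      simp only [hS]
      rw [← Finset.sum_filter]
      apply Finset.sum_subset_zero_on_sdiff
      · intro k hk
        rw [Finset.mem_filter, Finset.mem_Ioc] at hk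
        rw [Finset.mem_Ioc, Nat.le_div_iff_mul_le hm0]
        exact ⟨by omega, by rw [mul_comm]; exact hk.2⟩
      · intro k hk
        rw [Finset.mem_sdiff, Finset.mem_filter, Finset.mem_Ioc, Finset.mem_Ioc,
          Nat.le_div_iff_mul_le hm0] at hk
        rw [hG0 k, Complex.ofReal_zero, zero_mul]
        by_contra! hk'
        apply hk.2
        refine ⟨⟨hk', ?_⟩, by rw [mul_comm]; exact hk.1.2⟩
        rw [← hD, Nat.le_div_iff_mul_le hU]
        nlinarith
      · intro k _
        congr 2
        push_cast
        ring
  have hCS : ‖∑ m ∈ Finset.Ioc U D, (F m : ℂ) * S m‖ ^ 2 ≤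
      (1 + Real.log M) ^ 4 * ∑ m ∈ Finset.Ioc U D, (m : ℝ) * ‖S m‖ ^ 2 := by
    have h1 : ‖∑ m ∈ Finset.Ioc U D, (F m : ℂ) * S m‖ ≤
        ∑ m ∈ Finset.Ioc U D, (|F m| / √m) * (√m * ‖S m‖) := by
      refine (norm_sum_le _ _).trans (Finset.sum_le_sum fun m hm => ?_)
      have hm0 : (0 : ℝ) < m := by
        rw [Finset.mem_Ioc] at hm
        exact_mod_cast (by omega : 0 < m)
      have := Real.sqrt_pos.2 hm0
      rw [norm_mul, Complex.norm_real, Real.norm_eq_abs]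
      apply le_of_eq
      field_simp
    refine (pow_le_pow_left₀ (norm_nonneg _) h1 2).trans
      ((Finset.sum_mul_sq_le_sq_mul_sq _ _ _).trans ?_)
    have h2 : ∑ m ∈ Finset.Ioc U D, (|F m| / √m) ^ 2 ≤ (1 + Real.log M) ^ 4 := by
      refine le_trans ?_ (sum_Ioc_card_divisors_sq_div_le M)
      refine (Finset.sum_le_sum fun m _ => ?_).trans (Finset.sum_le_sum_of_subset_of_nonneg
        (Finset.Ioc_subset_Ioc (Nat.zero_le U) hDM) fun _ _ _ => by positivity)
      rw [div_pow, Real.sq_sqrt (Nat.cast_nonneg m), div_eq_mul_inv]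
      gcongr
      exact hFd m
    have h3 : ∑ m ∈ Finset.Ioc U D, (√m * ‖S m‖) ^ 2 =
        ∑ m ∈ Finset.Ioc U D, (m : ℝ) * ‖S m‖ ^ 2 := by
      refine Finset.sum_congr rfl fun m _ => ?_
      rw [mul_pow, Real.sq_sqrt (Nat.cast_nonneg m)]
    rw [h3]
    gcongr
  have hexp : ((∑ m ∈ Finset.Ioc U D, (m : ℝ) * ‖S m‖ ^ 2 : ℝ) : ℂ) =
      ∑ k₁ ∈ Finset.Ioc U D, ∑ k₂ ∈ Finset.Ioc U D, (G k₁ : ℂ) * (G k₂ : ℂ) *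
        ∑ m ∈ (Finset.Ioc U D).filter (fun m => m * k₁ ≤ M ∧ m * k₂ ≤ M),
          (m : ℂ) * e (x * ((k₁ : ℝ) - k₂) * m) := by
    have h1 : ∀ m : ℕ, (m : ℂ) * ((‖S m‖ ^ 2 : ℝ) : ℂ) = ∑ k₁ ∈ Finset.Ioc U D,
        ∑ k₂ ∈ Finset.Ioc U D, if m * k₁ ≤ M ∧ m * k₂ ≤ M then (G k₁ : ℂ) * (G k₂ : ℂ) *
          ((m : ℂ) * e (x * ((k₁ : ℝ) - k₂) * m)) else 0 := by
      intro m
      rw [← Complex.normSq_eq_norm_sq, ← Complex.mul_conj, hS]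
      simp only [map_sum]
      rw [Finset.sum_mul_sum, Finset.mul_sum]
      refine Finset.sum_congr rfl fun k₁ _ => ?_
      rw [Finset.mul_sum]
      refine Finset.sum_congr rfl fun k₂ _ => ?_
      by_cases h1 : m * k₁ ≤ M <;> by_cases h2 : m * k₂ ≤ M <;> simp only [h1, h2, if_true,
        if_false, and_self, and_true, true_and, _root_.map_zero, mul_zero, zero_mul]
      rw [map_mul, conj_e, Complex.conj_ofReal,
        show x * ((k₁ : ℝ) - k₂) * m = x * m * k₁ + -(x * m * k₂) by ring, e_add]
      ring
    push_cast
    simp_rw [← Complex.ofReal_pow, h1]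
    rw [Finset.sum_comm]
    refine Finset.sum_congr rfl fun k₁ _ => ?_
    rw [Finset.sum_comm]
    refine Finset.sum_congr rfl fun k₂ _ => ?_
    rw [Finset.mul_sum, Finset.sum_filter]
  have hsum : ∑ m ∈ Finset.Ioc U D, (m : ℝ) * ‖S m‖ ^ 2 ≤
      P ^ 2 * (M * (1 + Real.log M) * (5 * D * R + 8 * B * (1 + Real.log M))) := by
    have h0 : 0 ≤ ∑ m ∈ Finset.Ioc U D, (m : ℝ) * ‖S m‖ ^ 2 :=
      Finset.sum_nonneg fun m _ => by positivity
    rw [← abs_of_nonneg h0, ← Real.norm_eq_abs, ← Complex.norm_real, hexp]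
    have h2 : ∀ k₁ ∈ Finset.Ioc U D, ‖∑ k₂ ∈ Finset.Ioc U D, (G k₁ : ℂ) * (G k₂ : ℂ) *
        ∑ m ∈ (Finset.Ioc U D).filter (fun m => m * k₁ ≤ M ∧ m * k₂ ≤ M),
          (m : ℂ) * e (x * ((k₁ : ℝ) - k₂) * m)‖ ≤
        P ^ 2 * M * (5 * D * R + 8 * B * (1 + Real.log M)) * (k₁ : ℝ)⁻¹ := by
      intro k₁ h₁
      have h3 : ∀ k₂ ∈ Finset.Ioc U D, ‖(G k₁ : ℂ) * (G k₂ : ℂ) *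
          ∑ m ∈ (Finset.Ioc U D).filter (fun m => m * k₁ ≤ M ∧ m * k₂ ≤ M),
            (m : ℂ) * e (x * ((k₁ : ℝ) - k₂) * m)‖ ≤
          P ^ 2 * (M * (k₁ : ℝ)⁻¹ * (4 * (R + B * ((((k₁ : ℤ) - k₂).natAbs : ℕ) : ℝ)⁻¹) +
            if k₂ = k₁ then (D : ℝ) else 0)) := by
        intro k₂ h₂
        have h4 := norm_correlation_le hDM (by linarith) hB hG h₁ h₂
        have h5 := hGP k₁ ((Finset.mem_Ioc.1 h₁).2.trans hDM)
        have h6 := hGP k₂ ((Finset.mem_Ioc.1 h₂).2.trans hDM)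
        rw [norm_mul, norm_mul, Complex.norm_real, Complex.norm_real, Real.norm_eq_abs,
          Real.norm_eq_abs, sq]
        gcongr
      refine (norm_sum_le _ _).trans ((Finset.sum_le_sum h3).trans ?_)
      rw [← Finset.mul_sum, ← Finset.mul_sum, Finset.sum_add_distrib, ← Finset.mul_sum,
        Finset.sum_add_distrib, ← Finset.mul_sum, Finset.sum_ite_eq' _ k₁, if_pos h₁,
        Finset.sum_const, nsmul_eq_mul, Nat.card_Ioc]
      have h7 := sum_Ioc_natAbs_sub_inv_le (U := U) (Finset.mem_Ioc.1 h₁).2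
      have h8 : ((D - U : ℕ) : ℝ) ≤ D := by exact_mod_cast Nat.sub_le _ _
      have h9 : 4 * (((D - U : ℕ) : ℝ) * R + B * ∑ j ∈ Finset.Ioc U D,
          ((((k₁ : ℤ) - j).natAbs : ℕ) : ℝ)⁻¹) + D ≤ 5 * D * R + 8 * B * (1 + Real.log M) := by
        have a1 : ((D - U : ℕ) : ℝ) * R ≤ D * R := by gcongr
        have a2 : B * ∑ j ∈ Finset.Ioc U D, ((((k₁ : ℤ) - j).natAbs : ℕ) : ℝ)⁻¹ ≤
            B * (2 * (1 + Real.log M)) := by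
          gcongr
          linarith
        have a3 : (D : ℝ) * 1 ≤ D * R := by gcongr
        linarith
      calc _ ≤ P ^ 2 * (M * (k₁ : ℝ)⁻¹ * (5 * D * R + 8 * B * (1 + Real.log M))) := by gcongr
        _ = _ := by ring
    refine (norm_sum_le _ _).trans ((Finset.sum_le_sum h2).trans ?_)
    rw [← Finset.mul_sum]
    have h10 : ∑ k ∈ Finset.Ioc U D, (k : ℝ)⁻¹ ≤ 1 + Real.log M := by
      refine le_trans ?_ (sum_Ioc_zero_inv_le M)
      exact Finset.sum_le_sum_of_subset_of_nonneg (Finset.Ioc_subset_Ioc (Nat.zero_le U) hDM)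
        fun _ _ _ => by positivity
    calc _ ≤ P ^ 2 * M * (5 * D * R + 8 * B * (1 + Real.log M)) * (1 + Real.log M) := by gcongr
      _ = _ := by ring
  rw [hT]
  refine hCS.trans ?_
  calc _ ≤ (1 + Real.log M) ^ 4 *
        (P ^ 2 * (M * (1 + Real.log M) * (5 * D * R + 8 * B * (1 + Real.log M)))) := by gcongr
    _ = _ := by ring

end Bilinear

section MinorArc

open ArithmeticFunction

variable {x B R : ℝ} {D M U : ℕ}

lemma highPart_moebius_mul_zeta_eq_zero {m : ℕ} (hm : m ≤ U) :
    (highPart U (moebius : ArithmeticFunction ℝ) * (zeta : ArithmeticFunction ℝ)) m = 0 := by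
  rw [coe_mul_zeta_apply]
  refine Finset.sum_eq_zero fun d hd => ?_
  rw [highPart_apply, if_pos ((Nat.divisor_le hd).trans hm)]

lemma abs_highPart_moebius_mul_zeta_le (m : ℕ) :
    |(highPart U (moebius : ArithmeticFunction ℝ) * (zeta : ArithmeticFunction ℝ)) m| ≤
      m.divisors.card := by
  rw [coe_mul_zeta_apply]
  refine (Finset.abs_sum_le_sum_abs _ _).trans
    ((Finset.sum_le_card_nsmul _ _ (1 : ℝ) fun d _ => ?_).trans (by simp))
  rw [highPart_apply]
  split_ifs
  · simp
  · have := abs_moebius_le_one (n := d)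
    rw [intCoe_apply]
    exact_mod_cast this

/-- Vaughan's estimate for `∑ Λ(n) e(xn)`, given bounds for the sums of `e(xhk)` over `k`. -/
lemma norm_sum_vonMangoldt_mul_e_le (hU : 0 < U) (hUD : U * U ≤ D) (hD : M / U = D) (hR : 1 ≤ R)
    (hB : 0 ≤ B)
    (hG : ∀ h : ℕ, 0 < h → h ≤ D → ∀ K : ℕ,
      ‖∑ k ∈ Finset.range K, e (x * h * k)‖ ≤ R + B / h) :
    ‖∑ n ∈ Finset.Ioc 0 M, (vonMangoldt n : ℂ) * e (x * n)‖ ≤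
      5 * (1 + Real.log M) * (D * R + B * (1 + Real.log M)) +
        √((1 + Real.log M) ^ 7 * M * (5 * D * R + 8 * B * (1 + Real.log M))) := by
  have hDM : D ≤ M := hD ▸ Nat.div_le_self _ _
  have hUU : U ≤ U * U := Nat.le_mul_of_pos_left U hU
  have hUD' : U ≤ D := hUU.trans hUD
  have hM : 1 ≤ M := by omega
  have hM1 : (1 : ℝ) ≤ M := by exact_mod_cast hM
  have hl0 : 0 ≤ Real.log M := Real.log_nonneg hM1
  have hlogM : ∀ m : ℕ, m ≤ M → Real.log m ≤ 1 + Real.log M := by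
    intro m hm
    rcases Nat.eq_zero_or_pos m with h | h
    · rw [h]; simp; linarith
    · have := Real.log_le_log (by exact_mod_cast h : (0 : ℝ) < m)
        (by exact_mod_cast hm : (m : ℝ) ≤ M)
      linarith
  have h1 : ‖∑ n ∈ Finset.Ioc 0 M, (lowPart U vonMangoldt n : ℂ) * e (x * n)‖ ≤
      U * (1 + Real.log M) := by
    rw [← Finset.sum_subset (Finset.Ioc_subset_Ioc_right (hUD'.trans hDM)) (fun m hm hm' => by
      rw [lowPart_apply, if_neg (fun h => hm' (Finset.mem_Ioc.2 ⟨(Finset.mem_Ioc.1 hm).1, h⟩))]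
      simp)]
    refine (norm_sum_le _ _).trans
      ((Finset.sum_le_card_nsmul _ _ (1 + Real.log M) fun m hm => ?_).trans
        (le_of_eq (by rw [nsmul_eq_mul, Nat.card_Ioc, Nat.sub_zero])))
    rw [norm_mul, norm_e, mul_one, Complex.norm_real, lowPart_apply,
      if_pos (Finset.mem_Ioc.1 hm).2, Real.norm_eq_abs, abs_of_nonneg vonMangoldt_nonneg]
    exact vonMangoldt_le_log.trans (hlogM m ((Finset.mem_Ioc.1 hm).2.trans (hUD'.trans hDM)))
  have h2 := norm_sum_mul_typeI_le (F := lowPart U (moebius : ArithmeticFunction ℝ))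
    (G := ArithmeticFunction.log) (P := 1) (W := 1 + Real.log M) (hUD'.trans hDM) hUD'
    (by linarith) hB (by linarith) (fun m hm => by rw [lowPart_apply, if_neg (by omega)])
    (fun m _ => abs_lowPart_moebius_le m)
    (fun a ha b hb hab => by
      rw [log_apply, log_apply]
      have : (0 : ℝ) < a := by exact_mod_cast (Set.mem_Ici.1 ha)
      gcongr) (by simp) (by rw [log_apply]; exact log_natCast_add_one_le hM) hG
  have h3 := norm_sum_mul_typeI_le
    (F := lowPart U (moebius : ArithmeticFunction ℝ) * lowPart U vonMangoldt)
    (G := (zeta : ArithmeticFunction ℝ)) (P := 1 + Real.log M) (W := 1) (hUD.trans hDM) hUD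
    (by linarith) hB (by linarith) (fun m hm => lowPart_mul_lowPart_eq_zero _ _ hm)
    (fun m hm => (abs_lowPart_moebius_mul_lowPart_vonMangoldt_le m).trans
      (hlogM m (hm.trans (hUD.trans hDM))))
    (fun a ha b hb _ => by
      rw [Set.mem_Ici] at ha hb
      rw [natCoe_apply, natCoe_apply, zeta_apply_ne (by omega), zeta_apply_ne (by omega)])
    (by simp) (by simp) hG
  have h4 := norm_sum_mul_typeII_le
    (F := highPart U (moebius : ArithmeticFunction ℝ) * (zeta : ArithmeticFunction ℝ))
    (G := highPart U vonMangoldt) (P := 1 + Real.log M) hU hD hR hB hM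
    (fun m hm => highPart_moebius_mul_zeta_eq_zero hm) abs_highPart_moebius_mul_zeta_le
    (fun m hm => by rw [highPart_apply, if_pos hm])
    (fun m hm => by
      rw [highPart_apply]
      split_ifs
      · simp; linarith
      · rw [abs_of_nonneg vonMangoldt_nonneg]
        exact vonMangoldt_le_log.trans (hlogM m hm)) hG
  have h4' := Real.le_sqrt_of_sq_le h4
  have hsplit : ∑ n ∈ Finset.Ioc 0 M, (vonMangoldt n : ℂ) * e (x * n) =
      ∑ n ∈ Finset.Ioc 0 M, (lowPart U vonMangoldt n : ℂ) * e (x * n) +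
      ∑ n ∈ Finset.Ioc 0 M, ((lowPart U (moebius : ArithmeticFunction ℝ) *
        ArithmeticFunction.log) n : ℂ) * e (x * n) -
      ∑ n ∈ Finset.Ioc 0 M, ((lowPart U (moebius : ArithmeticFunction ℝ) *
        lowPart U vonMangoldt * (zeta : ArithmeticFunction ℝ)) n : ℂ) * e (x * n) +
      ∑ n ∈ Finset.Ioc 0 M, ((highPart U (moebius : ArithmeticFunction ℝ) *
        (zeta : ArithmeticFunction ℝ) * highPart U vonMangoldt) n : ℂ) * e (x * n) := by
    rw [← Finset.sum_add_distrib, ← Finset.sum_sub_distrib, ← Finset.sum_add_distrib]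
    refine Finset.sum_congr rfl fun n _ => ?_
    conv_lhs => rw [vonMangoldt_eq_vaughan U]
    rw [ArithmeticFunction.add_apply, sub_eq_add_neg, ArithmeticFunction.add_apply,
      ArithmeticFunction.neg_apply, ArithmeticFunction.add_apply]
    push_cast
    ring
  rw [hsplit]
  refine (norm_add_le _ _).trans (add_le_add ((norm_sub_le _ _).trans
    ((add_le_add ((norm_add_le _ _).trans (add_le_add h1 h2)) h3).trans ?_)) (h4'.trans ?_))
  · have a1 : (U : ℝ) ≤ D := by exact_mod_cast hUD'
    have a2 : ((U * U : ℕ) : ℝ) ≤ D := by exact_mod_cast hUD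
    have a3 : (U : ℝ) ≤ D * R := by nlinarith
    have a4 : (U : ℝ) * R ≤ D * R := by gcongr
    have a5 : ((U * U : ℕ) : ℝ) * R ≤ D * R := by gcongr
    have a6 : 0 ≤ B * (1 + Real.log M) := by positivity
    have hl : 0 ≤ 1 + Real.log M := by linarith
    have b1 := mul_le_mul_of_nonneg_left (a3.trans (le_add_of_nonneg_right a6)) hl
    have b2 := mul_le_mul_of_nonneg_left (add_le_add_left a4 (B * (1 + Real.log M))) hl
    have b3 := mul_le_mul_of_nonneg_left (add_le_add_left a5 (B * (1 + Real.log M))) hl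
    linarith
  · apply Real.sqrt_le_sqrt
    apply le_of_eq
    ring

/-- The distance of `2αh` from the integers when `α` is close to a rational number. -/
lemma norm_sum_range_e_near_rat_le {q h : ℕ} (a : ℤ) {β : ℝ} (hq : 0 < q) (hh : 0 < h)
    (hβ : β ≠ 0) (hqh : 4 * q * |β| * h ≤ 1) (K : ℕ) :
    ‖∑ k ∈ Finset.range K, e (2 * (a / q + β) * h * k)‖ ≤ q + 1 / (4 * |β|) / h := by
  have hq0 : (0 : ℝ) < q := by exact_mod_cast hq
  have hh0 : (0 : ℝ) < h := by exact_mod_cast hh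
  have hβ0 : 0 < |β| := abs_pos.2 hβ
  have h1 : ∀ z : ℤ, min (1 / (2 * (q : ℝ))) (2 * |β| * h) ≤ |2 * (a / q + β) * h - z| := by
    intro z
    obtain ⟨t, ht⟩ : ∃ t : ℤ, t = 2 * a * h - z * q := ⟨_, rfl⟩
    have h2 : 2 * (a / q + β) * h - z = t / q + 2 * β * h := by
      rw [ht]
      push_cast
      field_simp
      ring
    have h3 : |2 * β * h| = 2 * |β| * h := by
      rw [abs_mul, abs_mul, abs_two, abs_of_pos hh0]
    rw [h2]
    rcases eq_or_ne t 0 with h0 | h0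
    · rw [h0, Int.cast_zero, zero_div, zero_add, h3]
      exact min_le_right _ _
    · refine (min_le_left _ _).trans ?_
      have h4 : 1 / (q : ℝ) ≤ |(t : ℝ) / q| := by
        rw [abs_div, abs_of_pos hq0]
        gcongr
        exact_mod_cast Int.one_le_abs h0
      have h5 := abs_sub_abs_le_abs_sub ((t : ℝ) / q) (-(2 * β * h))
      rw [abs_neg, h3, sub_neg_eq_add] at h5
      have h6 : 2 * |β| * h ≤ 1 / (2 * q) := by
        rw [le_div_iff₀ (by positivity)]
        linarith
      have h7 : 1 / (q : ℝ) = 1 / (2 * q) + 1 / (2 * q) := by field_simp; norm_num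
      linarith
  have h8 : 0 < min (1 / (2 * (q : ℝ))) (2 * |β| * h) := lt_min (by positivity) (by positivity)
  refine (norm_sum_range_e_le h8 h1 K).trans ?_
  rcases min_choice (1 / (2 * (q : ℝ))) (2 * |β| * h) with h9 | h9 <;> rw [h9]
  · have : 0 ≤ 1 / (4 * |β|) / h := by positivity
    have h10 : 1 / (2 * (1 / (2 * (q : ℝ)))) = q := by field_simp
    linarith
  · have h10 : 1 / (2 * (2 * |β| * h)) = 1 / (4 * |β|) / h := by
      field_simp
      norm_num
    linarith

end MinorArc

section LargeShift

open ArithmeticFunction Filter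

lemma vaughan_bound_le {l W A X Y M : ℝ} (hl : 1 ≤ l) (hW : 0 ≤ W) (hX : X ≤ W)
    (hY0 : 0 ≤ Y) (hY : Y ≤ W) (hM0 : 0 ≤ M) (hM : M ≤ A) (hX0 : 0 ≤ X) :
    5 * l * (X + Y * l) + √(l ^ 7 * M * (5 * X + 8 * Y * l)) ≤ 10 * l ^ 2 * W +
      4 * l ^ 4 * √(A * W) := by
  have hl0 : 0 ≤ l := by linarith
  have hA : 0 ≤ A := hM0.trans hM
  have h1 : X + Y * l ≤ 2 * (W * l) := by nlinarith
  have h2 : 5 * X + 8 * Y * l ≤ 13 * (W * l) := by nlinarith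
  have h3 : √(l ^ 7 * M * (5 * X + 8 * Y * l)) ≤ 4 * l ^ 4 * √(A * W) := by
    have h4 : √((4 * l ^ 4) ^ 2 * (A * W)) = 4 * l ^ 4 * √(A * W) := by
      rw [Real.sqrt_mul (by positivity), Real.sqrt_sq (by positivity)]
    rw [← h4]
    apply Real.sqrt_le_sqrt
    calc l ^ 7 * M * (5 * X + 8 * Y * l) ≤ l ^ 7 * A * (13 * (W * l)) := by gcongr
      _ = 13 * (l ^ 8 * (A * W)) := by ring
      _ ≤ 16 * (l ^ 8 * (A * W)) := by gcongr; norm_num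
      _ = _ := by ring
  have h5 : 5 * l * (X + Y * l) ≤ 5 * l * (2 * (W * l)) := by gcongr
  linarith

set_option maxHeartbeats 800000 in
/-- The sum of `Λ(n) e(2αn)` when `α` is at an intermediate distance from a rational number with
small denominator. -/
lemma eventually_norm_sum_vonMangoldt_mul_e_le {lam δ : ℝ} (hlam : 0 < lam) (hδ0 : 0 < δ)
    (hδ1 : δ ≤ 1) : ∀ᶠ L : ℝ in atTop, ∀ A : ℝ, Real.exp (3 * L ^ 2 / 4) ≤ A →
      A ≤ Real.exp (L ^ 2) → ∀ (q : ℕ) (a : ℤ) (β : ℝ), 0 < q → (q : ℝ) ≤ L ^ (2 * lam) →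
      Real.exp (δ * L) ≤ A * |β| → A * |β| ≤ L ^ (2 * lam) * Real.exp L →
      ‖∑ n ∈ Finset.Ioc 0 ⌊A⌋₊, (vonMangoldt n : ℂ) * e (2 * (a / q + β) * n)‖ ≤
        A * Real.exp (-(δ / 4 * L)) := by
  filter_upwards [eventually_ge_atTop (8 : ℝ),
    eventually_mul_rpow_le_exp 8 (4 * lam) (zero_lt_one' ℝ),
    eventually_mul_pow_le_exp 224 8 (show 0 < δ / 4 by linarith)] with L hL hL1 hL2 A hA1 hA2
      q a β hq hqP hβ1 hβ2
  have hL0 : 0 < L := by linarith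
  obtain ⟨P, hP⟩ : ∃ P, P = L ^ (2 * lam) := ⟨_, rfl⟩
  have hP1 : 1 ≤ P := hP ▸ Real.one_le_rpow (by linarith) (by linarith)
  have hPP : L ^ (4 * lam) = P * P := by
    rw [hP, ← Real.rpow_add hL0]
    congr 1
    ring
  rw [← hP] at hqP hβ2
  rw [hPP, one_mul] at hL1
  obtain ⟨E, hE⟩ : ∃ E, E = Real.exp (L ^ 2 / 4) := ⟨_, rfl⟩
  have hE1 : 1 ≤ E := hE ▸ Real.one_le_exp (by positivity)
  have hE3 : E ^ 3 = Real.exp (3 * L ^ 2 / 4) := by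
    rw [hE, ← Real.exp_nat_mul]
    congr 1
    push_cast
    ring
  have hPE : 8 * (P * P) * Real.exp L ≤ E := by
    calc 8 * (P * P) * Real.exp L ≤ Real.exp L * Real.exp L := by gcongr
      _ = Real.exp (L + L) := (Real.exp_add _ _).symm
      _ ≤ E := by rw [hE]; apply Real.exp_le_exp.2; nlinarith
  have hA0 : 0 < A := (Real.exp_pos _).trans_le hA1
  have hA1' : 1 ≤ A := (Real.one_le_exp (by positivity)).trans hA1
  have hβ0 : 0 < |β| := by
    by_contra h
    have h0 : |β| = 0 := le_antisymm (not_lt.1 h) (abs_nonneg _)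
    rw [h0, mul_zero] at hβ1
    exact absurd hβ1 (not_le.2 (Real.exp_pos _))
  obtain ⟨U, hU⟩ : ∃ U, U = ⌊E⌋₊ := ⟨_, rfl⟩
  obtain ⟨M, hM⟩ : ∃ M, M = ⌊A⌋₊ := ⟨_, rfl⟩
  have hU0 : 0 < U := hU ▸ Nat.floor_pos.2 hE1
  have hM0 : 0 < M := hM ▸ Nat.floor_pos.2 hA1'
  have hUE : (U : ℝ) ≤ E := hU ▸ Nat.floor_le (by linarith)
  have hEU : E ≤ 2 * U := by
    have h1 : E < U + 1 := hU ▸ Nat.lt_floor_add_one E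
    have h2 : (1 : ℝ) ≤ U := by exact_mod_cast hU0
    linarith
  have hMA : (M : ℝ) ≤ A := hM ▸ Nat.floor_le hA0.le
  have hUD : U * U ≤ M / U := by
    rw [Nat.le_div_iff_mul_le hU0, hM]
    apply Nat.le_floor
    push_cast
    calc (U : ℝ) * U * U ≤ E * E * E := by gcongr
      _ = E ^ 3 := by ring
      _ ≤ A := hE3 ▸ hA1
  have hU0' : (0 : ℝ) < U := by exact_mod_cast hU0
  have hDA : ((M / U : ℕ) : ℝ) * E ≤ 2 * A := by
    have h1 : ((M / U : ℕ) : ℝ) ≤ M / U := Nat.cast_div_le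
    rw [le_div_iff₀ hU0'] at h1
    have h2 : ((M / U : ℕ) : ℝ) * E ≤ ((M / U : ℕ) : ℝ) * (2 * U) := by gcongr
    linarith
  obtain ⟨D, hD⟩ : ∃ D, D = M / U := ⟨_, rfl⟩
  rw [← hD] at hUD hDA
  have hq1 : (1 : ℝ) ≤ q := by exact_mod_cast hq
  have hE0 : 0 < E := by linarith
  have hexpδ : Real.exp (δ * L) ≤ Real.exp L := Real.exp_le_exp.2 (by nlinarith)
  have hG : ∀ h : ℕ, 0 < h → h ≤ D → ∀ K : ℕ,
      ‖∑ k ∈ Finset.range K, e (2 * (a / q + β) * h * k)‖ ≤ q + 1 / (4 * |β|) / h := by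
    intro h hh hhD K
    refine norm_sum_range_e_near_rat_le a hq hh (abs_pos.1 hβ0) ?_ K
    have h1 : (h : ℝ) ≤ D := by exact_mod_cast hhD
    refine le_of_mul_le_mul_right ?_ hE0
    calc 4 * q * |β| * h * E ≤ 4 * P * |β| * D * E := by gcongr
      _ = 4 * P * |β| * (D * E) := by ring
      _ ≤ 4 * P * |β| * (2 * A) := by gcongr
      _ = 8 * P * (A * |β|) := by ring
      _ ≤ 8 * P * (P * Real.exp L) := by gcongr
      _ = 8 * (P * P) * Real.exp L := by ring
      _ ≤ 1 * E := by rw [one_mul]; exact hPE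
  obtain ⟨W, hW⟩ : ∃ W, W = A * Real.exp (-(δ * L)) := ⟨_, rfl⟩
  have hWe : W * Real.exp (δ * L) = A := by
    rw [hW, mul_assoc, ← Real.exp_add, neg_add_cancel, Real.exp_zero, mul_one]
  have hDq : (D : ℝ) * q ≤ W := by
    refine le_of_mul_le_mul_right ?_ (Real.exp_pos (δ * L))
    rw [hWe]
    refine le_of_mul_le_mul_right ?_ hE0
    calc (D : ℝ) * q * Real.exp (δ * L) * E ≤ D * P * Real.exp L * E := by gcongr
      _ = P * Real.exp L * (D * E) := by ring
      _ ≤ P * Real.exp L * (2 * A) := by gcongr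
      _ = 2 * (P * 1) * Real.exp L * A := by ring
      _ ≤ 8 * (P * P) * Real.exp L * A := by gcongr; norm_num
      _ ≤ E * A := by gcongr
      _ = A * E := mul_comm _ _
  have hBW : 1 / (4 * |β|) ≤ W := by
    rw [div_le_iff₀ (by positivity)]
    refine le_of_mul_le_mul_right ?_ (Real.exp_pos (δ * L))
    calc 1 * Real.exp (δ * L) ≤ A * |β| := by rw [one_mul]; exact hβ1
      _ ≤ 4 * (A * |β|) := by linarith [mul_pos hA0 hβ0]
      _ = W * (4 * |β|) * Real.exp (δ * L) := by rw [← hWe]; ring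
  have hM1 : (1 : ℝ) ≤ M := by exact_mod_cast hM0
  have hlog0 : 0 ≤ Real.log M := Real.log_nonneg hM1
  have hlogM : 1 + Real.log M ≤ 2 * L ^ 2 := by
    have h1 : Real.log M ≤ L ^ 2 := by
      rw [← Real.log_exp (L ^ 2)]
      exact Real.log_le_log (by linarith) (hMA.trans hA2)
    have h2 : 1 ≤ L ^ 2 := one_le_pow₀ (by linarith)
    linarith
  have hAW : √(A * W) = A * Real.exp (-(δ / 2 * L)) := by
    rw [← Real.sqrt_sq (show 0 ≤ A * Real.exp (-(δ / 2 * L)) by positivity)]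
    congr 1
    rw [hW, mul_pow, ← Real.exp_nat_mul]
    have : ((2 : ℕ) : ℝ) * -(δ / 2 * L) = -(δ * L) := by push_cast; ring
    rw [this]
    ring
  have hW0 : 0 ≤ W := by rw [hW]; positivity
  have hWle : W ≤ A * Real.exp (-(δ / 2 * L)) := by
    rw [hW]
    gcongr
    linarith
  rw [← hM]
  have main := norm_sum_vonMangoldt_mul_e_le hU0 hUD hD.symm hq1
    (show 0 ≤ 1 / (4 * |β|) by positivity) hG
  rw [show 5 * (D : ℝ) * q + 8 * (1 / (4 * |β|)) * (1 + Real.log M) =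
    5 * (D * q) + 8 * (1 / (4 * |β|)) * (1 + Real.log M) by ring] at main
  refine (main.trans (vaughan_bound_le (by linarith) hW0 hDq (by positivity) hBW (by linarith)
    hMA (by positivity))).trans ?_
  rw [hAW]
  have hl24 : (1 + Real.log M) ^ 2 ≤ (1 + Real.log M) ^ 4 :=
    pow_le_pow_right₀ (by linarith) (by norm_num)
  calc 10 * (1 + Real.log M) ^ 2 * W + 4 * (1 + Real.log M) ^ 4 * (A * Real.exp (-(δ / 2 * L)))
      ≤ 10 * (1 + Real.log M) ^ 4 * (A * Real.exp (-(δ / 2 * L))) +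
        4 * (1 + Real.log M) ^ 4 * (A * Real.exp (-(δ / 2 * L))) := by gcongr
    _ = 14 * (1 + Real.log M) ^ 4 * (A * Real.exp (-(δ / 2 * L))) := by ring
    _ ≤ 14 * (2 * L ^ 2) ^ 4 * (A * Real.exp (-(δ / 2 * L))) := by gcongr
    _ = 224 * L ^ 8 * (A * Real.exp (-(δ / 2 * L))) := by ring
    _ ≤ Real.exp (δ / 4 * L) * (A * Real.exp (-(δ / 2 * L))) := by gcongr
    _ = A * (Real.exp (δ / 4 * L) * Real.exp (-(δ / 2 * L))) := by ring
    _ = A * Real.exp (-(δ / 4 * L)) := by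
      rw [← Real.exp_add]
      congr 2
      ring

end LargeShift

section MajorArc

open ArithmeticFunction

variable {q : ℕ}

lemma e_add_natCast (x : ℝ) (n : ℕ) : e (x + n) = e x := by
  rw [e_add, ← Int.cast_natCast, e_intCast, mul_one]

lemma e_mul_div_eq_of_modEq [NeZero q] (a : ℕ) {k n : ℕ} (h : k ≡ n [MOD q]) :
    e (2 * a * k / q) = e (2 * a * n / q) := by
  have hq : (q : ℝ) ≠ 0 := Nat.cast_ne_zero.2 (NeZero.ne q)
  have key : ∀ m : ℕ, e (2 * a * m / q) = e (2 * a * (m % q : ℕ) / q) := by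
    intro m
    have h1 : (2 * a * m / q : ℝ) = 2 * a * (m % q : ℕ) / q + (2 * a * (m / q) : ℕ) := by
      conv_lhs => rw [← Nat.mod_add_div m q]
      push_cast
      field_simp
    rw [h1, e_add_natCast]
  rw [key k, key n, h]

lemma card_filter_gcd_eq_one (q : ℕ) :
    ((Finset.Icc 1 q).filter (fun a => Nat.gcd a q = 1)).card = q.totient := by
  rw [← Nat.filter_coprime_Ico_eq_totient q 1]
  congr 1
  ext k
  simp only [Finset.mem_filter, Finset.mem_Icc, Finset.mem_Ico, Nat.coprime_iff_gcd_eq_one,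
    Nat.gcd_comm k q]
  omega

lemma norm_ramanujanC_le (q : ℕ) (m : ℤ) : ‖ramanujanC q m‖ ≤ q.totient := by
  rw [← card_filter_gcd_eq_one q]
  exact (norm_sum_le _ _).trans ((Finset.sum_le_card_nsmul _ _ 1 fun k _ => (norm_e _).le).trans
    (by simp))

/-- The Gauss sum `∑ χ̄(k) e(2ak/q)`. -/
noncomputable def gaussCoeff (a : ℕ) (χ : DirichletCharacter ℂ q) : ℂ :=
  ∑ k ∈ (Finset.Icc 1 q).filter (fun k => Nat.gcd k q = 1),
    χ (k : ZMod q)⁻¹ * e (2 * a * k / q)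

lemma norm_gaussCoeff_le (a : ℕ) (χ : DirichletCharacter ℂ q) :
    ‖gaussCoeff a χ‖ ≤ q.totient := by
  rw [← card_filter_gcd_eq_one q]
  refine (norm_sum_le _ _).trans ((Finset.sum_le_card_nsmul _ _ 1 fun k _ => ?_).trans (by simp))
  rw [norm_mul, norm_e, mul_one]
  exact χ.norm_le_one _

lemma gaussCoeff_one (a : ℕ) :
    gaussCoeff a (1 : DirichletCharacter ℂ q) = ramanujanC q (2 * (a : ℤ)) := by
  refine Finset.sum_congr rfl fun k hk => ?_
  have hu : IsUnit (k : ZMod q) := (ZMod.isUnit_iff_coprime k q).2 (Finset.mem_filter.1 hk).2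
  have hu' : IsUnit (k : ZMod q)⁻¹ := by
    obtain ⟨u, hu⟩ := hu
    rw [← hu, ZMod.inv_coe_unit]
    exact Units.isUnit _
  rw [MulChar.one_apply hu', one_mul]
  push_cast
  rfl

lemma sum_gaussCoeff_mul [NeZero q] (a : ℕ) {n : ℕ} (hn : 0 < n) :
    ∑ χ : DirichletCharacter ℂ q, gaussCoeff a χ * χ n =
      if Nat.gcd n q = 1 then q.totient * e (2 * a * n / q) else 0 := by
  have h1 : ∑ χ : DirichletCharacter ℂ q, gaussCoeff a χ * χ n =
      ∑ k ∈ (Finset.Icc 1 q).filter (fun k => Nat.gcd k q = 1),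
        (if (k : ZMod q) = n then (q.totient : ℂ) else 0) * e (2 * a * k / q) := by
    simp_rw [gaussCoeff, Finset.sum_mul]
    rw [Finset.sum_comm]
    refine Finset.sum_congr rfl fun k hk => ?_
    have hu : IsUnit (k : ZMod q) := (ZMod.isUnit_iff_coprime k q).2 (Finset.mem_filter.1 hk).2
    rw [← DirichletCharacter.sum_char_inv_mul_char_eq ℂ hu, Finset.sum_mul]
    exact Finset.sum_congr rfl fun χ _ => by ring
  rw [h1]
  split_ifs with h
  · obtain ⟨k, hk⟩ : ∃ k, k = (n - 1) % q + 1 := ⟨_, rfl⟩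
    have hq : 0 < q := Nat.pos_of_ne_zero (NeZero.ne q)
    have hkq : k ≤ q := hk ▸ Nat.mod_lt _ hq
    have hkn : k ≡ n [MOD q] := by
      have h2 := (Nat.mod_modEq (n - 1) q).add_right 1
      rwa [Nat.sub_add_cancel hn, ← hk] at h2
    rw [Finset.sum_eq_single_of_mem k]
    · rw [if_pos ((ZMod.natCast_eq_natCast_iff _ _ _).2 hkn), e_mul_div_eq_of_modEq a hkn]
    · rw [Finset.mem_filter, Finset.mem_Icc]
      exact ⟨⟨by omega, hkq⟩, hkn.gcd_eq.trans h⟩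
    · intro m hm hmk
      rw [Finset.mem_filter, Finset.mem_Icc] at hm
      rw [if_neg, zero_mul]
      intro hmn
      have h3 : m ≡ k [MOD q] := ((ZMod.natCast_eq_natCast_iff _ _ _).1 hmn).trans hkn.symm
      refine hmk (h3.eq_of_abs_lt ?_)
      rw [abs_lt]
      constructor <;> omega
  · refine Finset.sum_eq_zero fun k hk => ?_
    rw [if_neg, zero_mul]
    intro hkn
    have h3 := ((ZMod.natCast_eq_natCast_iff _ _ _).1 hkn).gcd_eq
    exact h (h3.symm.trans (Finset.mem_filter.1 hk).2)

lemma primeErr_level_one_sub [NeZero q] (n : ℕ) :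
    primeErr (1 : DirichletCharacter ℂ 1) n - primeErr (1 : DirichletCharacter ℂ q) n =
      ((if Nat.gcd n q = 1 then 0 else vonMangoldt n : ℝ) : ℂ) := by
  have h1 : (1 : DirichletCharacter ℂ 1) n = 1 :=
    MulChar.one_apply (isUnit_of_subsingleton _)
  simp only [primeErr, twistVM, if_true, h1, one_mul]
  split_ifs with h
  · rw [MulChar.one_apply ((ZMod.isUnit_iff_coprime n q).2 h)]
    simp
  · rw [MulChar.map_nonunit _ (fun hu => h ((ZMod.isUnit_iff_coprime n q).1 hu))]
    simp

lemma vonMangoldt_mul_e_sub_eq [NeZero q] (a : ℕ) {n : ℕ} (hn : 0 < n) :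
    (vonMangoldt n : ℂ) * e (2 * a * n / q) - ramanujanC q (2 * (a : ℤ)) / q.totient =
      (1 / q.totient) * ∑ χ : DirichletCharacter ℂ q, gaussCoeff a χ * primeErr χ n +
        ((if Nat.gcd n q = 1 then 0 else vonMangoldt n : ℝ) : ℂ) * e (2 * a * n / q) := by
  have hφ : (q.totient : ℂ) ≠ 0 :=
    Nat.cast_ne_zero.2 (Nat.totient_pos.2 (Nat.pos_of_ne_zero (NeZero.ne q))).ne'
  have h1 : ∑ χ : DirichletCharacter ℂ q, gaussCoeff a χ * primeErr χ n =
      (if Nat.gcd n q = 1 then q.totient * e (2 * a * n / q) else 0) * vonMangoldt n -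
        ramanujanC q (2 * (a : ℤ)) := by
    rw [← sum_gaussCoeff_mul a hn, ← gaussCoeff_one a, Finset.sum_mul]
    simp_rw [primeErr, twistVM, mul_sub, Finset.sum_sub_distrib, mul_ite, mul_one, mul_zero]
    rw [Finset.sum_ite_eq' Finset.univ (1 : DirichletCharacter ℂ q), if_pos (Finset.mem_univ _)]
    simp_rw [mul_assoc]
  rw [h1]
  split_ifs with h
  · rw [Complex.ofReal_zero]
    field_simp
    ring
  · ring

lemma norm_sum_vonMangoldt_mul_e_sub_le [NeZero q] (a : ℕ) {m : ℕ} {V : ℝ}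
    (h1 : ‖∑ n ∈ Finset.Icc 1 m, primeErr (1 : DirichletCharacter ℂ 1) n‖ ≤ V)
    (hV : ∀ χ : DirichletCharacter ℂ q, ‖∑ n ∈ Finset.Icc 1 m, primeErr χ n‖ ≤ V) :
    ‖∑ n ∈ Finset.Icc 1 m, ((vonMangoldt n : ℂ) * e (2 * a * n / q) -
      ramanujanC q (2 * (a : ℤ)) / q.totient)‖ ≤ (q + 2) * V := by
  have hφ0 : 0 < q.totient := Nat.totient_pos.2 (Nat.pos_of_ne_zero (NeZero.ne q))
  have hφ : (0 : ℝ) < q.totient := by exact_mod_cast hφ0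
  have hV0 : 0 ≤ V := (norm_nonneg _).trans h1
  have hcard : (Fintype.card (DirichletCharacter ℂ q) : ℝ) = q.totient := by
    rw [← Nat.card_eq_fintype_card, DirichletCharacter.card_eq_totient_of_hasEnoughRootsOfUnity]
  rw [Finset.sum_congr rfl fun n hn =>
    vonMangoldt_mul_e_sub_eq a (Finset.mem_Icc.1 hn).1, Finset.sum_add_distrib, ← Finset.mul_sum,
    Finset.sum_comm]
  have h2 : ‖∑ χ : DirichletCharacter ℂ q, ∑ n ∈ Finset.Icc 1 m,
      gaussCoeff a χ * primeErr χ n‖ ≤ q.totient * (q.totient * V) := by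
    refine (norm_sum_le _ _).trans ((Finset.sum_le_card_nsmul _ _ (q.totient * V)
      fun χ _ => ?_).trans (le_of_eq ?_))
    · rw [← Finset.mul_sum, norm_mul]
      exact mul_le_mul (norm_gaussCoeff_le a χ) (hV χ) (norm_nonneg _) hφ.le
    · rw [Finset.card_univ, nsmul_eq_mul, hcard]
  have h3 : ‖(1 / (q.totient : ℂ)) * ∑ χ : DirichletCharacter ℂ q, ∑ n ∈ Finset.Icc 1 m,
      gaussCoeff a χ * primeErr χ n‖ ≤ q * V := by
    rw [norm_mul, norm_div, norm_one, Complex.norm_natCast]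
    calc 1 / (q.totient : ℝ) * _ ≤ 1 / q.totient * (q.totient * (q.totient * V)) := by gcongr
      _ = q.totient * V := by field_simp
      _ ≤ q * V := by
        gcongr
        exact_mod_cast Nat.totient_le q
  have h4 : ‖∑ n ∈ Finset.Icc 1 m, ((if Nat.gcd n q = 1 then 0 else vonMangoldt n : ℝ) : ℂ) *
      e (2 * a * n / q)‖ ≤ 2 * V := by
    have h5 : ∀ n : ℕ, (0 : ℝ) ≤ if Nat.gcd n q = 1 then 0 else vonMangoldt n := by
      intro n
      split_ifs
      · exact le_rfl
      · exact vonMangoldt_nonneg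
    calc _ ≤ ∑ n ∈ Finset.Icc 1 m, (if Nat.gcd n q = 1 then 0 else vonMangoldt n : ℝ) := by
          refine (norm_sum_le _ _).trans (Finset.sum_le_sum fun n _ => ?_)
          rw [norm_mul, norm_e, mul_one, Complex.norm_real, Real.norm_of_nonneg (h5 n)]
      _ = ‖((∑ n ∈ Finset.Icc 1 m,
            (if Nat.gcd n q = 1 then 0 else vonMangoldt n : ℝ) : ℝ) : ℂ)‖ := by
          rw [Complex.norm_real, Real.norm_of_nonneg (Finset.sum_nonneg fun n _ => h5 n)]
      _ = ‖∑ n ∈ Finset.Icc 1 m, primeErr (1 : DirichletCharacter ℂ 1) n -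
            ∑ n ∈ Finset.Icc 1 m, primeErr (1 : DirichletCharacter ℂ q) n‖ := by
          rw [Complex.ofReal_sum, ← Finset.sum_sub_distrib]
          simp_rw [primeErr_level_one_sub]
      _ ≤ 2 * V := (norm_sub_le _ _).trans (by linarith [hV 1])
  refine (norm_add_le _ _).trans ?_
  linarith

lemma norm_sum_mul_e_le {z : ℕ → ℂ} {G : ℝ} {M : ℕ} (β : ℝ)
    (h : ∀ m ≤ M, ‖∑ n ∈ Finset.Icc 1 m, z n‖ ≤ G) :
    ‖∑ n ∈ Finset.Ioc 0 M, z n * e (2 * β * n)‖ ≤ (1 + 4 * π * |β| * M) * G := by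
  rw [sum_Ioc_zero_eq_sum_range]
  simp_rw [mul_comm (z _)]
  have hG : 0 ≤ G := (norm_nonneg _).trans (h 0 (Nat.zero_le _))
  refine (norm_sum_range_mul_le (w := fun k => e (2 * β * (k + 1 : ℕ)))
    (z := fun k => z (k + 1)) (G := G) fun k hk => ?_).trans ?_
  · rw [← sum_Ioc_zero_eq_sum_range]
    exact h k hk
  · refine mul_le_mul_of_nonneg_right ?_ hG
    rw [norm_e]
    refine add_le_add le_rfl ((Finset.sum_le_card_nsmul _ _ (4 * π * |β|) fun k _ => ?_).trans
      (le_of_eq ?_))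
    · have h1 : 2 * β * ((k + 1 + 1 : ℕ) : ℝ) = 2 * β * (k + 1 : ℕ) + 2 * β := by
        push_cast
        ring
      rw [h1, e_add, ← mul_sub_one, norm_mul, norm_e, one_mul]
      refine (norm_e_sub_one_le _).trans (le_of_eq ?_)
      rw [abs_mul, abs_two]
      ring
    · rw [Finset.card_range, nsmul_eq_mul, mul_comm]

end MajorArc

section CircleMethod

open ArithmeticFunction Filter

lemma norm_Ftilde_sub_le {A : ℝ} (hA : 1 ≤ A) (α : ℝ) :
    ‖Ftilde A α - ∑ n ∈ Finset.Ioc 0 ⌊A⌋₊, (vonMangoldt n : ℂ) * e (2 * α * n)‖ ≤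
      2 * √A * Real.log A + 1 := by
  obtain ⟨S, hS⟩ : ∃ S, S = (Finset.range (⌊A⌋₊ + 1)).filter
      (fun p => Nat.Prime p ∧ 2 < p ∧ (p : ℝ) ≤ A) := ⟨_, rfl⟩
  have hsub : S ⊆ Finset.Ioc 0 ⌊A⌋₊ := by
    intro p hp
    rw [hS, Finset.mem_filter, Finset.mem_range] at hp
    rw [Finset.mem_Ioc]
    omega
  have hF : Ftilde A α = ∑ n ∈ S, (vonMangoldt n : ℂ) * e (2 * α * n) := by
    rw [Ftilde, ← hS]
    refine Finset.sum_congr rfl fun p hp => ?_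
    rw [hS, Finset.mem_filter] at hp
    rw [vonMangoldt_apply_prime hp.2.1]
    congr 2
    ring
  rw [hF, ← Finset.sum_sdiff hsub, sub_add_cancel_right, norm_neg]
  have hsub' : Finset.Ioc 0 ⌊A⌋₊ \ S ⊆
      insert 2 ((Finset.Ioc 0 ⌊A⌋₊).filter fun n => ¬ n.Prime) := by
    intro p hp
    rw [Finset.mem_sdiff, Finset.mem_Ioc, hS, Finset.mem_filter, Finset.mem_range] at hp
    rw [Finset.mem_insert, Finset.mem_filter, Finset.mem_Ioc]
    by_cases hpp : p.Prime
    · left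
      have h1 : (p : ℝ) ≤ A := (Nat.le_floor_iff (by linarith)).1 hp.1.2
      have h2 := hpp.two_le
      by_contra h3
      exact hp.2 ⟨by omega, hpp, by omega, h1⟩
    · exact Or.inr ⟨hp.1, hpp⟩
  calc _ ≤ ∑ n ∈ Finset.Ioc 0 ⌊A⌋₊ \ S, vonMangoldt n := by
        refine (norm_sum_le _ _).trans (Finset.sum_le_sum fun n _ => ?_)
        rw [norm_mul, norm_e, mul_one, Complex.norm_real, Real.norm_of_nonneg vonMangoldt_nonneg]
    _ ≤ ∑ n ∈ insert 2 ((Finset.Ioc 0 ⌊A⌋₊).filter fun n => ¬ n.Prime), vonMangoldt n :=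
        Finset.sum_le_sum_of_subset_of_nonneg hsub' fun _ _ _ => vonMangoldt_nonneg
    _ = Real.log 2 + (Chebyshev.psi A - Chebyshev.theta A) := by
        rw [Finset.sum_insert (by simp [Nat.prime_two]), Chebyshev.psi_sub_theta_eq_sum_not_prime,
          vonMangoldt_apply_prime Nat.prime_two]
        push_cast
        rfl
    _ ≤ _ := by
        have h1 := Chebyshev.psi_sub_theta_le hA
        have h2 := Real.log_two_lt_d9
        linarith

lemma norm_utilde_sub_le {A : ℝ} (hA : 0 ≤ A) (β : ℝ) :
    ‖utilde A β - ∑ n ∈ Finset.Ioc 0 ⌊A⌋₊, e (2 * β * n)‖ ≤ 2 := by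
  obtain ⟨S, hS⟩ : ∃ S, S = (Finset.range (⌊A⌋₊ + 1)).filter
      (fun n : ℕ => 2 < n ∧ (n : ℝ) ≤ A) := ⟨_, rfl⟩
  have hsub : S ⊆ Finset.Ioc 0 ⌊A⌋₊ := by
    intro p hp
    rw [hS, Finset.mem_filter, Finset.mem_range] at hp
    rw [Finset.mem_Ioc]
    omega
  have hF : utilde A β = ∑ n ∈ S, e (2 * β * n) := by
    have himage : (Finset.range (⌊A⌋₊ + 1) >>= fun n => pure (n : ℝ)) =
        (Finset.range (⌊A⌋₊ + 1)).image (Nat.cast : ℕ → ℝ) := by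
      ext x
      simp [Finset.bind_def, eq_comm]
    rw [utilde, himage, Finset.filter_image, Finset.sum_image (by simp)]
    refine Finset.sum_congr (hS ▸ Finset.filter_congr fun n _ => ?_) fun p _ => ?_
    · rw [Nat.ofNat_lt_cast]
    · congr 1
      ring
  rw [hF, ← Finset.sum_sdiff hsub, sub_add_cancel_right, norm_neg]
  have hsub' : Finset.Ioc 0 ⌊A⌋₊ \ S ⊆ Finset.Icc 1 2 := by
    intro p hp
    rw [Finset.mem_sdiff, Finset.mem_Ioc, hS, Finset.mem_filter, Finset.mem_range] at hp
    have h1 : (p : ℝ) ≤ A := (Nat.le_floor_iff hA).1 hp.1.2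
    rw [Finset.mem_Icc]
    refine ⟨hp.1.1, ?_⟩
    by_contra h3
    exact hp.2 ⟨by omega, by omega, h1⟩
  have hcard := Finset.card_le_card hsub'
  rw [Nat.card_Icc] at hcard
  have hcard' : ((Finset.Ioc 0 ⌊A⌋₊ \ S).card : ℝ) ≤ 2 := by exact_mod_cast hcard
  refine (norm_sum_le _ _).trans ((Finset.sum_le_card_nsmul _ _ 1
    fun n _ => (norm_e _).le).trans ?_)
  rwa [nsmul_eq_mul, mul_one]

lemma norm_sum_Ioc_e_le {β : ℝ} (hβ : β ≠ 0) (hβ1 : 4 * |β| ≤ 1) (M : ℕ) :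
    ‖∑ n ∈ Finset.Ioc 0 M, e (2 * β * n)‖ ≤ 1 + 1 / (4 * |β|) := by
  have h1 := norm_sum_range_e_near_rat_le (q := 1) (h := 1) 0 one_pos one_pos hβ (by simpa) M
  have h2 : ∑ n ∈ Finset.Ioc 0 M, e (2 * β * n) =
      e (2 * β) * ∑ k ∈ Finset.range M, e (2 * ((0 : ℤ) / (1 : ℕ) + β) * (1 : ℕ) * k) := by
    rw [sum_Ioc_zero_eq_sum_range, Finset.mul_sum]
    refine Finset.sum_congr rfl fun k _ => ?_
    rw [← e_add]
    congr 1
    push_cast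
    ring
  rw [h2, norm_mul, norm_e, one_mul]
  simpa using h1

/-- The main term of `∑ Λ(n) e(2αn)` when `α` is very close to a rational number. -/
lemma eventually_norm_sum_vonMangoldt_sub_mul_e_le {lam : ℝ} (hlam : 0 < lam) :
    ∃ c > 0, c ≤ 1 ∧ ∀ᶠ L : ℝ in atTop, ∀ A : ℝ, Real.exp (3 * L ^ 2 / 4) ≤ A →
      A ≤ Real.exp (L ^ 2) → ∀ (q a : ℕ) (β : ℝ), 0 < q → (q : ℝ) ≤ L ^ (2 * lam) →
      A * |β| ≤ Real.exp (c / 4 * L) →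
      ‖∑ n ∈ Finset.Ioc 0 ⌊A⌋₊, ((vonMangoldt n : ℂ) * e (2 * a * n / q) -
        ramanujanC q (2 * (a : ℤ)) / q.totient) * e (2 * β * n)‖ ≤
        A * Real.exp (-(c / 2 * L)) := by
  obtain ⟨c, hc0, hc1, H⟩ := eventually_norm_sum_primeErr_le hlam
  refine ⟨c, hc0, hc1, ?_⟩
  filter_upwards [H, eventually_ge_atTop (1 : ℝ),
    eventually_mul_rpow_le_exp 51 (2 * lam) (show 0 < c / 4 by linarith)] with L hL hL1 hL2
      A hA1 hA2 q a β hq hqP hβ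
  have hA0 : 0 < A := (Real.exp_pos _).trans_le hA1
  have : NeZero q := ⟨hq.ne'⟩
  obtain ⟨P, hP⟩ : ∃ P, P = L ^ (2 * lam) := ⟨_, rfl⟩
  have hP1 : 1 ≤ P := hP ▸ Real.one_le_rpow hL1 (by linarith)
  rw [← hP] at hqP hL2
  have hbound : ∀ {r : ℕ} [NeZero r] (χ : DirichletCharacter ℂ r), (r : ℝ) ≤ P →
      ∀ m ≤ ⌊A⌋₊, ‖∑ n ∈ Finset.Icc 1 m, primeErr χ n‖ ≤ A * Real.exp (-(c * L)) := by
    intro r _ χ hr m hm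
    have h1 := hL r χ (hP ▸ hr) A hA1 hA2 m (Nat.cast_nonneg m)
      ((Nat.le_floor_iff hA0.le).1 hm)
    rwa [Nat.floor_natCast] at h1
  have h1 : ∀ m ≤ ⌊A⌋₊, ‖∑ n ∈ Finset.Icc 1 m, ((vonMangoldt n : ℂ) * e (2 * a * n / q) -
      ramanujanC q (2 * (a : ℤ)) / q.totient)‖ ≤ (q + 2) * (A * Real.exp (-(c * L))) :=
    fun m hm => norm_sum_vonMangoldt_mul_e_sub_le a (hbound _ (by simpa using hP1) m hm)
      fun χ => hbound χ hqP m hm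
  refine (norm_sum_mul_e_le β h1).trans ?_
  have h2 : 1 + 4 * π * |β| * ⌊A⌋₊ ≤ 17 * Real.exp (c / 4 * L) := by
    have h3 : |β| * ⌊A⌋₊ ≤ Real.exp (c / 4 * L) :=
      (by gcongr; exact Nat.floor_le hA0.le : |β| * ⌊A⌋₊ ≤ |β| * A).trans (by rwa [mul_comm])
    have h4 : 1 ≤ Real.exp (c / 4 * L) := Real.one_le_exp (by positivity)
    have h5 : 4 * π * (|β| * ⌊A⌋₊) ≤ 16 * Real.exp (c / 4 * L) := by
      gcongr
      linarith [Real.pi_le_four]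
    linarith
  calc (1 + 4 * π * |β| * ⌊A⌋₊) * ((q + 2) * (A * Real.exp (-(c * L))))
      ≤ 17 * Real.exp (c / 4 * L) * ((3 * P) * (A * Real.exp (-(c * L)))) := by
        gcongr
        linarith
    _ = 51 * P * (Real.exp (c / 4 * L) * (A * Real.exp (-(c * L)))) := by ring
    _ ≤ Real.exp (c / 4 * L) * (Real.exp (c / 4 * L) * (A * Real.exp (-(c * L)))) := by gcongr
    _ = A * (Real.exp (c / 4 * L) * Real.exp (c / 4 * L) * Real.exp (-(c * L))) := by ring
    _ = A * Real.exp (-(c / 2 * L)) := by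
      rw [← Real.exp_add, ← Real.exp_add]
      congr 2
      ring

/-- The approximation of `F̃` in terms of `L = √log N`. -/
lemma eventually_norm_Ftilde_sub_le {lam : ℝ} (hlam : 0 < lam) :
    ∃ c > 0, ∀ᶠ L : ℝ in atTop, ∀ A : ℝ, Real.exp (3 * L ^ 2 / 4) ≤ A →
      A ≤ Real.exp (L ^ 2) → ∀ (q a : ℕ) (β : ℝ), 0 < q → (q : ℝ) ≤ L ^ (2 * lam) →
      A * |β| ≤ L ^ (2 * lam) * Real.exp L →
      ‖Ftilde A (a / q + β) - ramanujanC q (2 * (a : ℤ)) / q.totient * utilde A β‖ ≤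
        4 * A * Real.exp (-c * L) := by
  obtain ⟨c, hc0, hc1, H⟩ := eventually_norm_sum_vonMangoldt_sub_mul_e_le hlam
  refine ⟨c / 16, by positivity, ?_⟩
  filter_upwards [H, eventually_ge_atTop (8 : ℝ),
    eventually_norm_sum_vonMangoldt_mul_e_le hlam (show 0 < c / 4 by linarith) (by linarith),
    eventually_mul_rpow_le_exp 4 (2 * lam) (zero_lt_one' ℝ),
    eventually_mul_pow_le_exp 7 2 (zero_lt_one' ℝ)] with L hsmall hL hlarge hL1 hL2
      A hA1 hA2 q a β hq hqP hβ
  have hL0 : 0 < L := by linarith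
  rw [one_mul] at hL1 hL2
  have hA2L : Real.exp (4 * L) ≤ A := (Real.exp_le_exp.2 (by nlinarith)).trans hA1
  have hA0 : 0 < A := (Real.exp_pos _).trans_le hA1
  have hA1' : 1 ≤ A := (Real.one_le_exp (by positivity)).trans hA1
  obtain ⟨κ, hκ⟩ : ∃ κ, κ = ramanujanC q (2 * (a : ℤ)) / q.totient := ⟨_, rfl⟩
  have hφ : (0 : ℝ) < q.totient := by exact_mod_cast Nat.totient_pos.2 hq
  have hκ1 : ‖κ‖ ≤ 1 := by
    rw [hκ, norm_div, Complex.norm_natCast, div_le_one hφ]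
    exact norm_ramanujanC_le _ _
  rw [← hκ]
  obtain ⟨T, hT⟩ : ∃ T, T = ∑ n ∈ Finset.Ioc 0 ⌊A⌋₊,
      (vonMangoldt n : ℂ) * e (2 * (a / q + β) * n) := ⟨_, rfl⟩
  obtain ⟨u, hu⟩ : ∃ u, u = ∑ n ∈ Finset.Ioc 0 ⌊A⌋₊, e (2 * β * n) := ⟨_, rfl⟩
  have hFT := norm_Ftilde_sub_le hA1' (a / q + β)
  rw [← hT] at hFT
  have hUu := norm_utilde_sub_le hA0.le β
  rw [← hu] at hUu
  have hκUu : ‖κ * (utilde A β - u)‖ ≤ 2 := by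
    rw [norm_mul]
    calc ‖κ‖ * ‖utilde A β - u‖ ≤ 1 * 2 := by gcongr
      _ = 2 := one_mul _
  obtain ⟨Y, hY⟩ : ∃ Y, Y = A * Real.exp (-(c / 16 * L)) := ⟨_, rfl⟩
  have hmono : ∀ x, c / 16 ≤ x → A * Real.exp (-(x * L)) ≤ Y := by
    intro x hx
    rw [hY]
    gcongr
  have herr : 2 * √A * Real.log A + 3 ≤ Y := by
    have hsA : Real.exp (2 * L) ≤ √A := by
      apply Real.le_sqrt_of_sq_le
      rw [← Real.exp_nat_mul]
      convert hA2L using 2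
      push_cast
      ring
    have hlogA : Real.log A ≤ L ^ 2 := (Real.log_le_iff_le_exp hA0).2 hA2
    have hsA1 : 1 ≤ √A := (Real.one_le_exp (by positivity)).trans hsA
    have hLL : 1 ≤ L ^ 2 := one_le_pow₀ (by linarith)
    refine le_trans ?_ (hmono 1 (by linarith))
    have h5 : √A * Real.exp L ≤ A * Real.exp (-(1 * L)) := by
      have h6 : √A * Real.exp (2 * L) ≤ A := by
        calc √A * Real.exp (2 * L) ≤ √A * √A := by gcongr
          _ = A := Real.mul_self_sqrt hA0.le
      have h7 : Real.exp L = Real.exp (2 * L) * Real.exp (-(1 * L)) := by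
        rw [← Real.exp_add]
        congr 1
        ring
      rw [h7, ← mul_assoc]
      gcongr
    refine le_trans ?_ h5
    calc 2 * √A * Real.log A + 3 ≤ 2 * √A * L ^ 2 + 3 * (√A * L ^ 2) := by
          gcongr
          nlinarith
      _ ≤ √A * (7 * L ^ 2) := by nlinarith [mul_nonneg (Real.sqrt_nonneg A) (sq_nonneg L)]
      _ ≤ √A * Real.exp L := by gcongr
  have hmain : ‖T - κ * u‖ ≤ 3 * Y := by
    have hY0 : 0 ≤ Y := by rw [hY]; positivity
    rcases le_total (A * |β|) (Real.exp (c / 4 * L)) with h | h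
    · have h1 := (hsmall A hA1 hA2 q a β hq hqP h).trans (hmono _ (by linarith))
      have h2 : T - κ * u = ∑ n ∈ Finset.Ioc 0 ⌊A⌋₊, ((vonMangoldt n : ℂ) * e (2 * a * n / q) -
          ramanujanC q (2 * (a : ℤ)) / q.totient) * e (2 * β * n) := by
        rw [hT, hu, Finset.mul_sum, ← Finset.sum_sub_distrib, ← hκ]
        refine Finset.sum_congr rfl fun n _ => ?_
        have h3 : e (2 * (a / q + β) * n) = e (2 * a * n / q) * e (2 * β * n) := by
          rw [← e_add]
          congr 1
          ring
        rw [h3]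
        ring
      rw [h2]
      linarith
    · have h1 := (hlarge A hA1 hA2 q a β hq hqP h hβ).trans (hmono _ (by linarith))
      have hβ0 : 0 < |β| := by
        by_contra h0
        have h0' : |β| = 0 := le_antisymm (not_lt.1 h0) (abs_nonneg _)
        rw [h0', mul_zero] at h
        exact absurd h (not_le.2 (Real.exp_pos _))
      have hβ4 : 4 * |β| ≤ 1 := by
        refine le_of_mul_le_mul_left ?_ hA0
        calc A * (4 * |β|) = 4 * (A * |β|) := by ring
          _ ≤ 4 * L ^ (2 * lam) * Real.exp L := by linarith
          _ ≤ Real.exp L * Real.exp L := by gcongr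
          _ = Real.exp (L + L) := (Real.exp_add _ _).symm
          _ ≤ Real.exp (4 * L) := Real.exp_le_exp.2 (by linarith)
          _ ≤ A * 1 := by rwa [mul_one]
      have h2 := norm_sum_Ioc_e_le (abs_pos.1 hβ0) hβ4 ⌊A⌋₊
      rw [← hu] at h2
      have h3 : 1 / (4 * |β|) ≤ Y := by
        refine le_trans ?_ (hmono (c / 4) (by linarith))
        rw [div_le_iff₀ (by positivity)]
        have h4 : Real.exp (c / 4 * L) * Real.exp (-(c / 4 * L)) = 1 := by
          rw [← Real.exp_add, add_neg_cancel, Real.exp_zero]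
        calc (1 : ℝ) = Real.exp (c / 4 * L) * Real.exp (-(c / 4 * L)) := h4.symm
          _ ≤ A * |β| * Real.exp (-(c / 4 * L)) := by gcongr
          _ ≤ 4 * (A * |β| * Real.exp (-(c / 4 * L))) := le_mul_of_one_le_left (by positivity)
            (by norm_num)
          _ = A * Real.exp (-(c / 4 * L)) * (4 * |β|) := by ring
      have h5 : 1 ≤ Y := by
        have : 0 ≤ 2 * √A * Real.log A := mul_nonneg (by positivity) (Real.log_nonneg hA1')
        linarith
      have h6 : ‖κ * u‖ ≤ 1 + 1 / (4 * |β|) := by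
        rw [norm_mul]
        calc ‖κ‖ * ‖u‖ ≤ 1 * (1 + 1 / (4 * |β|)) := by gcongr
          _ = _ := one_mul _
      refine (norm_sub_le _ _).trans ?_
      have h7 : ‖T‖ ≤ Y := by
        rw [hT]
        simpa using h1
      linarith
  have hsplit : Ftilde A (a / q + β) - κ * utilde A β =
      (Ftilde A (a / q + β) - T) + (T - κ * u) - κ * (utilde A β - u) := by ring
  rw [hsplit]
  have h1 := norm_sub_le ((Ftilde A (a / q + β) - T) + (T - κ * u)) (κ * (utilde A β - u))
  have h2 := norm_add_le (Ftilde A (a / q + β) - T) (T - κ * u)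
  have h3 : 4 * A * Real.exp (-(c / 16) * L) = 4 * Y := by
    rw [hY, neg_mul]
    ring
  rw [h3]
  linarith

end CircleMethod

theorem stmt9 (lam ε : ℝ) (hlam : 0 < lam) (hε : ε ∈ Set.Ioo (0 : ℝ) 1) :
    ∃ c₄ > (0 : ℝ), ∃ C > (0 : ℝ), ∃ N₀ : ℕ, ∀ N : ℕ, N₀ ≤ N → Even N →
      ∀ q a : ℕ, 1 ≤ q → (q : ℝ) ≤ Qof lam N → a < q → Nat.gcd a q = 1 →
        ∀ α : ℝ, |α - (a : ℝ) / q| ≤ 1 / tauof ε lam N →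
          ‖Ftilde (Aof ε N) α -
              (ramanujanC q (2 * (a : ℤ)) / (Nat.totient q : ℂ)) *
                utilde (Aof ε N) (α - (a : ℝ) / q)‖ ≤
            C * Aof ε N * Real.exp (-c₄ * Real.sqrt (Real.log N)) := by
  obtain ⟨c, hc, H⟩ := eventually_norm_Ftilde_sub_le hlam
  have htend : Filter.Tendsto (fun N : ℕ => √(Real.log N)) Filter.atTop Filter.atTop :=
    Real.tendsto_sqrt_atTop.comp (Real.tendsto_log_atTop.comp tendsto_natCast_atTop_atTop)
  obtain ⟨N₀, hN₀⟩ := Filter.eventually_atTop.1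
    (htend.eventually (H.and (Filter.eventually_ge_atTop (4 : ℝ))))
  refine ⟨c, hc, 4, by norm_num, N₀, fun N hN _ q a hq hqQ _ _ α hα => ?_⟩
  obtain ⟨hmain, hL4⟩ := hN₀ N hN
  obtain ⟨L, hL⟩ : ∃ L, L = √(Real.log N) := ⟨_, rfl⟩
  rw [← hL] at hmain hL4 ⊢
  have hlog0 : 0 < Real.log N := by
    by_contra h
    rw [Real.sqrt_eq_zero_of_nonpos (not_lt.1 h)] at hL
    linarith
  have hN0 : (0 : ℝ) < N := by
    rcases Nat.eq_zero_or_pos N with h | h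
    · rw [h] at hlog0
      simp at hlog0
    · exact_mod_cast h
  have hLL : L ^ 2 = Real.log N := by rw [hL, Real.sq_sqrt hlog0.le]
  have hNexp : (N : ℝ) = Real.exp (L ^ 2) := by rw [hLL, Real.exp_log hN0]
  have hA : Aof ε N = Real.exp (L ^ 2 + -ε * L) := by
    rw [Aof, ← hL, Real.exp_add, ← hNexp]
  have hQ : Qof lam N = L ^ (2 * lam) := by
    rw [Qof, ← hLL, Real.rpow_mul (by linarith), Real.rpow_two]
  have hA0 : 0 < Aof ε N := by rw [hA]; exact Real.exp_pos _
  have hQ0 : 0 < Qof lam N := Real.rpow_pos_of_pos hlog0 _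
  have hβ : Aof ε N * |α - a / q| ≤ L ^ (2 * lam) * Real.exp L := by
    calc Aof ε N * |α - a / q| ≤ Aof ε N * (1 / tauof ε lam N) := by gcongr
      _ = Qof lam N * (N / Aof ε N) := by
        rw [tauof]
        field_simp
      _ = L ^ (2 * lam) * Real.exp (ε * L) := by
        rw [hQ, hA, hNexp, ← Real.exp_sub]
        congr 2
        ring
      _ ≤ L ^ (2 * lam) * Real.exp L := by
        gcongr
        nlinarith [hε.2]
  have h1 := hmain (Aof ε N)
    (by rw [hA]; exact Real.exp_le_exp.2 (by nlinarith [hε.2, hε.1]))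
    (by rw [hA]; exact Real.exp_le_exp.2 (by nlinarith [hε.2, hε.1]))
    q a (α - a / q) hq (hQ ▸ hqQ) hβ
  rwa [add_sub_cancel] at h1
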